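/- O_q(G) is an 𝓗-UFD: every nonzero 𝓗-invariant prime ideal of O_q(G) contains a height one 𝓗-invariant prime ideal which is generated by a normal element that is an 𝓗-eigenvector. -/

import Mathlib

open scoped TensorProduct

/-- The `q`-factorial `(q - q⁻¹)(q² - q⁻²)⋯(qᵐ - q⁻ᵐ)`. -/
noncomputable def qfac (t : ℂ) (m : ℕ) : ℂ :=
  ∏ j ∈ Finset.range m, (t ^ (j + 1) - t⁻¹ ^ (j + 1))

/-- The `q`-binomial coefficient `[m k]` at parameter `t`. -/
noncomputable def qbinom (t : ℂ) (m k : ℕ) : ℂ :=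
  qfac t m / (qfac t k * qfac t (m - k))

/-- The defining relations of the quantised enveloping algebra `U_q(𝔤)` associated to a
Cartan matrix `a` with symmetrising integers `d`, on elements `E i`, `F i`, `K i` of a
`ℂ`-algebra `B`: the `K i` are commuting units, conjugation by `K i` rescales `E j` and
`F j` by `q_i^{±a i j}` (where `q_i = q^{d i}`), the commutator `[E i, F j]` is
`δ_{ij} (K_i - K_i⁻¹)/(q_i - q_i⁻¹)`, and the quantum Serre relations hold. -/
def UqRels (q : ℂ) {n : ℕ} (a : Fin n → Fin n → ℤ) (d : Fin n → ℕ)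
    (B : Type) [Ring B] [Algebra ℂ B] (E F : Fin n → B) (K : Fin n → Bˣ) : Prop :=
  (∀ i j, (K i : B) * (K j : B) = (K j : B) * (K i : B)) ∧
  (∀ i j, (K i : B) * E j = (q ^ ((d i : ℤ) * a i j)) • (E j * (K i : B))) ∧
  (∀ i j, (K i : B) * F j = (q ^ (-((d i : ℤ) * a i j))) • (F j * (K i : B))) ∧
  (∀ i j, E i * F j - F j * E i =
    if i = j then (q ^ (d i : ℤ) - q ^ (-(d i : ℤ)))⁻¹ • ((K i : B) - (((K i)⁻¹ : Bˣ) : B))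
    else 0) ∧
  (∀ i j, i ≠ j → ∑ k ∈ Finset.range ((1 - a i j).toNat + 1),
      ((-1 : ℂ) ^ k * qbinom (q ^ (d i : ℤ)) ((1 - a i j).toNat) k) •
        (E i ^ ((1 - a i j).toNat - k) * E j * E i ^ k) = 0) ∧
  (∀ i j, i ≠ j → ∑ k ∈ Finset.range ((1 - a i j).toNat + 1),
      ((-1 : ℂ) ^ k * qbinom (q ^ (d i : ℤ)) ((1 - a i j).toNat) k) •
        (F i ^ ((1 - a i j).toNat - k) * F j * F i ^ k) = 0)

/-- The weight space of weight `μ = ∑ μ i ϖ i` in a `U_q(𝔤)`-module: the set of vectors on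
which each `K i` acts by the scalar `q^{(μ, α_i)} = q^{μ i * d i}`. -/
noncomputable def wtSp (q : ℂ) {n : ℕ} (d : Fin n → ℕ)
    {U : Type} [Ring U] [Algebra ℂ U] (K : Fin n → Uˣ)
    {Vc : Type} [AddCommGroup Vc] [Module ℂ Vc] (ρ : U →ₐ[ℂ] Module.End ℂ Vc)
    (μ : Fin n → ℤ) : Submodule ℂ Vc :=
  ⨅ i : Fin n, LinearMap.ker (ρ (K i : U) - (q ^ (μ i * (d i : ℤ))) • (1 : Module.End ℂ Vc))

/-- `ξ` is a dual vector of weight `μ`:  equivalently (via the antipode-twisted action on the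
dual module), `ξ` vanishes on every weight space of weight `ν ≠ -μ`. -/
noncomputable def inDualWt (q : ℂ) {n : ℕ} (d : Fin n → ℕ)
    {U : Type} [Ring U] [Algebra ℂ U] (K : Fin n → Uˣ)
    {Vc : Type} [AddCommGroup Vc] [Module ℂ Vc] (ρ : U →ₐ[ℂ] Module.End ℂ Vc)
    (μ : Fin n → ℤ) (ξ : Module.Dual ℂ Vc) : Prop :=
  ∀ ν : Fin n → ℤ, ν ≠ -μ → ∀ x ∈ wtSp q d K ρ ν, ξ x = 0

/-- The Demazure-type submodule generated by the weight space of weight `ν` under the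
subalgebra of `U` generated by `gens` (take `gens = Set.range E` for `V⁺_w(λ)` with
`ν = wλ`, and `gens = Set.range F` for `V⁻_w(λ)`). -/
noncomputable def demazure (q : ℂ) {n : ℕ} (d : Fin n → ℕ)
    {U : Type} [Ring U] [Algebra ℂ U] (gens : Set U) (K : Fin n → Uˣ)
    {Vc : Type} [AddCommGroup Vc] [Module ℂ Vc] (ρ : U →ₐ[ℂ] Module.End ℂ Vc)
    (ν : Fin n → ℤ) : Submodule ℂ Vc :=
  Submodule.span ℂ
    {x | ∃ y ∈ Algebra.adjoin ℂ gens, ∃ u ∈ wtSp q d K ρ ν, x = ρ y u}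

/-- A two-sided ideal of a (possibly noncommutative) ring is prime if it is proper and
`x R y ⊆ P` implies `x ∈ P` or `y ∈ P`. -/
def IsPrimeTwoSided {R : Type*} [Ring R] (P : TwoSidedIdeal R) : Prop :=
  P ≠ ⊤ ∧ ∀ x y : R, (∀ r : R, x * r * y ∈ P) → x ∈ P ∨ y ∈ P

/-- An element `r` of a ring is normal if `rR = Rr`. -/
def IsNormalElem {R : Type*} [Ring R] (r : R) : Prop :=
  (∀ x, ∃ y, r * x = y * r) ∧ ∀ x, ∃ y, x * r = r * y

/-- The ideal `Q⁺_{w}` of `O_q(G)`: generated by the coordinate functions `c^{ϖ_j}_{ξ,v}` with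
`v` a highest weight vector of `V(ϖ_j)` and `ξ` orthogonal to the Demazure module
`V⁺_w(ϖ_j)`. -/
noncomputable def Qplus (q : ℂ) {n : ℕ} (d : Fin n → ℕ)
    {U : Type} [Ring U] [Algebra ℂ U] (E : Fin n → U) (K : Fin n → Uˣ)
    {V : (Fin n → ℕ) → Type} [∀ c, AddCommGroup (V c)] [∀ c, Module ℂ (V c)]
    (ρ : ∀ c, U →ₐ[ℂ] Module.End ℂ (V c))
    {W : Type} [Group W] (σ : W →* Multiplicative (AddAut (Fin n → ℤ)))
    {A : Type} [Ring A]
    (cf : ∀ c : Fin n → ℕ, Module.Dual ℂ (V c) → V c → A)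
    (w : W) : TwoSidedIdeal A :=
  TwoSidedIdeal.span
    {x | ∃ j : Fin n, ∃ ξ : Module.Dual ℂ (V (Pi.single j 1)),
      ∃ v ∈ wtSp q d K (ρ (Pi.single j 1)) (fun k => ((Pi.single j 1 : Fin n → ℕ) k : ℤ)),
        (∀ y ∈ demazure q d (Set.range E) K (ρ (Pi.single j 1))
            (σ w (fun k => ((Pi.single j 1 : Fin n → ℕ) k : ℤ))), ξ y = 0) ∧
        x = cf (Pi.single j 1) ξ v}

/-- The ideal `Q⁻_{w}` of `O_q(G)`: generated by the coordinate functions `c^{ϖ_j}_{ξ,v}` with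
`v` a lowest weight vector of `V(ϖ_j)` and `ξ` orthogonal to the Demazure module
`V⁻_{w w₀}(ϖ_j)`. -/
noncomputable def Qminus (q : ℂ) {n : ℕ} (d : Fin n → ℕ)
    {U : Type} [Ring U] [Algebra ℂ U] (F : Fin n → U) (K : Fin n → Uˣ)
    {V : (Fin n → ℕ) → Type} [∀ c, AddCommGroup (V c)] [∀ c, Module ℂ (V c)]
    (ρ : ∀ c, U →ₐ[ℂ] Module.End ℂ (V c))
    {W : Type} [Group W] (σ : W →* Multiplicative (AddAut (Fin n → ℤ))) (w₀ : W)
    {A : Type} [Ring A]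
    (cf : ∀ c : Fin n → ℕ, Module.Dual ℂ (V c) → V c → A)
    (w : W) : TwoSidedIdeal A :=
  TwoSidedIdeal.span
    {x | ∃ j : Fin n, ∃ ξ : Module.Dual ℂ (V (Pi.single j 1)),
      ∃ v ∈ wtSp q d K (ρ (Pi.single j 1)) (σ w₀ (fun k => ((Pi.single j 1 : Fin n → ℕ) k : ℤ))),
        (∀ y ∈ demazure q d (Set.range F) K (ρ (Pi.single j 1))
            (σ (w * w₀) (fun k => ((Pi.single j 1 : Fin n → ℕ) k : ℤ))), ξ y = 0) ∧
        x = cf (Pi.single j 1) ξ v}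



namespace OQ

/-- nonzero and not a root of unity -/
def NotRU (q : ℂ) : Prop := q ≠ 0 ∧ ∀ m : ℤ, q ^ m = 1 → m = 0

theorem NotRU.inv {q : ℂ} (h : NotRU q) : NotRU q⁻¹ := by
  refine ⟨inv_ne_zero h.1, fun m hm => ?_⟩
  rw [inv_zpow, inv_eq_one] at hm
  exact h.2 m hm

theorem NotRU.inj {q : ℂ} (h : NotRU q) {m l : ℤ} (e : q ^ m = q ^ l) : m = l := by
  have := h.2 (m - l) (by rw [zpow_sub₀ h.1, e, div_self (zpow_ne_zero _ h.1)])
  omega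

theorem NotRU.zpow_ne {q : ℂ} (h : NotRU q) (m : ℤ) : q ^ m ≠ 0 := zpow_ne_zero _ h.1

theorem NotRU.ne_one {q : ℂ} (h : NotRU q) {m : ℤ} (hm : m ≠ 0) : q ^ m ≠ 1 :=
  fun e => hm (h.2 m e)

theorem notRU_of_transcendental {q : ℂ} (hq : Transcendental ℚ q) : NotRU q := by
  have h0 : q ≠ 0 := by
    rintro rfl
    exact hq isAlgebraic_zero
  have key : ∀ m : ℕ, q ^ m = 1 → m = 0 := by
    intro m hm
    by_contra hm0
    apply hq
    have h1 : IsAlgebraic ℚ (q ^ m) := by rw [hm]; exact isAlgebraic_one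
    exact IsAlgebraic.of_pow (Nat.pos_of_ne_zero hm0) h1
  refine ⟨h0, fun m hm => ?_⟩
  obtain ⟨k, rfl | rfl⟩ := m.eq_nat_or_neg
  · rw [zpow_natCast] at hm
    exact_mod_cast key k hm
  · rw [zpow_neg, zpow_natCast, inv_eq_one] at hm
    simp [key k hm]

section weights
variable {n : ℕ} {M : Type*} [AddCommGroup M] [Module ℂ M]

/-- `x` is a weight vector of weight `μ` for commuting operators `k`. -/
def IsWt (q : ℂ) (d : Fin n → ℕ) (k : Fin n → M → M) (μ : Fin n → ℤ) (x : M) : Prop :=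
  ∀ i, k i x = q ^ ((d i : ℤ) * μ i) • x

theorem comp_mem {q : ℂ} (hq : NotRU q) {d : Fin n → ℕ} (hd : ∀ i, 0 < d i)
    (k : Fin n → M →ₗ[ℂ] M) (S : Submodule ℂ M) (hS : ∀ i, ∀ x ∈ S, k i x ∈ S)
    (s : Finset (Fin n → ℤ)) :
    ∀ (w : (Fin n → ℤ) → M), (∀ μ ∈ s, IsWt q d (fun i => k i) μ (w μ)) →
      ∑ μ ∈ s, w μ ∈ S → ∀ μ ∈ s, w μ ∈ S := by
  classical
  induction s using Finset.induction_on with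
  | empty => simp
  | insert μ0 s hμ0 ih =>
    intro w hw hsum
    have hs : ∀ ν ∈ s, w ν ∈ S := by
      intro ν hν
      have hne : ν ≠ μ0 := by rintro rfl; exact hμ0 hν
      obtain ⟨i, hi⟩ := Function.ne_iff.mp hne
      let c : (Fin n → ℤ) → ℂ := fun μ => q ^ ((d i : ℤ) * μ i) - q ^ ((d i : ℤ) * μ0 i)
      have h1 : ∑ μ ∈ s, c μ • w μ ∈ S := by
        have h2 : k i (∑ μ ∈ insert μ0 s, w μ) - q ^ ((d i : ℤ) * μ0 i) • (∑ μ ∈ insert μ0 s, w μ)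
            ∈ S := S.sub_mem (hS i _ hsum) (S.smul_mem _ hsum)
        convert h2 using 1
        rw [map_sum, Finset.smul_sum, ← Finset.sum_sub_distrib, Finset.sum_insert hμ0]
        have h0 : k i (w μ0) = _ := hw μ0 (Finset.mem_insert_self _ _) i
        rw [h0, sub_self, zero_add]
        refine Finset.sum_congr rfl fun μ hμ => ?_
        have h3 : k i (w μ) = _ := hw μ (Finset.mem_insert_of_mem hμ) i
        rw [h3, sub_smul]
      have h4 := ih (fun μ => c μ • w μ) (fun μ hμ j => by
        have h3 : k j (w μ) = _ := hw μ (Finset.mem_insert_of_mem hμ) j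
        simp only [map_smul]
        rw [h3, smul_comm]) h1 ν hν
      have hc : c ν ≠ 0 := by
        intro h
        have := hq.inj (sub_eq_zero.mp h)
        have hdi : (d i : ℤ) ≠ 0 := by have := hd i; omega
        exact hi (mul_left_cancel₀ hdi this)
      have h5 := S.smul_mem (c ν)⁻¹ h4
      rwa [smul_smul, inv_mul_cancel₀ hc, one_smul] at h5
    intro μ hμ
    rcases Finset.mem_insert.mp hμ with rfl | hμ
    · rw [Finset.sum_insert hμ0] at hsum
      have := S.sub_mem hsum (S.sum_mem hs)
      simpa using this
    · exact hs μ hμ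

/-- The module is spanned by weight vectors. -/
def WtSpan (q : ℂ) (d : Fin n → ℕ) (k : Fin n → M → M) : Prop :=
  ∀ x : M, x ∈ Submodule.span ℂ {y : M | ∃ μ, IsWt q d k μ y}

theorem IsWt.smul {q : ℂ} {d : Fin n → ℕ} {k : Fin n → M →ₗ[ℂ] M} {μ : Fin n → ℤ} {x : M}
    (h : IsWt q d (fun i => k i) μ x) (c : ℂ) : IsWt q d (fun i => k i) μ (c • x) := by
  intro i
  have h1 : k i x = _ := h i
  simp only [map_smul]
  rw [h1, smul_comm]

theorem IsWt.add {q : ℂ} {d : Fin n → ℕ} {k : Fin n → M →ₗ[ℂ] M} {μ : Fin n → ℤ} {x y : M}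
    (h : IsWt q d (fun i => k i) μ x) (h' : IsWt q d (fun i => k i) μ y) :
    IsWt q d (fun i => k i) μ (x + y) := by
  intro i
  have := h i
  have := h' i
  simp only [map_add] at *
  simp [*]

theorem isWt_zero {q : ℂ} {d : Fin n → ℕ} {k : Fin n → M →ₗ[ℂ] M} {μ : Fin n → ℤ} :
    IsWt q d (fun i => k i) μ (0 : M) := by
  intro i; simp

theorem WtSpan.exists_sum {q : ℂ} {d : Fin n → ℕ} {k : Fin n → M →ₗ[ℂ] M}
    (h : WtSpan q d (fun i => k i)) (x : M) :
    ∃ (s : Finset (Fin n → ℤ)) (w : (Fin n → ℤ) → M),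
      (∀ μ, IsWt q d (fun i => k i) μ (w μ)) ∧ (∀ μ, μ ∉ s → w μ = 0) ∧ x = ∑ μ ∈ s, w μ := by
  classical
  refine Submodule.span_induction ?_ ?_ ?_ ?_ (h x)
  · rintro y ⟨μ, hμ⟩
    refine ⟨{μ}, fun ν => if ν = μ then y else 0, fun ν => ?_, fun ν hν => ?_, by simp⟩
    · by_cases h : ν = μ
      · subst h; simpa using hμ
      · simpa [h] using isWt_zero
    · simp at hν; simp [hν]
  · exact ⟨∅, fun _ => 0, fun _ => isWt_zero, fun _ _ => rfl, by simp⟩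
  · rintro x y _ _ ⟨s, w, h1, h2, rfl⟩ ⟨s', w', h1', h2', rfl⟩
    refine ⟨s ∪ s', fun μ => w μ + w' μ, fun μ => (h1 μ).add (h1' μ), fun μ hμ => ?_, ?_⟩
    · rw [Finset.mem_union, not_or] at hμ
      simp [h2 μ hμ.1, h2' μ hμ.2]
    · rw [Finset.sum_add_distrib]
      congr 1
      · exact Finset.sum_subset Finset.subset_union_left fun μ _ hμ => h2 μ hμ
      · exact Finset.sum_subset Finset.subset_union_right fun μ _ hμ => h2' μ hμ
  · rintro c x _ ⟨s, w, h1, h2, rfl⟩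
    refine ⟨s, fun μ => c • w μ, fun μ => (h1 μ).smul c, fun μ hμ => by simp [h2 μ hμ], ?_⟩
    rw [Finset.smul_sum]

theorem WtSpan.le {q : ℂ} (hq : NotRU q) {d : Fin n → ℕ} (hd : ∀ i, 0 < d i)
    {k : Fin n → M →ₗ[ℂ] M} (h : WtSpan q d (fun i => k i)) (S T : Submodule ℂ M)
    (hS : ∀ i, ∀ x ∈ S, k i x ∈ S)
    (hT : ∀ μ x, x ∈ S → IsWt q d (fun i => k i) μ x → x ∈ T) : S ≤ T := by
  intro x hx
  obtain ⟨s, w, h1, -, rfl⟩ := h.exists_sum x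
  exact T.sum_mem fun μ hμ => hT μ _ (comp_mem hq hd k S hS s w (fun μ _ => h1 μ) hx μ hμ) (h1 μ)

end weights

section nil
variable {n : ℕ} {M : Type*} [AddCommGroup M] [Module ℂ M]

/-- vectors killed by all words of length `m` in the operators `e` -/
def nilE (e : Fin n → M →ₗ[ℂ] M) : ℕ → Submodule ℂ M
  | 0 => ⊥
  | m + 1 => ⨅ j, (nilE e m).comap (e j)

theorem mem_nilE_zero {e : Fin n → M →ₗ[ℂ] M} {x : M} : x ∈ nilE e 0 ↔ x = 0 := by
  simp [nilE]

theorem mem_nilE_succ {e : Fin n → M →ₗ[ℂ] M} {m : ℕ} {x : M} :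
    x ∈ nilE e (m + 1) ↔ ∀ j, e j x ∈ nilE e m := by
  simp [nilE]

theorem nilE_mono_succ (e : Fin n → M →ₗ[ℂ] M) (m : ℕ) : nilE e m ≤ nilE e (m + 1) := by
  induction m with
  | zero => intro x hx; rw [mem_nilE_zero] at hx; subst hx; exact Submodule.zero_mem _
  | succ m ih =>
    intro x hx
    rw [mem_nilE_succ] at hx ⊢
    exact fun j => ih (hx j)

theorem nilE_mono (e : Fin n → M →ₗ[ℂ] M) : Monotone (nilE e) :=
  monotone_nat_of_le_succ (nilE_mono_succ e)

/-- Tops: a predicate stable under `e`. -/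
theorem nilE_top (e : Fin n → M →ₗ[ℂ] M) (P : M → Prop) (hP : ∀ j x, P x → P (e j x)) (m : ℕ) :
    ∀ x, x ∈ nilE e m → x ≠ 0 → P x → ∃ y, y ≠ 0 ∧ P y ∧ ∀ j, e j y = 0 := by
  induction m with
  | zero => intro x hx h0; exact absurd (mem_nilE_zero.mp hx) h0
  | succ m ih =>
    intro x hx h0 hPx
    by_cases h : ∀ j, e j x = 0
    · exact ⟨x, h0, hPx, h⟩
    · push Not at h
      obtain ⟨j, hj⟩ := h
      exact ih _ (mem_nilE_succ.mp hx j) hj (hP j x hPx)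

/-- stability of `nilE` under an operator commuting up to scalars -/
theorem nilE_stable (e : Fin n → M →ₗ[ℂ] M) (k : M →ₗ[ℂ] M)
    (hk : ∀ j, ∃ c : ℂ, ∀ x, e j (k x) = c • k (e j x)) (m : ℕ) :
    ∀ x ∈ nilE e m, k x ∈ nilE e m := by
  induction m with
  | zero => intro x hx; rw [mem_nilE_zero] at hx ⊢; simp [hx]
  | succ m ih =>
    intro x hx
    rw [mem_nilE_succ] at hx ⊢
    intro j
    obtain ⟨c, hc⟩ := hk j
    rw [hc]
    exact Submodule.smul_mem _ _ (ih _ (hx j))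

/-- a single operator nilpotent on `x`: last nonzero power -/
theorem last_pow (f : M →ₗ[ℂ] M) {x : M} (h0 : x ≠ 0) {N : ℕ} (hN : (f ^ N) x = 0) :
    ∃ m, (f ^ m) x ≠ 0 ∧ (f ^ (m + 1)) x = 0 := by
  classical
  have hex : ∃ N, (f ^ N) x = 0 := ⟨N, hN⟩
  have h1 := Nat.find_spec hex
  have h2 : Nat.find hex ≠ 0 := by
    intro h; rw [h] at h1; exact h0 (by simpa using h1)
  obtain ⟨m, hm⟩ := Nat.exists_eq_succ_of_ne_zero h2
  refine ⟨m, Nat.find_min hex (by omega), ?_⟩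
  rw [← Nat.succ_eq_add_one, ← hm]; exact h1

/-- the abstract `sl2` computation -/
theorem sl2_step (X Y : M →ₗ[ℂ] M) (z : M) (s T C : ℂ) (hs : s ≠ 1)
    (hXY : ∀ m : ℕ, X (Y ((Y ^ m) z)) = s • Y (X ((Y ^ m) z)) + (C * (T * s ^ (2 * m) - 1)) • (Y ^ m) z)
    (h0 : X z = 0) (m : ℕ) :
    X ((Y ^ (m + 1)) z) = (C * (1 - s ^ (m + 1)) * (T * s ^ m - 1) / (1 - s)) • (Y ^ m) z := by
  have hs' : 1 - s ≠ 0 := sub_ne_zero.mpr (Ne.symm hs)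
  induction m with
  | zero =>
    have := hXY 0
    simp only [pow_zero, Module.End.one_apply, h0, map_zero, smul_zero, zero_add, pow_one] at this ⊢
    rw [this]; congr 1; field_simp; ring
  | succ m ih =>
    have := hXY (m + 1)
    rw [pow_succ' Y (m + 1), Module.End.mul_apply, this, ih, map_smul, smul_smul,
      ← Module.End.mul_apply Y, ← pow_succ', ← add_smul]
    congr 1
    field_simp
    ring

end nil

end OQ


namespace OQ

/-- A quantum group action by skew derivations on an algebra. -/
structure QAct {n : ℕ} (q : ℂ) (d : Fin n → ℕ) (a : Fin n → Fin n → ℤ)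
    (A : Type) [Ring A] [Algebra ℂ A] where
  k : Fin n → A →ₐ[ℂ] A
  e : Fin n → A →ₗ[ℂ] A
  f : Fin n → A →ₗ[ℂ] A
  cc : Fin n → ℂ
  cc_ne : ∀ i, cc i ≠ 0
  kk : ∀ i j x, k i (k j x) = k j (k i x)
  ke : ∀ i j x, k i (e j x) = q ^ ((d i : ℤ) * a i j) • e j (k i x)
  kf : ∀ i j x, k i (f j x) = q ^ (-((d i : ℤ) * a i j)) • f j (k i x)
  e_mul : ∀ i x y, e i (x * y) = e i x * y + k i x * e i y
  f_mul : ∀ i x y, f i (x * y) = f i x * y + k i x * f i y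
  ef : ∀ i j x, e i (f j x) = q ^ (-((d i : ℤ) * a i j)) • f j (e i x) +
    if i = j then cc i • (k i (k i x) - x) else 0

/-- the simple root in fundamental weight coordinates -/
def root {n : ℕ} (a : Fin n → Fin n → ℤ) (j : Fin n) : Fin n → ℤ := fun i => a i j

section
variable {n : ℕ} {q : ℂ} {d : Fin n → ℕ} {a : Fin n → Fin n → ℤ}
  {A : Type} [Ring A] [Algebra ℂ A] (D : QAct q d a A)

/-- weight vectors for a `QAct` -/
def QAct.Wt (μ : Fin n → ℤ) (x : A) : Prop := IsWt q d (fun i => D.k i) μ x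

variable {D}

theorem QAct.Wt.e (hq : NotRU q) {μ : Fin n → ℤ} {x : A} (h : D.Wt μ x) (j : Fin n) :
    D.Wt (μ + root a j) (D.e j x) := by
  intro i
  have h1 : D.k i x = _ := h i
  show D.k i (D.e j x) = _
  rw [D.ke, h1, map_smul, smul_smul, ← zpow_add₀ hq.1]
  congr 2
  simp [root]; ring

theorem QAct.Wt.f (hq : NotRU q) {μ : Fin n → ℤ} {x : A} (h : D.Wt μ x) (j : Fin n) :
    D.Wt (μ - root a j) (D.f j x) := by
  intro i
  have h1 : D.k i x = _ := h i
  show D.k i (D.f j x) = _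
  rw [D.kf, h1, map_smul, smul_smul, ← zpow_add₀ hq.1]
  congr 2
  simp [root]; ring

theorem QAct.Wt.mul (hq : NotRU q) {μ ν : Fin n → ℤ} {x y : A} (h : D.Wt μ x) (h' : D.Wt ν y) :
    D.Wt (μ + ν) (x * y) := by
  intro i
  have h1 : D.k i x = _ := h i
  have h2 : D.k i y = _ := h' i
  show D.k i (x * y) = _
  rw [map_mul, h1, h2, smul_mul_smul_comm, ← zpow_add₀ hq.1]
  congr 2
  simp; ring

theorem QAct.Wt.epow (hq : NotRU q) {μ : Fin n → ℤ} {x : A} (h : D.Wt μ x) (j : Fin n) (m : ℕ) :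
    D.Wt (μ + m • root a j) ((D.e j ^ m) x) := by
  induction m with
  | zero => simpa using h
  | succ m ih =>
    rw [pow_succ', Module.End.mul_apply]
    have := ih.e hq j
    convert this using 1
    rw [succ_nsmul, add_assoc]

theorem QAct.Wt.fpow (hq : NotRU q) {μ : Fin n → ℤ} {x : A} (h : D.Wt μ x) (j : Fin n) (m : ℕ) :
    D.Wt (μ - m • root a j) ((D.f j ^ m) x) := by
  induction m with
  | zero => simpa using h
  | succ m ih =>
    rw [pow_succ', Module.End.mul_apply]
    have := ih.f hq j
    convert this using 1
    rw [succ_nsmul, sub_sub]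

theorem QAct.fpow_ne (hq : NotRU q) (hd : ∀ i, 0 < d i) (ha : ∀ i, a i i = 2)
    {μ : Fin n → ℤ} {x : A} (h : D.Wt μ x) (i : Fin n) (h0 : x ≠ 0) (he : D.e i x = 0) (m : ℕ)
    (hm : ∀ l : ℕ, l < m → (l : ℤ) ≠ μ i) : (D.f i ^ m) x ≠ 0 := by
  have hdi : (d i : ℤ) ≠ 0 := by have := hd i; omega
  set s : ℂ := q ^ (-(2 * (d i : ℤ))) with hs
  have hs1 : s ≠ 1 := hq.ne_one (by omega)
  have key := sl2_step (D.e i) (D.f i) x s (q ^ (2 * (d i : ℤ) * μ i)) (D.cc i) hs1 (by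
    intro m
    have hw : D.k i ((D.f i ^ m) x) = _ := (h.fpow hq i m) i
    rw [D.ef, if_pos rfl, hw, map_smul, hw, smul_smul, ha, ← zpow_add₀ hq.1]
    congr 1
    · congr 2; ring
    · nth_rewrite 2 [← one_smul ℂ ((D.f i ^ m) x)]
      rw [← sub_smul, smul_smul]
      congr 3
      rw [hs, ← zpow_natCast, ← zpow_mul, ← zpow_add₀ hq.1]
      congr 1
      simp [root, ha]; ring) he
  induction m with
  | zero => simpa using h0
  | succ m ih =>
    intro hz
    have h1 := ih fun l hl => hm l (by omega)
    have h2 := key m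
    rw [hz, map_zero, eq_comm, smul_eq_zero] at h2
    rcases h2 with h2 | h2
    · have e1 : (1 - s ^ (m + 1)) ≠ 0 := by
        rw [sub_ne_zero, hs, ← zpow_natCast, ← zpow_mul]
        refine (hq.ne_one ?_).symm
        have : ((m + 1 : ℕ) : ℤ) ≠ 0 := by omega
        exact mul_ne_zero (by omega) this
      have e2 : q ^ (2 * (d i : ℤ) * μ i) * s ^ m - 1 ≠ 0 := by
        rw [sub_ne_zero, hs, ← zpow_natCast, ← zpow_mul, ← zpow_add₀ hq.1]
        refine hq.ne_one ?_
        have h3 := hm m (by omega)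
        have : 2 * (d i : ℤ) * μ i + -(2 * (d i : ℤ)) * (m : ℤ) = (2 * d i) * (μ i - m) := by ring
        rw [this]
        exact mul_ne_zero (by omega) (by omega)
      have e3 : 1 - s ≠ 0 := sub_ne_zero.mpr (Ne.symm hs1)
      exact (div_ne_zero (mul_ne_zero (mul_ne_zero (D.cc_ne i) e1) e2) e3) h2
    · exact h1 h2

theorem QAct.epow_ne (hq : NotRU q) (hd : ∀ i, 0 < d i) (ha : ∀ i, a i i = 2)
    {μ : Fin n → ℤ} {x : A} (h : D.Wt μ x) (i : Fin n) (h0 : x ≠ 0) (he : D.f i x = 0) (m : ℕ)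
    (hm : ∀ l : ℕ, l < m → (l : ℤ) ≠ -μ i) : (D.e i ^ m) x ≠ 0 := by
  have hdi : (d i : ℤ) ≠ 0 := by have := hd i; omega
  set s : ℂ := q ^ (2 * (d i : ℤ)) with hs
  have hs0 : s ≠ 0 := hq.zpow_ne _
  have hs1 : s ≠ 1 := hq.ne_one (by omega)
  have hfe : ∀ y, D.f i (D.e i y) = s • D.e i (D.f i y) - (D.cc i * s) • (D.k i (D.k i y) - y) := by
    intro y
    rw [D.ef, if_pos rfl, smul_add, smul_smul, smul_smul, ha, hs, ← zpow_add₀ hq.1]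
    rw [show 2 * (d i : ℤ) + -((d i : ℤ) * 2) = 0 by ring, zpow_zero, one_smul, mul_comm (D.cc i)]
    abel
  have key := sl2_step (D.f i) (D.e i) x s (q ^ (2 * (d i : ℤ) * μ i)) (-(D.cc i * s)) hs1 (by
    intro m
    have hw : D.k i ((D.e i ^ m) x) = _ := (h.epow hq i m) i
    rw [hfe, hw, map_smul, hw, smul_smul, ← zpow_add₀ hq.1, sub_eq_add_neg]
    congr 1
    rw [neg_mul, neg_smul]
    congr 1
    nth_rewrite 2 [← one_smul ℂ ((D.e i ^ m) x)]
    rw [← sub_smul, smul_smul]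
    congr 3
    rw [hs, ← zpow_natCast, ← zpow_mul, ← zpow_add₀ hq.1]
    congr 1
    simp [root, ha]; ring) he
  induction m with
  | zero => simpa using h0
  | succ m ih =>
    intro hz
    have h1 := ih fun l hl => hm l (by omega)
    have h2 := key m
    rw [hz, map_zero, eq_comm, smul_eq_zero] at h2
    rcases h2 with h2 | h2
    · have e1 : (1 - s ^ (m + 1)) ≠ 0 := by
        rw [sub_ne_zero, hs, ← zpow_natCast, ← zpow_mul]
        refine (hq.ne_one ?_).symm
        have : ((m + 1 : ℕ) : ℤ) ≠ 0 := by omega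
        exact mul_ne_zero (by omega) this
      have e2 : q ^ (2 * (d i : ℤ) * μ i) * s ^ m - 1 ≠ 0 := by
        rw [sub_ne_zero, hs, ← zpow_natCast, ← zpow_mul, ← zpow_add₀ hq.1]
        refine hq.ne_one ?_
        have h3 := hm m (by omega)
        have : 2 * (d i : ℤ) * μ i + (2 * (d i : ℤ)) * (m : ℤ) = (2 * d i) * (μ i + m) := by ring
        rw [this]
        exact mul_ne_zero (by omega) (by omega)
      have e3 : 1 - s ≠ 0 := sub_ne_zero.mpr (Ne.symm hs1)
      exact (div_ne_zero (mul_ne_zero (mul_ne_zero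
        (neg_ne_zero.mpr (mul_ne_zero (D.cc_ne i) hs0)) e1) e2) e3) h2
    · exact h1 h2

theorem QAct.dominant (hq : NotRU q) (hd : ∀ i, 0 < d i) (ha : ∀ i, a i i = 2)
    {μ : Fin n → ℤ} {x : A} (h : D.Wt μ x) (i : Fin n) (h0 : x ≠ 0) (he : D.e i x = 0)
    {m : ℕ} (hm : (D.f i ^ m) x = 0) : 0 ≤ μ i := by
  by_contra hc
  exact QAct.fpow_ne hq hd ha h i h0 he m (fun l _ => by omega) hm

theorem QAct.nilE_k (hq : NotRU q) (i : Fin n) (m : ℕ) : ∀ x ∈ nilE D.e m, D.k i x ∈ nilE D.e m := by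
  refine nilE_stable D.e (D.k i).toLinearMap (fun j => ⟨(q ^ ((d i : ℤ) * a i j))⁻¹, fun x => ?_⟩) m
  show D.e j (D.k i x) = _ • D.k i (D.e j x)
  rw [D.ke, smul_smul, inv_mul_cancel₀ (hq.zpow_ne _), one_smul]

theorem QAct.nilE_f (hq : NotRU q) (i : Fin n) (m : ℕ) :
    ∀ x ∈ nilE D.e m, D.f i x ∈ nilE D.e (m + 1) := by
  induction m with
  | zero => intro x hx; rw [mem_nilE_zero] at hx; rw [hx, map_zero]; exact Submodule.zero_mem _
  | succ m ih =>
    intro x hx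
    rw [mem_nilE_succ]
    intro j
    rw [D.ef]
    refine Submodule.add_mem _ (Submodule.smul_mem _ _ (ih _ (mem_nilE_succ.mp hx j))) ?_
    split_ifs
    · exact Submodule.smul_mem _ _ (Submodule.sub_mem _
        (nilE_k hq _ _ _ (nilE_k hq _ _ _ hx)) hx)
    · exact Submodule.zero_mem _

theorem QAct.nilE_fpow (hq : NotRU q) (i : Fin n) (m l : ℕ) :
    ∀ x ∈ nilE D.e m, (D.f i ^ l) x ∈ nilE D.e (m + l) := by
  induction l with
  | zero => intro x hx; simpa using hx
  | succ l ih =>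
    intro x hx
    rw [pow_succ', Module.End.mul_apply]
    exact nilE_f hq i _ _ (ih x hx)

theorem nilE_epow {M : Type} [AddCommGroup M] [Module ℂ M] (e : Fin n → M →ₗ[ℂ] M) (i : Fin n)
    (m l : ℕ) : ∀ x ∈ nilE e (m + l), (e i ^ l) x ∈ nilE e m := by
  induction l with
  | zero => intro x hx; simpa using hx
  | succ l ih =>
    intro x hx
    rw [pow_succ, Module.End.mul_apply]
    exact ih _ (mem_nilE_succ.mp hx i)

end

end OQ


namespace OQ

/-- `L` is the localization of `A` at the powers of the normal element `r`. -/
structure IsLoc {A : Type} [Ring A] [Algebra ℂ A] (r : A) {L : Type} [Ring L] [Algebra ℂ L]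
    (φ : A →ₐ[ℂ] L) : Prop where
  inj : Function.Injective φ
  unit : IsUnit (φ r)
  frac : ∀ z : L, ∃ (N : ℕ) (b : A), φ r ^ N * z = φ b
  univ : ∀ (T : Type) [Ring T] (ψ : A →+* T), IsUnit (ψ r) → ∃ Ψ : L →+* T, ∀ b, Ψ (φ b) = ψ b

theorem exists_isLoc {A : Type} [Ring A] [Algebra ℂ A] (dom : ∀ x y : A, x * y = 0 → x = 0 ∨ y = 0)
    (r : A) (hr : r ≠ 0) (σ : A → A) (hσ : ∀ x, r * x = σ x * r) :
    ∃ (L : Type) (_ : Ring L) (_ : Algebra ℂ L) (φ : A →ₐ[ℂ] L), IsLoc r φ := by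
  classical
  have : NoZeroDivisors A := ⟨fun {x y} h => dom x y h⟩
  let S : Submonoid A := Submonoid.powers r
  have hpow : ∀ (m : ℕ) (x : A), ∃ y, r ^ m * x = y * r ^ m := by
    intro m
    induction m with
    | zero => intro x; exact ⟨x, by simp⟩
    | succ m ih =>
      intro x
      obtain ⟨y, hy⟩ := ih (σ x)
      exact ⟨y, by rw [pow_succ, mul_assoc, hσ, ← mul_assoc, hy, mul_assoc]⟩
  have hore : ∀ (x : A) (s : S), ∃ y : A, (s : A) * x = y * s := by
    rintro x ⟨s, m, rfl⟩
    exact hpow m x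
  choose num hnum using hore
  let : OreLocalization.OreSet S :=
    OreLocalization.oreSetOfNoZeroDivisors num (fun _ s => s) hnum
  let φ : A →ₐ[ℂ] OreLocalization S A :=
    { OreLocalization.numeratorRingHom with
      commutes' := fun c => rfl }
  have hφ : ∀ b, φ b = OreLocalization.numeratorHom b := fun _ => rfl
  refine ⟨OreLocalization S A, inferInstance, inferInstance, φ, ?_, ?_, ?_, ?_⟩
  · apply OreLocalization.numeratorHom_inj
    rintro _ ⟨m, rfl⟩
    rw [mem_nonZeroDivisorsLeft_iff]
    intro x hx
    exact (dom _ _ hx).resolve_left (pow_ne_zero m hr)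
  · exact OreLocalization.numerator_isUnit (⟨r, Submonoid.mem_powers r⟩ : S)
  · intro z
    induction z using OreLocalization.ind with | _ b s
    obtain ⟨s, m, rfl⟩ := s
    refine ⟨m, b, ?_⟩
    rw [← map_pow, hφ, hφ, OreLocalization.numeratorHom_apply, OreLocalization.numeratorHom_apply]
    exact OreLocalization.mul_cancel (s := (⟨r ^ m, ⟨m, rfl⟩⟩ : S)) (t := 1)
  · intro T _ ψ hu
    have hfS : ∀ s : S, IsUnit (ψ s) := by
      rintro ⟨s, m, rfl⟩
      simpa using hu.pow m
    let fS : S →* Tˣ := IsUnit.liftRight ((ψ : A →* T).comp S.subtype) hfS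
    have hf : ∀ s : S, ψ s = fS s := fun s =>
      (IsUnit.coe_liftRight ((ψ : A →* T).comp S.subtype) hfS s).symm
    exact ⟨OreLocalization.universalHom ψ fS hf, fun b => OreLocalization.universalHom_commutes ψ fS hf⟩

section
variable {A : Type} [Ring A] [Algebra ℂ A] {r : A} {L : Type} [Ring L] [Algebra ℂ L]
    {φ : A →ₐ[ℂ] L}

theorem IsLoc.unit_pow (h : IsLoc r φ) (N : ℕ) : IsUnit (φ r ^ N) := h.unit.pow N

/-- extension of algebra endomorphisms -/
theorem IsLoc.ext_hom (h : IsLoc r φ) (k : A →ₐ[ℂ] A) {c : ℂ} (hc : c ≠ 0) (hk : k r = c • r) :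
    ∃ kL : L →ₐ[ℂ] L, ∀ b, kL (φ b) = φ (k b) := by
  have hu : IsUnit ((φ : A →+* L).comp (k : A →+* A) r) := by
    simp only [RingHom.comp_apply, RingHom.coe_coe, hk, map_smul]
    exact (Units.mk0 c hc • h.unit.unit).isUnit
  obtain ⟨Ψ, hΨ⟩ := h.univ L _ hu
  refine ⟨{ Ψ with commutes' := fun z => ?_ }, fun b => hΨ b⟩
  have := hΨ (algebraMap ℂ A z)
  simpa using this

/-- a twisted derivation vanishing on `A` vanishes on `L` -/
theorem IsLoc.zero_of (h : IsLoc r φ) (Z : L → L) (α β : L → L)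
    (hα : ∀ N, IsUnit (α (φ r ^ N)))
    (hZ : ∀ x y, Z (x * y) = Z x * β y + α x * Z y) (h0 : ∀ b, Z (φ b) = 0) (z : L) : Z z = 0 := by
  obtain ⟨N, b, hb⟩ := h.frac z
  have h1 : Z (φ r ^ N * z) = 0 := by rw [hb, h0]
  have h2 : Z (φ r ^ N) = 0 := by rw [← map_pow, h0]
  rw [hZ, h2, zero_mul, zero_add] at h1
  exact (hα N).mul_right_eq_zero.mp h1

theorem IsLoc.hom_eq (h : IsLoc r φ) (g g' : L →ₐ[ℂ] L) (hg : ∀ b, g (φ b) = g' (φ b)) (z : L) :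
    g z = g' z := by
  obtain ⟨N, b, hb⟩ := h.frac z
  have h1 : g (φ r ^ N) * g z = g (φ r ^ N) * g' z := by
    rw [← map_mul, hb, hg, ← hb, map_mul, ← map_pow, hg]
  exact ((h.unit_pow N).map g).mul_left_cancel h1

theorem IsLoc.ext_der (h : IsLoc r φ) (k : A →ₐ[ℂ] A) {c : ℂ} (hc : c ≠ 0) (hk : k r = c • r)
    (kL : L →ₐ[ℂ] L) (hkL : ∀ b, kL (φ b) = φ (k b)) (D : A →ₗ[ℂ] A)
    (hD : ∀ x y, D (x * y) = D x * y + k x * D y) :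
    ∃ DL : L →ₗ[ℂ] L, (∀ b, DL (φ b) = φ (D b)) ∧
      ∀ x y, DL (x * y) = DL x * y + kL x * DL y := by
  have hD1 : D 1 = 0 := by
    have := hD 1 1
    simpa using this
  let ψ : A →+* Matrix (Fin 2) (Fin 2) L :=
    { toFun := fun b => !![φ (k b), φ (D b); 0, φ b]
      map_one' := by simp [hD1, Matrix.one_fin_two]
      map_mul' := fun x y => by
        simp [hD, Matrix.mul_fin_two, add_comm]
      map_zero' := by
        ext i j; fin_cases i <;> fin_cases j <;> simp
      map_add' := fun x y => by
        simp }
  have hkr : IsUnit (φ (k r)) := by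
    rw [hk, map_smul]
    exact (Units.mk0 c hc • h.unit.unit).isUnit
  have hu : IsUnit (ψ r) := by
    obtain ⟨u, hu⟩ := hkr
    obtain ⟨v, hv⟩ := h.unit
    refine ⟨⟨ψ r, !![↑u⁻¹, -(↑u⁻¹ * φ (D r) * ↑v⁻¹); 0, ↑v⁻¹], ?_, ?_⟩, rfl⟩
    · simp only [ψ, RingHom.coe_mk, MonoidHom.coe_mk, OneHom.coe_mk, ← hu, ← hv,
        Matrix.mul_fin_two, Matrix.one_fin_two]
      simp [← mul_assoc]
    · simp only [ψ, RingHom.coe_mk, MonoidHom.coe_mk, OneHom.coe_mk, ← hu, ← hv,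
        Matrix.mul_fin_two, Matrix.one_fin_two]
      simp [mul_assoc]
  obtain ⟨Ψ, hΨ⟩ := h.univ _ ψ hu
  have hmul : ∀ x y (i j : Fin 2), Ψ (x * y) i j = Ψ x i 0 * Ψ y 0 j + Ψ x i 1 * Ψ y 1 j := by
    intro x y i j
    rw [map_mul, Matrix.mul_apply, Fin.sum_univ_two]
  have h10 : ∀ z, Ψ z 1 0 = 0 ∧ Ψ z 1 1 = z ∧ Ψ z 0 0 = kL z := by
    intro z
    obtain ⟨N, b, hb⟩ := h.frac z
    have e : ∀ i j, Ψ (φ r ^ N * z) i j = ψ b i j := fun i j => by rw [hb, hΨ]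
    have e' : ∀ i j, Ψ (φ r ^ N) i j = ψ (r ^ N) i j := fun i j => by rw [← map_pow, hΨ]
    have e10 := e 1 0
    have e11 := e 1 1
    have e00 := e 0 0
    rw [hmul, e', e'] at e10 e11 e00
    simp [ψ] at e10 e11 e00
    have i10 : Ψ z 1 0 = 0 := (h.unit_pow N).mul_right_eq_zero.mp e10
    refine ⟨i10, ?_, ?_⟩
    · rw [← hb] at e11
      exact (h.unit_pow N).mul_left_cancel e11
    · rw [i10, mul_zero, add_zero, ← hkL b, ← hb, map_mul, ← map_pow, ← map_pow, ← map_pow, hkL] at e00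
      refine IsUnit.mul_left_cancel ?_ e00
      rw [map_pow, map_pow]
      exact hkr.pow N
  have hD01 : ∀ x y, Ψ (x * y) 0 1 = Ψ x 0 1 * y + kL x * Ψ y 0 1 := by
    intro x y
    rw [hmul, (h10 x).2.2, (h10 y).2.1, add_comm]
  refine ⟨{ toFun := fun z => Ψ z 0 1, map_add' := fun x y => by simp, map_smul' := ?_ }, ?_, ?_⟩
  · intro c z
    have h1 : Ψ (algebraMap ℂ L c) 0 1 = 0 := by
      rw [← φ.commutes, hΨ]
      simp [ψ, Algebra.algebraMap_eq_smul_one, hD1]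
    rw [Algebra.smul_def, hD01, h1, zero_mul, zero_add, kL.commutes, ← Algebra.smul_def]
    rfl
  · intro b
    show Ψ (φ b) 0 1 = _
    rw [hΨ]; simp [ψ]
  · exact hD01

end

theorem QAct.ext_loc {n : ℕ} {q : ℂ} {d : Fin n → ℕ} {a : Fin n → Fin n → ℤ}
    {A : Type} [Ring A] [Algebra ℂ A] (D : QAct q d a A) (hq : NotRU q)
    (hsym : ∀ i j, (d i : ℤ) * a i j = (d j : ℤ) * a j i)
    {r : A} {L : Type} [Ring L] [Algebra ℂ L] {φ : A →ₐ[ℂ] L} (h : IsLoc r φ)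
    (hkr : ∀ i, ∃ c : ℂ, c ≠ 0 ∧ D.k i r = c • r) :
    ∃ DL : QAct q d a L, (∀ i b, DL.k i (φ b) = φ (D.k i b)) ∧
      (∀ i b, DL.e i (φ b) = φ (D.e i b)) ∧ (∀ i b, DL.f i (φ b) = φ (D.f i b)) := by
  choose c hc hk using hkr
  choose k hkφ using fun i => h.ext_hom (D.k i) (hc i) (hk i)
  choose e heφ hem using fun i => h.ext_der (D.k i) (hc i) (hk i) (k i) (hkφ i) (D.e i) (D.e_mul i)
  choose f hfφ hfm using fun i => h.ext_der (D.k i) (hc i) (hk i) (k i) (hkφ i) (D.f i) (D.f_mul i)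
  have kk : ∀ i j x, k i (k j x) = k j (k i x) := by
    intro i j x
    exact h.hom_eq ((k i).comp (k j)) ((k j).comp (k i)) (fun b => by simp [hkφ, D.kk i j]) x
  have hu : ∀ i j N, IsUnit (k i (k j (φ r ^ N))) := fun i j N =>
    ((h.unit_pow N).map (k j)).map (k i)
  have ke : ∀ i j x, k i (e j x) = q ^ ((d i : ℤ) * a i j) • e j (k i x) := by
    intro i j x
    have := h.zero_of (fun x => k i (e j x) - q ^ ((d i : ℤ) * a i j) • e j (k i x))
      (fun x => k i (k j x)) (k i) (hu i j) (fun x y => by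
        simp only [hem, map_add, map_mul, smul_add, kk j i]
        simp only [sub_mul, mul_sub, smul_mul_assoc, mul_smul_comm]
        abel) (fun b => by simp [heφ, hkφ, D.ke]) x
    exact sub_eq_zero.mp this
  have kf : ∀ i j x, k i (f j x) = q ^ (-((d i : ℤ) * a i j)) • f j (k i x) := by
    intro i j x
    have := h.zero_of (fun x => k i (f j x) - q ^ (-((d i : ℤ) * a i j)) • f j (k i x))
      (fun x => k i (k j x)) (k i) (hu i j) (fun x y => by
        simp only [hfm, map_add, map_mul, smul_add, kk j i]
        simp only [sub_mul, mul_sub, smul_mul_assoc, mul_smul_comm]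
        abel) (fun b => by simp [hfφ, hkφ, D.kf]) x
    exact sub_eq_zero.mp this
  have ef : ∀ i j x, e i (f j x) = q ^ (-((d i : ℤ) * a i j)) • f j (e i x) +
      if i = j then D.cc i • (k i (k i x) - x) else 0 := by
    intro i j x
    have hek : ∀ x, e i (k j x) = q ^ (-((d i : ℤ) * a i j)) • k j (e i x) := by
      intro x
      rw [ke, smul_smul, ← zpow_add₀ hq.1, hsym i j, neg_add_cancel, zpow_zero, one_smul]
    have := h.zero_of (fun x => e i (f j x) - q ^ (-((d i : ℤ) * a i j)) • f j (e i x) -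
        if i = j then D.cc i • (k i (k i x) - x) else 0)
      (fun x => k i (k j x)) id (hu i j) (fun x y => by
        simp only [hem, hfm, map_add, map_mul, smul_add, kf, hek, id, kk j i]
        split_ifs with hij
        · subst hij
          simp only [sub_mul, mul_sub, smul_mul_assoc, mul_smul_comm, smul_sub]
          abel
        · simp only [sub_mul, mul_sub, smul_mul_assoc, mul_smul_comm, smul_sub]
          simp only [zero_mul, mul_zero]
          abel) (fun b => by
        simp only [hfφ, heφ, hkφ, D.ef i j]
        split_ifs <;> simp) x
    have h2 := sub_eq_zero.mp this
    rw [← h2]; abel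
  exact ⟨{ k := k, e := e, f := f, cc := D.cc, cc_ne := D.cc_ne, kk := kk, ke := ke, kf := kf
           e_mul := hem, f_mul := hfm, ef := ef }, hkφ, heφ, hfφ⟩

end OQ


namespace OQ

/-- Finite reflection group boundedness. -/
def RefBound {n : ℕ} (a : Fin n → Fin n → ℤ) : Prop :=
  ∃ (h : (Fin n → ℤ) →+ ℤ) (C : ℤ), 0 < C ∧ (∀ j, h (root a j) = C) ∧
    ∀ T : Set (Fin n → ℤ), (∀ i, ∀ μ ∈ T, μ - μ i • root a i ∈ T) →
      (∃ H, ∀ μ ∈ T, h μ ≤ H) → ∃ B, ∀ μ ∈ T, B ≤ h μ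

/-- The hypotheses of the abstract theorem. -/
structure QHyp {n : ℕ} {q : ℂ} {d : Fin n → ℕ} {a : Fin n → Fin n → ℤ}
    {A : Type} [Ring A] [Algebra ℂ A] (D : QAct q d a A) (j : Fin n) (r : A) where
  hq : NotRU q
  hd : ∀ i, 0 < d i
  ha : ∀ i, a i i = 2
  hsym : ∀ i j, (d i : ℤ) * a i j = (d j : ℤ) * a j i
  hR : RefBound a
  dom : ∀ x y : A, x * y = 0 → x = 0 ∨ y = 0
  wts : WtSpan q d (fun i => D.k i)
  enil : ∀ x, ∃ m, x ∈ nilE D.e m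
  fnil : ∀ i x, ∃ m, (D.f i ^ m) x = 0
  hopf : ∀ Y : Submodule ℂ A, Y ≠ ⊥ → (∀ y ∈ Y, ∀ b, y * b ∈ Y) →
    (∀ i, ∀ y ∈ Y, D.e i y ∈ Y ∧ D.f i y ∈ Y ∧ D.k i y ∈ Y) → 1 ∈ Y
  r0 : r ≠ 0
  er : ∀ i, D.e i r = 0
  rwt : D.Wt (Pi.single j 1) r
  fr : ∀ i, i ≠ j → D.f i r = 0
  ffr : D.f j (D.f j r) = 0
  κ : A ≃ₐ[ℂ] A
  hκ : ∀ x, κ x = D.k j x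
  σ : A ≃ₐ[ℂ] A
  hσ : ∀ x, r * x = σ x * r
  θ : ℂ
  hθ : θ ≠ 0
  σf : ∀ x, D.f j (σ x) = θ • σ (D.f j x)

section
variable {n : ℕ} {q : ℂ} {d : Fin n → ℕ} {a : Fin n → Fin n → ℤ}
    {A : Type} [Ring A] [Algebra ℂ A] {D : QAct q d a A} {j : Fin n} {r : A}

namespace QHyp

theorem p_ne (H : QHyp D j r) : q ^ (d j : ℤ) ≠ 0 := H.hq.zpow_ne _

theorem kr (H : QHyp D j r) (i : Fin n) : ∃ c : ℂ, c ≠ 0 ∧ D.k i r = c • r :=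
  ⟨_, H.hq.zpow_ne _, H.rwt i⟩

theorem krj (H : QHyp D j r) : D.k j r = q ^ (d j : ℤ) • r := by
  have := H.rwt j
  simpa using this

theorem x_ne (H : QHyp D j r) : D.f j r ≠ 0 := by
  have := QAct.fpow_ne H.hq H.hd H.ha H.rwt j H.r0 (H.er j) 1 (fun l hl => by
    obtain rfl : l = 0 := by omega
    simp)
  simpa using this

theorem xwt (H : QHyp D j r) : D.Wt (Pi.single j 1 - root a j) (D.f j r) := H.rwt.f H.hq j

theorem kx (H : QHyp D j r) (i : Fin n) : ∃ c : ℂ, c ≠ 0 ∧ D.k i (D.f j r) = c • D.f j r :=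
  ⟨_, H.hq.zpow_ne _, H.xwt i⟩

theorem kxj (H : QHyp D j r) : D.k j (D.f j r) = (q ^ (d j : ℤ))⁻¹ • D.f j r := by
  have := H.xwt j
  simp only [root, Pi.sub_apply, Pi.single_eq_same, H.ha] at this
  rw [← zpow_neg]
  rw [this]
  congr 2; ring

/-- the twist for `x` -/
def τ (H : QHyp D j r) : A ≃ₐ[ℂ] A := H.σ.trans H.κ

theorem τ_apply (H : QHyp D j r) (b : A) : H.τ b = D.k j (H.σ b) := by
  simp [τ, H.hκ]

theorem x_mul (H : QHyp D j r) (b : A) : D.f j r * b = H.τ b * D.f j r +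
    (H.θ - q ^ (d j : ℤ)) • (r * D.f j b) := by
  have h1 := D.f_mul j r b
  rw [H.hσ, D.f_mul, H.krj, H.σf, ← H.τ_apply, smul_mul_assoc, smul_mul_assoc, ← H.hσ] at h1
  rw [sub_smul, ← add_sub_assoc, eq_sub_iff_add_eq, ← h1, add_comm]

theorem fτ (H : QHyp D j r) (b : A) : D.f j (H.τ b) = (q ^ ((d j : ℤ) * 2) * H.θ) • H.τ (D.f j b) := by
  have := D.kf j j (H.σ b)
  rw [H.σf, map_smul, ← H.τ_apply, ← H.τ_apply, H.ha] at this
  rw [mul_smul, this, smul_smul, ← zpow_add₀ H.hq.1, add_neg_cancel, zpow_zero, one_smul]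

theorem fτ_symm (H : QHyp D j r) (b : A) : ∃ c : ℂ, D.f j (H.τ.symm b) = c • H.τ.symm (D.f j b) := by
  refine ⟨(q ^ ((d j : ℤ) * 2) * H.θ)⁻¹, ?_⟩
  have := H.fτ (H.τ.symm b)
  rw [AlgEquiv.apply_symm_apply] at this
  rw [this, map_smul, AlgEquiv.symm_apply_apply, smul_smul, inv_mul_cancel₀, one_smul]
  exact mul_ne_zero (H.hq.zpow_ne _) H.hθ

theorem fτ_symm_pow (H : QHyp D j r) (b : A) (m : ℕ) :
    ∃ c : ℂ, (D.f j ^ m) (H.τ.symm b) = c • H.τ.symm ((D.f j ^ m) b) := by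
  induction m with
  | zero => exact ⟨1, by simp⟩
  | succ m ih =>
    obtain ⟨c, hc⟩ := ih
    obtain ⟨c', hc'⟩ := H.fτ_symm ((D.f j ^ m) b)
    refine ⟨c * c', ?_⟩
    rw [pow_succ', Module.End.mul_apply, hc, map_smul, hc', smul_smul, Module.End.mul_apply]

/-- the ideal `rA` -/
def I (_ : QHyp D j r) : Submodule ℂ A := LinearMap.range (LinearMap.mulLeft ℂ r)

theorem mem_I (H : QHyp D j r) {z : A} : z ∈ H.I ↔ ∃ y, r * y = z := by
  simp [I]

theorem r_mul_mem (H : QHyp D j r) (y : A) : r * y ∈ H.I := H.mem_I.mpr ⟨y, rfl⟩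

theorem I_right (H : QHyp D j r) {z : A} (hz : z ∈ H.I) (b : A) : z * b ∈ H.I := by
  obtain ⟨y, rfl⟩ := H.mem_I.mp hz
  rw [mul_assoc]; exact H.r_mul_mem _

theorem mul_r (H : QHyp D j r) (b : A) : b * r = r * H.σ.symm b := by
  rw [H.hσ, AlgEquiv.apply_symm_apply]

theorem I_left (H : QHyp D j r) {z : A} (hz : z ∈ H.I) (b : A) : b * z ∈ H.I := by
  obtain ⟨y, rfl⟩ := H.mem_I.mp hz
  rw [← mul_assoc, H.mul_r, mul_assoc]; exact H.r_mul_mem _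

theorem σr (H : QHyp D j r) : H.σ r = r := by
  have := H.hσ r
  have h2 : (r - H.σ r) * r = 0 := by rw [sub_mul, this, sub_self]
  exact (sub_eq_zero.mp ((H.dom _ _ h2).resolve_right H.r0)).symm

theorem τ_mem_I (H : QHyp D j r) {z : A} : H.τ z ∈ H.I ↔ z ∈ H.I := by
  have hτr : H.τ r = q ^ (d j : ℤ) • r := by rw [H.τ_apply, H.σr, H.krj]
  constructor
  · intro h
    obtain ⟨y, hy⟩ := H.mem_I.mp h
    have : z = r * ((q ^ (d j : ℤ))⁻¹ • H.τ.symm y) := by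
      apply H.τ.injective
      rw [map_mul, hτr, map_smul, AlgEquiv.apply_symm_apply, smul_mul_smul_comm,
        mul_inv_cancel₀ H.p_ne, one_smul, hy]
    rw [this]; exact H.r_mul_mem _
  · intro h
    obtain ⟨y, rfl⟩ := H.mem_I.mp h
    rw [map_mul, hτr, smul_mul_assoc]
    exact Submodule.smul_mem _ _ (H.r_mul_mem _)

theorem kI (H : QHyp D j r) (i : Fin n) {z : A} (hz : z ∈ H.I) : D.k i z ∈ H.I := by
  obtain ⟨y, rfl⟩ := H.mem_I.mp hz
  obtain ⟨c, -, hc⟩ := H.kr i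
  rw [map_mul, hc, smul_mul_assoc]
  exact Submodule.smul_mem _ _ (H.r_mul_mem _)

/-- `x b ≡ τ(b) x` -/
theorem x_mul_sub_mem (H : QHyp D j r) (b : A) : D.f j r * b - H.τ b * D.f j r ∈ H.I := by
  rw [H.x_mul, add_sub_cancel_left]
  exact Submodule.smul_mem _ _ (H.r_mul_mem _)

/-- quantum integers -/
noncomputable def β (q : ℂ) (d : Fin n → ℕ) (j : Fin n) (m : ℕ) : ℂ :=
  ((q ^ (d j : ℤ)) ^ m - ((q ^ (d j : ℤ))⁻¹) ^ m) / (q ^ (d j : ℤ) - (q ^ (d j : ℤ))⁻¹)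

theorem pp_ne (H : QHyp D j r) : q ^ (d j : ℤ) - (q ^ (d j : ℤ))⁻¹ ≠ 0 := by
  rw [← zpow_neg, sub_ne_zero]
  intro h
  have := H.hq.inj h
  have := H.hd j
  omega

theorem β_ne (H : QHyp D j r) (m : ℕ) : β q d j (m + 1) ≠ 0 := by
  refine div_ne_zero ?_ H.pp_ne
  rw [← zpow_neg, sub_ne_zero, ← zpow_natCast, ← zpow_natCast, ← zpow_mul, ← zpow_mul]
  intro h
  have h1 := H.hq.inj h
  have h2 := H.hd j
  have h3 : (d j : ℤ) * ((m + 1 : ℕ) : ℤ) > 0 := by positivity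
  linarith

theorem β_one (H : QHyp D j r) : β q d j 1 = 1 := by
  unfold β; rw [pow_one, pow_one]; exact div_self H.pp_ne

theorem β_succ (H : QHyp D j r) (m : ℕ) : β q d j (m + 1) = (q ^ (d j : ℤ)) ^ m + (q ^ (d j : ℤ))⁻¹ * β q d j m := by
  have h1 := H.pp_ne
  have h2 := H.p_ne
  unfold β
  generalize q ^ (d j : ℤ) = p at *
  rw [← mul_div_assoc, div_eq_iff h1, add_mul, div_mul_cancel₀ _ h1]
  have h3 : p * p⁻¹ = 1 := mul_inv_cancel₀ h2
  ring

theorem f_r_mul (H : QHyp D j r) (b : A) : D.f j (r * b) = D.f j r * b + q ^ (d j : ℤ) • (r * D.f j b) := by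
  rw [D.f_mul, H.krj, smul_mul_assoc]

theorem f_x_mul (H : QHyp D j r) (b : A) : D.f j (D.f j r * b) = (q ^ (d j : ℤ))⁻¹ • (D.f j r * D.f j b) := by
  rw [D.f_mul, H.ffr, H.kxj, zero_mul, zero_add, smul_mul_assoc]

theorem fpow_x_mul (H : QHyp D j r) (b : A) (m : ℕ) :
    (D.f j ^ m) (D.f j r * b) = ((q ^ (d j : ℤ))⁻¹) ^ m • (D.f j r * (D.f j ^ m) b) := by
  induction m with
  | zero => simp
  | succ m ih =>
    rw [pow_succ', Module.End.mul_apply, ih, map_smul, H.f_x_mul, smul_smul, Module.End.mul_apply,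
      pow_succ]

theorem fpow_r_mul (H : QHyp D j r) (b : A) (m : ℕ) : (D.f j ^ (m + 1)) (r * b) =
    (q ^ (d j : ℤ)) ^ (m + 1) • (r * (D.f j ^ (m + 1)) b) +
      β q d j (m + 1) • (D.f j r * (D.f j ^ m) b) := by
  induction m with
  | zero => simp [H.f_r_mul, H.β_one, add_comm]
  | succ m ih =>
    rw [pow_succ' _ (m + 1), Module.End.mul_apply, ih, map_add, map_smul, map_smul, H.f_r_mul,
      H.f_x_mul, H.β_succ (m + 1), Module.End.mul_apply, smul_add, smul_smul, smul_smul, add_smul]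
    rw [← Module.End.mul_apply (D.f j) (D.f j ^ m), ← pow_succ']
    rw [← pow_succ, mul_comm (β q d j (m + 1))]
    abel

theorem ker_inf (H : QHyp D j r) {z : A} (hz : z ∈ H.I) (hf : D.f j z = 0) : z = 0 := by
  obtain ⟨b, rfl⟩ := H.mem_I.mp hz
  by_contra h0
  have hb : b ≠ 0 := by rintro rfl; simp at h0
  obtain ⟨N, hN⟩ := H.fnil j b
  obtain ⟨m, h1, h2⟩ := last_pow (D.f j) hb hN
  have h3 := H.fpow_r_mul b m
  rw [h2, mul_zero, smul_zero, zero_add, pow_succ, Module.End.mul_apply, hf, map_zero, eq_comm,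
    smul_eq_zero] at h3
  rcases h3 with h3 | h3
  · exact H.β_ne m h3
  · rcases H.dom _ _ h3 with h3 | h3
    · exact H.x_ne h3
    · exact h1 h3

theorem reduce (H : QHyp D j r) (N : ℕ) : ∀ b, (D.f j ^ (N + 1)) b = 0 →
    ∃ b0, D.f j b0 = 0 ∧ D.f j r ^ N * b - b0 ∈ H.I := by
  induction N with
  | zero => intro b hb; exact ⟨b, by simpa using hb, by simp⟩
  | succ N ih =>
    intro b hb
    set c : ℂ := ((q ^ (d j : ℤ))⁻¹) ^ (N + 1) / β q d j (N + 1)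
    set b' := D.f j r * b - c • (r * D.f j b) with hb'
    have h1 : (D.f j ^ (N + 1)) b' = 0 := by
      rw [hb', map_sub, map_smul, H.fpow_x_mul, H.fpow_r_mul]
      have e1 : (D.f j ^ (N + 1)) (D.f j b) = 0 := by
        rw [← Module.End.mul_apply, ← pow_succ, hb]
      have e2 : (D.f j ^ N) (D.f j b) = (D.f j ^ (N + 1)) b := by
        rw [← Module.End.mul_apply, ← pow_succ]
      rw [e1, e2, mul_zero, smul_zero, zero_add, smul_smul, div_mul_cancel₀ _ (H.β_ne N), sub_self]
    obtain ⟨b0, h2, h3⟩ := ih b' h1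
    refine ⟨b0, h2, ?_⟩
    have h4 : D.f j r ^ (N + 1) * b - b0 = (D.f j r ^ N * b' - b0) +
        D.f j r ^ N * (c • (r * D.f j b)) := by
      rw [hb', mul_sub, pow_succ, mul_assoc]; abel
    rw [h4]
    exact Submodule.add_mem _ h3 (H.I_left (Submodule.smul_mem _ _ (H.r_mul_mem _)) _)

theorem ker_xpow (H : QHyp D j r) (m : ℕ) {b : A} (hb : D.f j b = 0) : D.f j (D.f j r ^ m * b) = 0 := by
  induction m with
  | zero => simpa using hb
  | succ m ih => rw [pow_succ', mul_assoc, H.f_x_mul, ih]; simp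

theorem reduce' (H : QHyp D j r) (N : ℕ) (b : A) (hb : (D.f j ^ (N + 1)) b = 0) (m : ℕ) (hm : N ≤ m) :
    ∃ b0, D.f j b0 = 0 ∧ D.f j r ^ m * b - b0 ∈ H.I := by
  obtain ⟨b0, h1, h2⟩ := H.reduce N b hb
  obtain ⟨l, rfl⟩ := Nat.exists_eq_add_of_le' hm
  refine ⟨D.f j r ^ l * b0, H.ker_xpow l h1, ?_⟩
  rw [pow_add, mul_assoc, ← mul_sub]
  exact H.I_left h2 _

theorem xpow_mul_sub_mem (H : QHyp D j r) (m : ℕ) (b : A) :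
    ∃ b', (∀ N, (D.f j ^ N) b = 0 → (D.f j ^ N) b' = 0) ∧ b * D.f j r ^ m - D.f j r ^ m * b' ∈ H.I := by
  induction m generalizing b with
  | zero => exact ⟨b, fun _ h => h, by simp⟩
  | succ m ih =>
    obtain ⟨b', h1, h2⟩ := ih (H.τ.symm b)
    refine ⟨b', fun N hN => h1 N ?_, ?_⟩
    · obtain ⟨c, hc⟩ := H.fτ_symm_pow b N
      rw [hc, hN]; simp
    · have h3 := H.x_mul_sub_mem (H.τ.symm b)
      rw [AlgEquiv.apply_symm_apply] at h3
      have h4 : b * D.f j r ^ (m + 1) - D.f j r ^ (m + 1) * b' =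
          -((D.f j r * H.τ.symm b - b * D.f j r) * D.f j r ^ m) +
          D.f j r * (H.τ.symm b * D.f j r ^ m - D.f j r ^ m * b') := by
        rw [pow_succ' _ m]; noncomm_ring
      rw [h4]
      exact Submodule.add_mem _ (Submodule.neg_mem _ (H.I_right h3 _)) (H.I_left h2 _)

/-- Ore condition for powers of `x` -/
theorem ore_one (H : QHyp D j r) (N : ℕ) : ∀ b, (D.f j ^ N) b = 0 → ∃ M b', b * D.f j r ^ M = D.f j r * b' := by
  have hω : ∃ ω : ℂ, ω ≠ 0 ∧ D.f j r * r = ω • (r * D.f j r) := by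
    have h1 := H.x_mul r
    rw [H.τ_apply, H.σr, H.krj, smul_mul_assoc, ← add_smul] at h1
    refine ⟨_, ?_, h1⟩
    intro h
    rw [h, zero_smul] at h1
    rcases H.dom _ _ h1 with h1 | h1
    · exact H.x_ne h1
    · exact H.r0 h1
  obtain ⟨ω, hω0, hω⟩ := hω
  induction N with
  | zero => intro b hb; exact ⟨0, 0, by simpa using hb⟩
  | succ N ih =>
    intro b hb
    obtain ⟨c, hc⟩ := H.fτ_symm_pow b (N + 1)
    rw [hb, map_zero, smul_zero, pow_succ, Module.End.mul_apply] at hc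
    obtain ⟨M, b', h1⟩ := ih _ hc
    have h2 := H.x_mul (H.τ.symm b)
    rw [AlgEquiv.apply_symm_apply] at h2
    have h3 : r * D.f j r = ω⁻¹ • (D.f j r * r) := by
      rw [hω, smul_smul, inv_mul_cancel₀ hω0, one_smul]
    refine ⟨M + 1, H.τ.symm b * D.f j r ^ M - ((H.θ - q ^ (d j : ℤ)) * ω⁻¹) • (r * b'), ?_⟩
    have h4 : b * D.f j r = D.f j r * H.τ.symm b - (H.θ - q ^ (d j : ℤ)) • (r * D.f j (H.τ.symm b)) := by
      rw [h2]; abel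
    rw [pow_succ', ← mul_assoc, h4, sub_mul, mul_sub, smul_mul_assoc, mul_assoc r, h1,
      ← mul_assoc r, h3, mul_smul_comm, smul_mul_assoc, smul_smul, mul_assoc, mul_assoc]

theorem ore (H : QHyp D j r) (m' : ℕ) : ∀ b, ∃ M b', b * D.f j r ^ M = D.f j r ^ m' * b' := by
  induction m' with
  | zero => intro b; exact ⟨0, b, by simp⟩
  | succ m ih =>
    intro b
    obtain ⟨N, hN⟩ := H.fnil j b
    obtain ⟨M, b', h1⟩ := H.ore_one N b hN
    obtain ⟨M', b'', h2⟩ := ih b'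
    refine ⟨M + M', b'', ?_⟩
    rw [pow_add, ← mul_assoc, h1, mul_assoc, h2, ← mul_assoc, ← pow_succ']

theorem er_pow (H : QHyp D j r) (i : Fin n) (N : ℕ) : D.e i (r ^ N) = 0 := by
  induction N with
  | zero =>
    have := D.e_mul i 1 1
    simpa using this
  | succ N ih => rw [pow_succ, D.e_mul, ih, H.er]; simp

theorem fr_pow (H : QHyp D j r) (i : Fin n) (hi : i ≠ j) (N : ℕ) : D.f i (r ^ N) = 0 := by
  induction N with
  | zero =>
    have := D.f_mul i 1 1
    simpa using this
  | succ N ih => rw [pow_succ, D.f_mul, ih, H.fr i hi]; simp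

theorem kr_pow (H : QHyp D j r) (i : Fin n) (N : ℕ) : ∃ c : ℂ, c ≠ 0 ∧ D.k i (r ^ N) = c • r ^ N := by
  obtain ⟨c, hc, h⟩ := H.kr i
  exact ⟨c ^ N, pow_ne_zero _ hc, by rw [map_pow, h, smul_pow]⟩

theorem rpow_ne (H : QHyp D j r) (N : ℕ) : r ^ N ≠ 0 := by
  induction N with
  | zero =>
    intro h
    have : r * r ^ 0 = 0 := by rw [h, mul_zero]
    exact H.r0 (by simpa using this)
  | succ N ih =>
    intro h
    rw [pow_succ] at h
    rcases H.dom _ _ h with h | h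
    · exact ih h
    · exact H.r0 h

/-- S4 : separatedness -/
theorem separated (H : QHyp D j r) (z : A) (hz : ∀ m : ℕ, ∃ y, z = r ^ m * y) : z = 0 := by
  let S : Submodule ℂ A :=
    { carrier := {z | ∀ m : ℕ, ∃ y, z = r ^ m * y}
      add_mem' := fun {x y} hx hy m => by
        obtain ⟨u, hu⟩ := hx m
        obtain ⟨v, hv⟩ := hy m
        exact ⟨u + v, by rw [hu, hv, mul_add]⟩
      zero_mem' := fun m => ⟨0, by simp⟩
      smul_mem' := fun c x hx m => by
        obtain ⟨u, hu⟩ := hx m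
        exact ⟨c • u, by rw [hu, mul_smul_comm]⟩ }
  have hSk : ∀ i, ∀ x ∈ S, D.k i x ∈ S := by
    intro i x hx m
    obtain ⟨u, hu⟩ := hx m
    obtain ⟨c, -, hc⟩ := H.kr_pow i m
    exact ⟨c • D.k i u, by rw [hu, map_mul, hc, smul_mul_assoc, mul_smul_comm]⟩
  have hSe : ∀ i, ∀ x ∈ S, D.e i x ∈ S := by
    intro i x hx m
    obtain ⟨u, hu⟩ := hx m
    obtain ⟨c, -, hc⟩ := H.kr_pow i m
    exact ⟨c • D.e i u, by rw [hu, D.e_mul, H.er_pow, hc, zero_mul, zero_add, smul_mul_assoc,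
      mul_smul_comm]⟩
  have hle : S ≤ ⊥ := by
    refine WtSpan.le (k := fun i => (D.k i).toLinearMap) H.hq H.hd H.wts S ⊥ hSk ?_
    intro μ x hx hwt
    rw [Submodule.mem_bot]
    by_contra h0
    obtain ⟨N, hN⟩ := H.enil x
    obtain ⟨y, hy0, ⟨hyS, ν, hν⟩, hye⟩ := nilE_top D.e (fun y => y ∈ S ∧ ∃ ν, D.Wt ν y)
      (fun i y hy => ⟨hSe i y hy.1, by
        obtain ⟨ν, hν⟩ := hy.2
        exact ⟨_, hν.e H.hq i⟩⟩) N x hN h0 ⟨hx, μ, hwt⟩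
    obtain ⟨u, hu⟩ := hyS ((ν j).toNat + 1)
    set m := (ν j).toNat + 1
    have hu0 : u ≠ 0 := by rintro rfl; exact hy0 (by simpa using hu)
    have hrm : D.Wt (m • Pi.single j 1) (r ^ m) := by
      have : ∀ m : ℕ, D.Wt (m • Pi.single j 1) (r ^ m) := by
        intro m
        induction m with
        | zero => intro i; simp
        | succ m ih => rw [pow_succ, succ_nsmul]; exact ih.mul H.hq H.rwt
      exact this m
    have hcancel : ∀ v w : A, r ^ m * v = r ^ m * w → v = w := by
      intro v w h
      have : r ^ m * (v - w) = 0 := by rw [mul_sub, h, sub_self]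
      exact sub_eq_zero.mp ((H.dom _ _ this).resolve_left (H.rpow_ne m))
    have huwt : D.Wt (ν - m • Pi.single j 1) u := by
      intro i
      show D.k i u = _
      have e1 : D.k i y = _ := hν i
      have e2 : D.k i (r ^ m) = _ := hrm i
      rw [hu, map_mul, e2, smul_mul_assoc, ← mul_smul_comm, ← mul_smul_comm] at e1
      have e3 := hcancel _ _ e1
      have e4 : D.k i u = (q ^ ((d i : ℤ) * (m • Pi.single j (1:ℤ) : Fin n → ℤ) i))⁻¹ •
          (q ^ ((d i : ℤ) * (m • Pi.single j (1:ℤ) : Fin n → ℤ) i) • D.k i u) := by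
        rw [smul_smul, inv_mul_cancel₀ (H.hq.zpow_ne _), one_smul]
      rw [e4, e3, smul_smul, ← zpow_neg, ← zpow_add₀ H.hq.1]
      congr 2
      simp; ring
    have hue : D.e j u = 0 := by
      have e1 := hye j
      obtain ⟨c, hc0, hc⟩ := H.kr_pow j m
      rw [hu, D.e_mul, H.er_pow, hc, zero_mul, zero_add, smul_mul_assoc, smul_eq_zero] at e1
      exact (H.dom _ _ (e1.resolve_left hc0)).resolve_left (H.rpow_ne m)
    obtain ⟨N', hN'⟩ := H.fnil j u
    have := QAct.dominant H.hq H.hd H.ha huwt j hu0 hue hN'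
    simp at this
    omega
  exact (Submodule.mem_bot ℂ).mp (hle (show z ∈ S from hz))

end QHyp
end
end OQ


namespace OQ

section
variable {n : ℕ} {q : ℂ} {d : Fin n → ℕ} {a : Fin n → Fin n → ℤ}
    {A : Type} [Ring A] [Algebra ℂ A] {D : QAct q d a A} {j : Fin n} {r : A}
    {L : Type} [Ring L] [Algebra ℂ L] {φ : A →ₐ[ℂ] L} {DL : QAct q d a L}

/-- compatibility of the localised action -/
structure LocAct (D : QAct q d a A) (DL : QAct q d a L) (r : A) (φ : A →ₐ[ℂ] L) : Prop where
  loc : IsLoc r φ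
  k : ∀ i b, DL.k i (φ b) = φ (D.k i b)
  e : ∀ i b, DL.e i (φ b) = φ (D.e i b)
  f : ∀ i b, DL.f i (φ b) = φ (D.f i b)

namespace QHyp

theorem kxpow (H : QHyp D j r) (i : Fin n) (m : ℕ) :
    ∃ c : ℂ, c ≠ 0 ∧ D.k i (D.f j r ^ m) = c • D.f j r ^ m := by
  obtain ⟨c, hc, h⟩ := H.kx i
  exact ⟨c ^ m, pow_ne_zero _ hc, by rw [map_pow, h, smul_pow]⟩

theorem fxpow (H : QHyp D j r) (m : ℕ) : D.f j (D.f j r ^ m) = 0 := by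
  have h1 : D.f j 1 = 0 := by
    have := D.f_mul j 1 1
    simpa using this
  have := H.ker_xpow m h1
  simpa using this

theorem xpow_ne (H : QHyp D j r) (N : ℕ) : D.f j r ^ N ≠ 0 := by
  induction N with
  | zero => simpa using H.rpow_ne 0
  | succ N ih =>
    intro h
    rw [pow_succ] at h
    rcases H.dom _ _ h with h | h
    · exact ih h
    · exact H.x_ne h

theorem x_reg (H : QHyp D j r) (h : LocAct D DL r φ) {z : L} (m : ℕ)
    (hz : z * φ (D.f j r) ^ m = 0) : z = 0 := by
  obtain ⟨N, b, hb⟩ := h.loc.frac z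
  have h1 : φ (b * D.f j r ^ m) = φ 0 := by
    rw [map_mul, ← hb, map_pow, mul_assoc, hz, mul_zero, map_zero]
  have h2 := (H.dom _ _ (h.loc.inj h1)).resolve_right (H.xpow_ne m)
  rw [h2, map_zero] at hb
  exact (h.loc.unit_pow N).mul_right_eq_zero.mp hb

/-- the Ore-type set -/
def Ω (φ : A →ₐ[ℂ] L) (x : A) : Set L := {z | ∃ m b, z * φ x ^ m = φ b}

theorem Ω_der (H : QHyp D j r) (h : LocAct D DL r φ) (i : Fin n) (δ : A →ₗ[ℂ] A) (δL : L →ₗ[ℂ] L)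
    (hδ : ∀ b, δL (φ b) = φ (δ b)) (hm : ∀ x y, δL (x * y) = δL x * y + DL.k i x * δL y) {z : L}
    (hz : z ∈ Ω φ (D.f j r)) : δL z ∈ Ω φ (D.f j r) := by
  obtain ⟨m, b, hb⟩ := hz
  obtain ⟨M, b', h1⟩ := H.ore m (δ (D.f j r ^ m))
  obtain ⟨c, hc, h2⟩ := H.kxpow i m
  refine ⟨m + M, δ b * D.f j r ^ M - c⁻¹ • (D.k i b * b'), ?_⟩
  have h3 : DL.k i z * φ (D.f j r) ^ m = c⁻¹ • φ (D.k i b) := by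
    have := congrArg (DL.k i) hb
    rw [map_mul, h.k, ← map_pow, h.k, h2, map_smul, mul_smul_comm] at this
    rw [← this, smul_smul, inv_mul_cancel₀ hc, one_smul, map_pow]
  have h4 : δL z * φ (D.f j r) ^ m = φ (δ b) - DL.k i z * φ (δ (D.f j r ^ m)) := by
    rw [← hδ, ← hb, hm, ← map_pow, hδ]; abel
  rw [pow_add, ← mul_assoc, h4, sub_mul, mul_assoc (DL.k i z), ← map_pow, ← map_mul, ← map_mul, h1,
    map_mul φ (D.f j r ^ m), map_pow, ← mul_assoc, h3]
  simp

theorem Ω_e (H : QHyp D j r) (h : LocAct D DL r φ) (i : Fin n) {z : L}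
    (hz : z ∈ Ω φ (D.f j r)) : DL.e i z ∈ Ω φ (D.f j r) :=
  H.Ω_der h i (D.e i) (DL.e i) (h.e i) (DL.e_mul i) hz

theorem Ω_f (H : QHyp D j r) (h : LocAct D DL r φ) (i : Fin n) {z : L}
    (hz : z ∈ Ω φ (D.f j r)) : DL.f i z ∈ Ω φ (D.f j r) :=
  H.Ω_der h i (D.f i) (DL.f i) (h.f i) (DL.f_mul i) hz

theorem Ω_epow (H : QHyp D j r) (h : LocAct D DL r φ) (i : Fin n) {z : L}
    (hz : z ∈ Ω φ (D.f j r)) (m : ℕ) : (DL.e i ^ m) z ∈ Ω φ (D.f j r) := by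
  induction m with
  | zero => simpa using hz
  | succ m ih => rw [pow_succ', Module.End.mul_apply]; exact H.Ω_e h i ih

theorem Ω_fpow (H : QHyp D j r) (h : LocAct D DL r φ) (i : Fin n) {z : L}
    (hz : z ∈ Ω φ (D.f j r)) (m : ℕ) : (DL.f i ^ m) z ∈ Ω φ (D.f j r) := by
  induction m with
  | zero => simpa using hz
  | succ m ih => rw [pow_succ', Module.End.mul_apply]; exact H.Ω_f h i ih

theorem krφ (H : QHyp D j r) (h : LocAct D DL r φ) (i : Fin n) (N : ℕ) :
    ∃ c : ℂ, c ≠ 0 ∧ DL.k i (φ r ^ N) = c • φ r ^ N := by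
  obtain ⟨c, hc, h2⟩ := H.kr_pow i N
  exact ⟨c, hc, by rw [← map_pow, h.k, h2, map_smul]⟩

theorem nilEφ (h : LocAct D DL r φ) (m : ℕ) : ∀ b ∈ nilE D.e m, φ b ∈ nilE DL.e m := by
  induction m with
  | zero => intro b hb; rw [mem_nilE_zero] at hb ⊢; simp [hb]
  | succ m ih =>
    intro b hb
    rw [mem_nilE_succ] at hb ⊢
    intro i
    rw [h.e]; exact ih _ (hb i)

theorem nilE_cancel (H : QHyp D j r) (h : LocAct D DL r φ) (N m : ℕ) :
    ∀ z, φ r ^ N * z ∈ nilE DL.e m → z ∈ nilE DL.e m := by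
  induction m with
  | zero =>
    intro z hz
    rw [mem_nilE_zero] at hz ⊢
    exact (h.loc.unit_pow N).mul_right_eq_zero.mp hz
  | succ m ih =>
    intro z hz
    rw [mem_nilE_succ] at hz ⊢
    intro i
    obtain ⟨c, hc, h2⟩ := H.krφ h i N
    have h3 := hz i
    rw [DL.e_mul, ← map_pow, h.e, H.er_pow, map_zero, zero_mul, zero_add, map_pow, h2,
      smul_mul_assoc] at h3
    exact ih _ ((Submodule.smul_mem_iff _ hc).mp h3)

theorem enilL (H : QHyp D j r) (h : LocAct D DL r φ) (z : L) : ∃ m, z ∈ nilE DL.e m := by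
  obtain ⟨N, b, hb⟩ := h.loc.frac z
  obtain ⟨m, hm⟩ := H.enil b
  exact ⟨m, H.nilE_cancel h N m z (by rw [hb]; exact nilEφ h m b hm)⟩

theorem fφpow (h : LocAct D DL r φ) (i : Fin n) (m : ℕ) (b : A) :
    (DL.f i ^ m) (φ b) = φ ((D.f i ^ m) b) := by
  induction m with
  | zero => simp
  | succ m ih => rw [pow_succ', Module.End.mul_apply, ih, h.f, pow_succ', Module.End.mul_apply]

theorem fnilL (H : QHyp D j r) (h : LocAct D DL r φ) (i : Fin n) {z : L}
    (hz : z ∈ Ω φ (D.f j r)) : ∃ m, (DL.f i ^ m) z = 0 := by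
  by_cases hi : i = j
  · subst hi
    obtain ⟨m, b, hb⟩ := hz
    obtain ⟨M, hM⟩ := H.fnil i b
    refine ⟨M, H.x_reg h m ?_⟩
    have : ∀ M, (DL.f i ^ M) (z * φ (D.f i r) ^ m) = (DL.f i ^ M) z * φ (D.f i r) ^ m := by
      intro M
      induction M with
      | zero => simp
      | succ M ih =>
        rw [pow_succ', Module.End.mul_apply, ih, DL.f_mul, ← map_pow, h.f, H.fxpow, map_zero,
          mul_zero, add_zero, Module.End.mul_apply]
    rw [← this, hb, fφpow h, hM, map_zero]
  · obtain ⟨N, b, hb⟩ := h.loc.frac z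
    obtain ⟨M, hM⟩ := H.fnil i b
    refine ⟨M, (h.loc.unit_pow N).mul_right_eq_zero.mp ?_⟩
    obtain ⟨c, hc, h2⟩ := H.krφ h i N
    have : ∀ M, (DL.f i ^ M) (φ r ^ N * z) = c ^ M • (φ r ^ N * (DL.f i ^ M) z) := by
      intro M
      induction M with
      | zero => simp
      | succ M ih =>
        rw [pow_succ', Module.End.mul_apply, ih, map_smul, DL.f_mul, h2, ← map_pow, h.f,
          H.fr_pow i hi, map_zero, zero_mul, zero_add, smul_mul_assoc, smul_smul, pow_succ,
          Module.End.mul_apply]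
    have h3 := this M
    rw [hb, fφpow h, hM, map_zero, eq_comm, smul_eq_zero] at h3
    exact h3.resolve_left (pow_ne_zero _ hc)

theorem reflect (H : QHyp D j r) (h : LocAct D DL r φ) (i : Fin n) {g : L} {μ : Fin n → ℤ} {m : ℕ}
    (hg0 : g ≠ 0) (hg : g ∈ Ω φ (D.f j r)) (hw : DL.Wt μ g) (hm : g ∈ nilE DL.e m) :
    ∃ (g' : L) (m' : ℕ), g' ≠ 0 ∧ g' ∈ Ω φ (D.f j r) ∧ DL.Wt (μ - μ i • root a i) g' ∧
      g' ∈ nilE DL.e m' ∧ (m' : ℤ) = m + μ i := by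
  have hlast : ∀ (t m : ℕ) (g : L), g ∈ nilE DL.e m → (DL.e i ^ t) g ≠ 0 → t ≤ m := by
    intro t m g hm ht
    by_contra hc
    apply ht
    have := nilE_epow DL.e i 0 t g (by rw [zero_add]; exact nilE_mono _ (by omega) hm)
    exact mem_nilE_zero.mp this
  have hai := H.ha i
  rcases le_or_gt 0 (μ i) with hμ | hμ
  · obtain ⟨N, hN⟩ : ∃ N, (DL.e i ^ N) g = 0 := by
      refine ⟨m, ?_⟩
      have := nilE_epow DL.e i 0 m g (by rw [zero_add]; exact hm)
      exact mem_nilE_zero.mp this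
    obtain ⟨p, hp, hp'⟩ := last_pow (DL.e i) hg0 hN
    obtain ⟨t, ht⟩ := Int.eq_ofNat_of_zero_le hμ
    have hpm := hlast p m g hm hp
    obtain ⟨m0, rfl⟩ := Nat.exists_eq_add_of_le' hpm
    have hw1 := hw.epow H.hq i p
    refine ⟨(DL.f i ^ (p + t)) ((DL.e i ^ p) g), m0 + (p + t), ?_, ?_, ?_, ?_, ?_⟩
    · refine QAct.fpow_ne H.hq H.hd H.ha hw1 i hp ?_ _ ?_
      · rw [← Module.End.mul_apply, ← pow_succ']; exact hp'
      · intro l hl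
        simp [root, hai]
        omega
    · exact H.Ω_fpow h i (H.Ω_epow h i hg p) _
    · have := hw1.fpow H.hq i (p + t)
      convert this using 1
      funext l
      simp [ht]; ring
    · exact QAct.nilE_fpow H.hq i _ _ _ (nilE_epow _ i m0 p g hm)
    · push_cast; omega
  · obtain ⟨N, hN⟩ := H.fnilL h i hg
    obtain ⟨p, hp, hp'⟩ := last_pow (DL.f i) hg0 hN
    obtain ⟨t, ht⟩ := Int.eq_ofNat_of_zero_le (show 0 ≤ -μ i by omega)
    have hw1 := hw.fpow H.hq i p
    have hne : (DL.e i ^ (p + t)) ((DL.f i ^ p) g) ≠ 0 := by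
      refine QAct.epow_ne H.hq H.hd H.ha hw1 i hp ?_ _ ?_
      · rw [← Module.End.mul_apply, ← pow_succ']; exact hp'
      · intro l hl
        simp [root, hai]
        omega
    have hn1 := QAct.nilE_fpow (D := DL) H.hq i m p g hm
    have hle := hlast _ _ _ hn1 hne
    obtain ⟨m0, hm0⟩ := Nat.exists_eq_add_of_le' hle
    refine ⟨_, m0, hne, H.Ω_epow h i (H.Ω_fpow h i hg p) _, ?_, ?_, by omega⟩
    · have := hw1.epow H.hq i (p + t)
      convert this using 1
      funext l
      have : μ i = -(t : ℤ) := by omega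
      simp [this]; ring
    · rw [hm0] at hn1
      exact nilE_epow _ i m0 _ _ hn1

theorem descend (H : QHyp D j r) (h : LocAct D DL r φ) {g : L} {μ : Fin n → ℤ}
    (hg : g ∈ Ω φ (D.f j r)) (hw : DL.Wt μ g) (hgr : g ∉ Set.range φ) :
    ∃ g' ν, g' ∉ Set.range φ ∧ DL.Wt ν g' ∧ ∀ i, DL.f i g' ∈ Set.range φ := by
  obtain ⟨hh, C, hC, hroot, hbd⟩ := H.hR
  obtain ⟨m, hm⟩ := H.enilL h g
  set T : Set (Fin n → ℤ) := {ν | ∃ g' m', g' ≠ 0 ∧ g' ∈ Ω φ (D.f j r) ∧ DL.Wt ν g' ∧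
    g' ∈ nilE DL.e m' ∧ hh ν + C * m' = hh μ + C * m} with hT
  obtain ⟨B, hB⟩ := hbd T (by
    rintro i ν ⟨g', m', h0, h1, h2, h3, h4⟩
    obtain ⟨g'', m'', k0, k1, k2, k3, k4⟩ := H.reflect h i h0 h1 h2 h3
    refine ⟨g'', m'', k0, k1, k2, k3, ?_⟩
    rw [k4, map_sub, map_zsmul, hroot, ← h4, smul_eq_mul]; ring) ⟨hh μ + C * m, by
    rintro ν ⟨g', m', h0, h1, h2, h3, h4⟩
    have : 0 ≤ C * (m' : ℤ) := by positivity
    omega⟩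
  have key : ∀ (N : ℕ) (g : L) (ν : Fin n → ℤ) (m' : ℕ), g ∉ Set.range φ → g ∈ Ω φ (D.f j r) →
      DL.Wt ν g → g ∈ nilE DL.e m' → hh ν + C * m' = hh μ + C * m → (hh ν - B).toNat ≤ N →
      ∃ g' ν, g' ∉ Set.range φ ∧ DL.Wt ν g' ∧ ∀ i, DL.f i g' ∈ Set.range φ := by
    intro N
    induction N with
    | zero =>
      intro g ν m' hr hg hw hm' he hN
      refine ⟨g, ν, hr, hw, fun i => ?_⟩
      by_contra hi
      have h0 : DL.f i g ≠ 0 := fun h0 => hi ⟨0, by rw [h0, map_zero]⟩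
      have := hB (ν - root a i) ⟨DL.f i g, m' + 1, h0, H.Ω_f h i hg, hw.f H.hq i,
        QAct.nilE_f H.hq i m' g hm', by rw [map_sub, hroot, ← he]; push_cast; ring⟩
      rw [map_sub, hroot] at this
      omega
    | succ N ih =>
      intro g ν m' hr hg hw hm' he hN
      by_cases hall : ∀ i, DL.f i g ∈ Set.range φ
      · exact ⟨g, ν, hr, hw, hall⟩
      · push Not at hall
        obtain ⟨i, hi⟩ := hall
        have h0 : DL.f i g ≠ 0 := fun h0 => hi ⟨0, by rw [h0, map_zero]⟩
        have hT1 : hh (ν - root a i) + C * ((m' + 1 : ℕ) : ℤ) = hh μ + C * m := by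
          rw [map_sub, hroot, ← he]; push_cast; ring
        have := hB (ν - root a i) ⟨DL.f i g, m' + 1, h0, H.Ω_f h i hg, hw.f H.hq i,
          QAct.nilE_f H.hq i m' g hm', hT1⟩
        refine ih (DL.f i g) (ν - root a i) (m' + 1) hi (H.Ω_f h i hg) (hw.f H.hq i)
          (QAct.nilE_f H.hq i m' g hm') hT1 ?_
        rw [map_sub, hroot] at this ⊢
        omega
  exact key _ g μ m hgr hg hw hm rfl le_rfl

theorem rpow_comm (H : QHyp D j r) (N : ℕ) : ∀ b, ∃ b', b * r ^ N = r ^ N * b' := by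
  induction N with
  | zero => intro b; exact ⟨b, by simp⟩
  | succ N ih =>
    intro b
    obtain ⟨b', hb'⟩ := ih (H.σ.symm b)
    exact ⟨b', by rw [pow_succ', ← mul_assoc, H.mul_r, mul_assoc, hb', mul_assoc]⟩

theorem in_range (H : QHyp D j r) (h : LocAct D DL r φ) {g : L} {ν : Fin n → ℤ}
    (hw : DL.Wt ν g) (hf : ∀ i, DL.f i g ∈ Set.range φ) : g ∈ Set.range φ := by
  obtain ⟨N, b, hb⟩ := h.loc.frac g
  obtain ⟨b', hb'⟩ := H.rpow_comm N b
  let St : Submodule ℂ A → Prop := fun Y => r ^ N ∈ Y ∧ (∀ y ∈ Y, ∀ b, y * b ∈ Y) ∧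
    (∀ i, ∀ y ∈ Y, D.f i y ∈ Y ∧ D.k i y ∈ Y)
  let Y : Submodule ℂ A := sInf {Y | St Y}
  have hmem : ∀ {y}, y ∈ Y ↔ ∀ Z, St Z → y ∈ Z := by
    intro y; simp [Y, Submodule.mem_sInf]
  have hYr : r ^ N ∈ Y := hmem.mpr fun Z hZ => hZ.1
  have hYm : ∀ y ∈ Y, ∀ b, y * b ∈ Y := fun y hy b =>
    hmem.mpr fun Z hZ => hZ.2.1 y (hmem.mp hy Z hZ) b
  have hYf : ∀ i, ∀ y ∈ Y, D.f i y ∈ Y := fun i y hy =>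
    hmem.mpr fun Z hZ => (hZ.2.2 i y (hmem.mp hy Z hZ)).1
  have hYk : ∀ i, ∀ y ∈ Y, D.k i y ∈ Y := fun i y hy =>
    hmem.mpr fun Z hZ => (hZ.2.2 i y (hmem.mp hy Z hZ)).2
  let Y' : Submodule ℂ A := Y ⊓ ⨅ i, Y.comap (D.e i)
  have hY' : ∀ {y}, y ∈ Y' ↔ y ∈ Y ∧ ∀ i, D.e i y ∈ Y := by
    intro y; simp [Y', Submodule.mem_iInf]
  have hSt : St Y' := by
    refine ⟨hY'.mpr ⟨hYr, fun i => ?_⟩, fun y hy b => ?_, fun i y hy => ⟨?_, ?_⟩⟩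
    · rw [H.er_pow]; exact Y.zero_mem
    · rw [hY'] at hy ⊢
      refine ⟨hYm y hy.1 b, fun i => ?_⟩
      rw [D.e_mul]
      exact Y.add_mem (hYm _ (hy.2 i) _) (hYm _ (hYk i _ hy.1) _)
    · rw [hY'] at hy ⊢
      refine ⟨hYf i y hy.1, fun l => ?_⟩
      rw [D.ef]
      refine Y.add_mem (Y.smul_mem _ (hYf _ _ (hy.2 l))) ?_
      split_ifs
      · exact Y.smul_mem _ (Y.sub_mem (hYk _ _ (hYk _ _ hy.1)) hy.1)
      · exact Y.zero_mem
    · rw [hY'] at hy ⊢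
      refine ⟨hYk i y hy.1, fun l => ?_⟩
      have h1 := D.ke i l y
      have h2 : D.e l (D.k i y) = (q ^ ((d i : ℤ) * a i l))⁻¹ • D.k i (D.e l y) := by
        rw [h1, smul_smul, inv_mul_cancel₀ (H.hq.zpow_ne _), one_smul]
      rw [h2]
      exact Y.smul_mem _ (hYk _ _ (hy.2 l))
  have h1 : (1 : A) ∈ Y := by
    refine H.hopf Y ?_ hYm (fun i y hy => ⟨?_, hYf i y hy, hYk i y hy⟩)
    · intro hbot
      rw [hbot] at hYr
      exact H.rpow_ne N ((Submodule.mem_bot ℂ).mp hYr)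
    · exact (hY'.mp (hmem.mp hy Y' hSt)).2 i
  let X : Submodule ℂ A :=
    (LinearMap.range φ.toLinearMap).comap ((LinearMap.mulLeft ℂ g).comp φ.toLinearMap)
  have hX : ∀ {y}, y ∈ X ↔ ∃ z, φ z = g * φ y := by
    intro y; simp [X]
  have hStX : St X := by
    refine ⟨hX.mpr ⟨b', ?_⟩, fun y hy b => ?_, fun i y hy => ⟨?_, ?_⟩⟩
    · apply (h.loc.unit_pow N).mul_left_cancel
      rw [← mul_assoc, hb, ← map_pow, ← map_mul, ← map_mul, hb']
    · obtain ⟨z, hz⟩ := hX.mp hy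
      exact hX.mpr ⟨z * b, by rw [map_mul, hz, map_mul, mul_assoc]⟩
    · obtain ⟨z, hz⟩ := hX.mp hy
      obtain ⟨z', hz'⟩ := hf i
      have h2 := congrArg (DL.f i) hz
      have hk : DL.k i g = _ := hw i
      rw [h.f, DL.f_mul, h.f, hk, ← hz', smul_mul_assoc] at h2
      refine hX.mpr ⟨(q ^ ((d i : ℤ) * ν i))⁻¹ • (D.f i z - z' * y), ?_⟩
      rw [map_smul, map_sub, h2, map_mul, add_sub_cancel_left, smul_smul,
        inv_mul_cancel₀ (H.hq.zpow_ne _), one_smul]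
    · obtain ⟨z, hz⟩ := hX.mp hy
      have h2 := congrArg (DL.k i) hz
      have hk : DL.k i g = _ := hw i
      rw [h.k, map_mul, h.k, hk, smul_mul_assoc] at h2
      refine hX.mpr ⟨(q ^ ((d i : ℤ) * ν i))⁻¹ • (D.k i z), ?_⟩
      rw [map_smul, h2, smul_smul, inv_mul_cancel₀ (H.hq.zpow_ne _), one_smul]
  obtain ⟨z, hz⟩ := hX.mp (hmem.mp h1 X hStX)
  exact ⟨z, by rw [hz, map_one, mul_one]⟩

theorem saturated_wt (H : QHyp D j r) {μ : Fin n → ℤ} {b : A} (hb : D.Wt μ b)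
    (hbx : b * D.f j r ∈ H.I) : b ∈ H.I := by
  obtain ⟨L, i1, i2, φ, hloc⟩ := exists_isLoc H.dom r H.r0 H.σ H.hσ
  obtain ⟨DL, h1, h2, h3⟩ := QAct.ext_loc D H.hq H.hsym hloc H.kr
  have h : LocAct D DL r φ := ⟨hloc, h1, h2, h3⟩
  obtain ⟨u, hu⟩ := hloc.unit
  set g : L := ↑u⁻¹ * φ b with hg
  have hrg : φ r * g = φ b := by rw [hg, ← hu, ← mul_assoc, Units.mul_inv, one_mul]
  have hcan : ∀ z w : L, φ r * z = φ r * w → z = w := fun z w e => hloc.unit.mul_left_cancel e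
  have hrange : g ∈ Set.range φ → b ∈ H.I := by
    rintro ⟨z, hz⟩
    refine H.mem_I.mpr ⟨z, hloc.inj ?_⟩
    rw [map_mul, hz, hrg]
  have hΩ : g ∈ Ω φ (D.f j r) := by
    obtain ⟨y, hy⟩ := H.mem_I.mp hbx
    refine ⟨1, y, hcan _ _ ?_⟩
    rw [pow_one, ← mul_assoc, hrg, ← map_mul, ← hy, map_mul]
  have hw : DL.Wt (μ - Pi.single j 1) g := by
    intro i
    show DL.k i g = _
    have e1 := congrArg (DL.k i) hrg
    have e2 : D.k i r = _ := H.rwt i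
    have e3 : D.k i b = _ := hb i
    rw [map_mul, h.k, h.k, e2, e3, map_smul, map_smul, ← hrg, smul_mul_assoc, ← mul_smul_comm,
      ← mul_smul_comm] at e1
    have e4 := hcan _ _ e1
    have e5 : DL.k i g = (q ^ ((d i : ℤ) * (Pi.single j 1 : Fin n → ℤ) i))⁻¹ •
        (q ^ ((d i : ℤ) * (Pi.single j 1 : Fin n → ℤ) i) • DL.k i g) := by
      rw [smul_smul, inv_mul_cancel₀ (H.hq.zpow_ne _), one_smul]
    rw [e5, e4, smul_smul, ← zpow_neg, ← zpow_add₀ H.hq.1]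
    congr 2
    simp; ring
  by_contra hnb
  obtain ⟨g', ν, k1, k2, k3⟩ := H.descend h hΩ hw (fun hr => hnb (hrange hr))
  exact k1 (H.in_range h k2 k3)

theorem saturated (H : QHyp D j r) {b : A} (hbx : b * D.f j r ∈ H.I) : b ∈ H.I := by
  let S : Submodule ℂ A := H.I.comap (LinearMap.mulRight ℂ (D.f j r))
  have hS : ∀ {b}, b ∈ S ↔ b * D.f j r ∈ H.I := by intro b; simp [S]
  have : S ≤ H.I := by
    refine WtSpan.le (k := fun i => (D.k i).toLinearMap) H.hq H.hd H.wts S H.I ?_ ?_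
    · intro i x hx
      rw [hS] at hx ⊢
      have h1 := H.kI i hx
      obtain ⟨c, hc, h2⟩ := H.kx i
      rw [map_mul, h2, mul_smul_comm] at h1
      exact (Submodule.smul_mem_iff _ hc).mp h1
    · intro μ x hx hw
      exact H.saturated_wt hw (hS.mp hx)
  exact this (hS.mpr hbx)

theorem saturated_pow (H : QHyp D j r) (m : ℕ) : ∀ {b : A}, b * D.f j r ^ m ∈ H.I → b ∈ H.I := by
  induction m with
  | zero => intro b h; simpa using h
  | succ m ih =>
    intro b h
    rw [pow_succ, ← mul_assoc] at h
    exact ih (H.saturated h)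

theorem saturated_left (H : QHyp D j r) (m : ℕ) : ∀ {b : A}, D.f j r ^ m * b ∈ H.I → b ∈ H.I := by
  induction m with
  | zero => intro b h; simpa using h
  | succ m ih =>
    intro b h
    rw [pow_succ, mul_assoc] at h
    have h1 := ih h
    have h2 : H.τ b * D.f j r ∈ H.I := by
      have := Submodule.sub_mem _ h1 (H.x_mul_sub_mem b)
      simpa using this
    exact H.τ_mem_I.mp (H.saturated h2)

theorem completely_prime (H : QHyp D j r) {x y : A} (hxy : x * y ∈ H.I) : x ∈ H.I ∨ y ∈ H.I := by
  obtain ⟨N, hN⟩ := H.fnil j x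
  obtain ⟨N', hN'⟩ := H.fnil j y
  set m := N + N'
  have hs : ∀ (z : A) (M : ℕ), (D.f j ^ M) z = 0 → (D.f j ^ (M + 1)) z = 0 := by
    intro z M h
    rw [pow_succ', Module.End.mul_apply, h, map_zero]
  obtain ⟨x0, h1, h2⟩ := H.reduce' N x (hs _ _ hN) m (by omega)
  obtain ⟨y', h3, h4⟩ := H.xpow_mul_sub_mem m y
  obtain ⟨y0, h5, h6⟩ := H.reduce' N' y' (hs _ _ (h3 _ hN')) m (by omega)
  have h7 : y * D.f j r ^ m - y0 ∈ H.I := by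
    have := Submodule.add_mem _ h4 h6
    simpa using this
  have h8 : x0 * y0 ∈ H.I := by
    have e : x0 * y0 = D.f j r ^ m * (x * y) * D.f j r ^ m
        - (D.f j r ^ m * x - x0) * (y * D.f j r ^ m) - x0 * (y * D.f j r ^ m - y0) := by
      noncomm_ring
    rw [e]
    exact Submodule.sub_mem _ (Submodule.sub_mem _ (H.I_right (H.I_left hxy _) _) (H.I_right h2 _))
      (H.I_left h7 _)
  have h9 : D.f j (x0 * y0) = 0 := by rw [D.f_mul, h1, h5]; simp
  rcases H.dom _ _ (H.ker_inf h8 h9) with h0 | h0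
  · left
    rw [h0, sub_zero] at h2
    exact H.saturated_left m h2
  · right
    rw [h0, sub_zero] at h7
    exact H.saturated_pow m h7

end QHyp
end
end OQ


set_option linter.unusedSectionVars false
set_option linter.unusedSimpArgs false
namespace OQ

section
variable {n : ℕ} {a : Fin n → Fin n → ℤ} {W : Type} [Group W] [Finite W]
  {σ : W →* Multiplicative (AddAut (Fin n → ℤ))} {s : Fin n → W}

theorem sig_mul (σ : W →* Multiplicative (AddAut (Fin n → ℤ))) (w w' : W) (μ : Fin n → ℤ) :
    σ (w * w') μ = σ w (σ w' μ) := by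
  rw [map_mul]; rfl

theorem sig_one (σ : W →* Multiplicative (AddAut (Fin n → ℤ))) (μ : Fin n → ℤ) :
    σ 1 μ = μ := by
  rw [map_one]; rfl

theorem sig_add (σ : W →* Multiplicative (AddAut (Fin n → ℤ))) (w : W) (μ ν : Fin n → ℤ) :
    σ w (μ + ν) = σ w μ + σ w ν :=
  AddEquiv.map_add (Multiplicative.toAdd (σ w)) μ ν

theorem sig_sum [Fintype W] (ha : ∀ i, a i i = 2)
    (hs : ∀ i (μ : Fin n → ℤ), σ (s i) μ = fun k => μ k - μ i * a k i) (μ : Fin n → ℤ) :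
    ∑ w, σ w μ = 0 := by
  funext i
  have h1 : σ (s i) (∑ w, σ w μ) = ∑ w, σ w μ := by
    have : σ (s i) (∑ w, σ w μ) = ∑ w, σ (s i) (σ w μ) :=
      map_sum (Multiplicative.toAdd (σ (s i))) _ _
    rw [this]
    simp_rw [← sig_mul]
    exact Fintype.sum_equiv (Equiv.mulLeft (s i)) _ _ (fun w => rfl)
  rw [hs] at h1
  have h2 := congrFun h1 i
  simp only [ha] at h2
  show (∑ w, σ w μ) i = 0
  omega

theorem sig_ind (hsgen : Subgroup.closure (Set.range s) = ⊤) (ha : ∀ i, a i i = 2)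
    (hs : ∀ i (μ : Fin n → ℤ), σ (s i) μ = fun k => μ k - μ i * a k i)
    (T : Set (Fin n → ℤ)) (hT : ∀ i, ∀ μ ∈ T, σ (s i) μ ∈ T) (w : W) : ∀ μ ∈ T, σ w μ ∈ T := by
  have hss : ∀ i, s i * s i = 1 ∨ ∀ μ, σ (s i)⁻¹ μ = σ (s i) μ := by
    intro i
    right
    intro μ
    have h1 : σ (s i) (σ (s i) μ) = μ := by
      rw [hs, hs]
      funext k
      simp only [ha]; ring
    conv_lhs => rw [← h1]
    rw [← sig_mul, inv_mul_cancel, sig_one]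
  have hw : w ∈ Subgroup.closure (Set.range s) := by rw [hsgen]; trivial
  induction hw using Subgroup.closure_induction'' with
  | one => intro μ hμ; rw [sig_one]; exact hμ
  | mem x hx => obtain ⟨i, rfl⟩ := hx; exact hT i
  | inv_mem x hx =>
    obtain ⟨i, rfl⟩ := hx
    intro μ hμ
    rcases hss i with h | h
    · rw [inv_eq_of_mul_eq_one_left h]; exact hT i μ hμ
    · rw [h]; exact hT i μ hμ
  | mul x y _ _ hx hy => intro μ hμ; rw [sig_mul]; exact hx _ (hy _ hμ)

theorem det_ne (hsgen : Subgroup.closure (Set.range s) = ⊤) (ha : ∀ i, a i i = 2)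
    (hs : ∀ i (μ : Fin n → ℤ), σ (s i) μ = fun k => μ k - μ i * a k i) :
    (Matrix.of a).det ≠ 0 := by
  intro hdet
  obtain ⟨ν, hν0, hν⟩ := Matrix.exists_vecMul_eq_zero_iff.mpr hdet
  apply hν0
  have : Fintype W := Fintype.ofFinite W
  have key : ∀ μ : Fin n → ℤ, ν ⬝ᵥ μ = 0 := by
    intro μ
    have h1 : ∀ w, ν ⬝ᵥ (σ w μ) = ν ⬝ᵥ μ := by
      intro w
      refine sig_ind hsgen ha hs {x | ν ⬝ᵥ x = ν ⬝ᵥ μ} ?_ w μ rfl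
      intro i x hx
      show ν ⬝ᵥ _ = _
      rw [← show ν ⬝ᵥ x = ν ⬝ᵥ μ from hx, hs]
      have h2 := congrFun hν i
      simp only [dotProduct, Matrix.vecMul, Matrix.of_apply, Pi.zero_apply] at h2 ⊢
      have : ∑ k, ν k * (x k - x i * a k i) = ∑ k, ν k * x k - x i * ∑ k, ν k * a k i := by
        rw [Finset.mul_sum, ← Finset.sum_sub_distrib]
        exact Finset.sum_congr rfl fun k _ => by ring
      rw [this, h2]; ring
    have h2 : ∑ w, ν ⬝ᵥ (σ w μ) = 0 := by
      rw [← dotProduct_sum, sig_sum ha hs, dotProduct_zero]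
    simp only [h1, Finset.sum_const, smul_eq_mul, nsmul_eq_mul, Finset.card_univ] at h2
    rcases mul_eq_zero.mp h2 with h3 | h3
    · have := Fintype.card_pos (α := W)
      norm_cast at h3
      omega
    · exact h3
  funext i
  have := key (Pi.single i 1)
  simpa using this

theorem refBound {d : Fin n → ℕ} (hd : ∀ i, 0 < d i)
    (hsgen : Subgroup.closure (Set.range s) = ⊤) (ha : ∀ i, a i i = 2)
    (hs : ∀ i (μ : Fin n → ℤ), σ (s i) μ = fun k => μ k - μ i * a k i) : RefBound a := by
  classical
  have : Fintype W := Fintype.ofFinite W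
  set M := Matrix.of a
  have hdet : M.det ≠ 0 := det_ne hsgen ha hs
  set m : Fin n → ℤ := Matrix.vecMul (fun _ => M.det) M.adjugate with hm
  have hmM : Matrix.vecMul m M = fun _ => M.det * M.det := by
    rw [hm, Matrix.vecMul_vecMul, Matrix.adjugate_mul]
    funext i
    simp [Matrix.vecMul_smul, mul_comm]
  let h : (Fin n → ℤ) →+ ℤ :=
    { toFun := fun μ => m ⬝ᵥ μ
      map_zero' := dotProduct_zero _
      map_add' := fun x y => dotProduct_add _ _ _ }
  refine ⟨h, M.det * M.det, by rw [← pow_two]; positivity, fun j => ?_, ?_⟩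
  · have := congrFun hmM j
    exact this
  · rintro T hT ⟨H, hH⟩
    refine ⟨-∑ w ∈ Finset.univ.erase (1 : W), H, fun μ hμ => ?_⟩
    have hst : ∀ w, σ w μ ∈ T := fun w => sig_ind hsgen ha hs T (fun i ν hν => by
      rw [hs]; convert hT i ν hν using 1; funext k; simp [root]) w μ hμ
    have h1 : ∑ w, h (σ w μ) = 0 := by rw [← map_sum, sig_sum ha hs, map_zero]
    rw [← Finset.add_sum_erase _ _ (Finset.mem_univ (1 : W)), sig_one] at h1
    have h2 : ∑ w ∈ Finset.univ.erase (1 : W), h (σ w μ) ≤ ∑ w ∈ Finset.univ.erase (1 : W), H :=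
      Finset.sum_le_sum fun w _ => hH _ (hst w)
    linarith

theorem exists_torus {q : ℂ} (hq : q ≠ 0) (hdet : (Matrix.of a).det ≠ 0) (e : Fin n → ℤ) :
    ∃ g : Fin n → ℂˣ, ∀ i, ((∏ k, g k ^ a k i : ℂˣ) : ℂ) = q ^ e i := by
  set M := Matrix.of a
  obtain ⟨t, ht⟩ : ∃ t : ℂˣ, ((t ^ M.det : ℂˣ) : ℂ) = q := by
    obtain ⟨z, hz⟩ := IsAlgClosed.exists_pow_nat_eq q (Int.natAbs_pos.mpr hdet)
    have hz0 : z ≠ 0 := by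
      rintro rfl
      rw [zero_pow (Int.natAbs_pos.mpr hdet).ne'] at hz
      exact hq hz.symm
    rcases Int.natAbs_eq M.det with h | h
    · refine ⟨Units.mk0 z hz0, ?_⟩
      rw [h, zpow_natCast, Units.val_pow_eq_pow_val, Units.val_mk0, hz]
    · refine ⟨(Units.mk0 z hz0)⁻¹, ?_⟩
      rw [h, inv_zpow, zpow_neg, inv_inv, zpow_natCast, Units.val_pow_eq_pow_val, Units.val_mk0, hz]
  set x := Matrix.vecMul e M.adjugate with hx
  have hxM : ∀ i, ∑ k, x k * a k i = M.det * e i := by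
    intro i
    have : Matrix.vecMul x M = M.det • e := by
      rw [hx, Matrix.vecMul_vecMul, Matrix.adjugate_mul, Matrix.vecMul_smul, Matrix.vecMul_one]
    have := congrFun this i
    simpa [Matrix.vecMul, dotProduct, M] using this
  refine ⟨fun k => t ^ x k, fun i => ?_⟩
  have h1 : ∏ k, (t ^ x k) ^ a k i = t ^ (∑ k, x k * a k i) := by
    have : ∀ S : Finset (Fin n), ∏ k ∈ S, (t ^ x k) ^ a k i = t ^ (∑ k ∈ S, x k * a k i) := by
      intro S
      induction S using Finset.induction_on with
      | empty => simp
      | insert b S hb ih => rw [Finset.prod_insert hb, Finset.sum_insert hb, ih, zpow_add, zpow_mul]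
    exact this _
  rw [h1, hxM, zpow_mul, Units.val_zpow_eq_zpow_val, ht]

end
end OQ


namespace OQ

open scoped TensorProduct

theorem uqRels_swap {q : ℂ} {n : ℕ} {a : Fin n → Fin n → ℤ} {d : Fin n → ℕ} (hq : NotRU q)
    {B : Type} [Ring B] [Algebra ℂ B] {E F : Fin n → B} {K : Fin n → Bˣ}
    (h : UqRels q a d B E F K) : UqRels q a d B F E (fun i => (K i)⁻¹) := by
  obtain ⟨h1, h2, h3, h4, h5, h6⟩ := h
  have cm : ∀ i j, Commute (K i) (K j) := fun i j => Units.ext (h1 i j)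
  have inv_lem : ∀ (i : Fin n) (x : B) (m : ℤ), (K i : B) * x = q ^ m • (x * (K i : B)) →
      (((K i)⁻¹ : Bˣ) : B) * x = q ^ (-m) • (x * (((K i)⁻¹ : Bˣ) : B)) := by
    intro i x m h
    rw [Units.inv_mul_eq_iff_eq_mul, mul_smul_comm, ← mul_assoc, h, smul_mul_assoc, smul_smul,
      ← zpow_add₀ hq.1, neg_add_cancel, zpow_zero, one_smul, mul_assoc, Units.mul_inv, mul_one]
  refine ⟨fun i j => ?_, fun i j => ?_, fun i j => ?_, fun i j => ?_, h6, h5⟩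
  · have := (cm i j).inv_inv
    exact congrArg Units.val this.eq
  · have := inv_lem i (F j) _ (h3 i j)
    rwa [neg_neg] at this
  · exact inv_lem i (E j) _ (h2 i j)
  · have h7 := h4 j i
    rw [← neg_sub, h7]
    by_cases hij : i = j
    · subst hij
      simp only [if_true, inv_inv]
      rw [← smul_neg, neg_sub]
    · rw [if_neg hij, if_neg (Ne.symm hij), neg_zero]

/-- evaluation of a pair of functionals on a tensor -/
noncomputable def m2 {U : Type} [Ring U] [Algebra ℂ U] (f g : U →ₗ[ℂ] ℂ) : U ⊗[ℂ] U →ₗ[ℂ] ℂ :=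
  (TensorProduct.lid ℂ ℂ).toLinearMap ∘ₗ TensorProduct.map f g

@[simp] theorem m2_tmul {U : Type} [Ring U] [Algebra ℂ U] (f g : U →ₗ[ℂ] ℂ) (x y : U) :
    m2 f g (x ⊗ₜ y) = f x * g y := by simp [m2]

/-- All the data. -/
structure Oq where
  q : ℂ
  n : ℕ
  a : Fin n → Fin n → ℤ
  d : Fin n → ℕ
  hq : NotRU q
  ha : ∀ i, a i i = 2
  hd : ∀ i, 0 < d i
  hsym : ∀ i j, (d i : ℤ) * a i j = (d j : ℤ) * a j i
  hR : RefBound a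
  hdet : (Matrix.of a).det ≠ 0
  U : Type
  iU1 : Ring U
  iU2 : Algebra ℂ U
  E : Fin n → U
  F : Fin n → U
  K : Fin n → Uˣ
  hrel : UqRels q a d U E F K
  huniv : ∀ (B : Type) [Ring B] [Algebra ℂ B] (E' F' : Fin n → B) (K' : Fin n → Bˣ),
      UqRels q a d B E' F' K' → ∃! φ : U →ₐ[ℂ] B,
        (∀ i, φ (E i) = E' i) ∧ (∀ i, φ (F i) = F' i) ∧ (∀ i, φ (K i : U) = (K' i : B))
  Δ : U →ₐ[ℂ] U ⊗[ℂ] U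
  ε : U →ₐ[ℂ] ℂ
  hΔE : ∀ i, Δ (E i) = E i ⊗ₜ 1 + (K i : U) ⊗ₜ E i
  hΔF : ∀ i, Δ (F i) = F i ⊗ₜ (((K i)⁻¹ : Uˣ) : U) + 1 ⊗ₜ F i
  hΔK : ∀ i, Δ (K i : U) = (K i : U) ⊗ₜ (K i : U)
  hεE : ∀ i, ε (E i) = 0
  hεF : ∀ i, ε (F i) = 0
  hεK : ∀ i, ε (K i : U) = 1
  I : Type
  V : I → Type
  iV1 : ∀ c, AddCommGroup (V c)
  iV2 : ∀ c, Module ℂ (V c)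
  ρ : ∀ c, U →ₐ[ℂ] Module.End ℂ (V c)
  hfd : ∀ c, FiniteDimensional ℂ (V c)
  hsimple : ∀ c (N : Submodule ℂ (V c)), (∀ (u : U), ∀ v ∈ N, ρ c u v ∈ N) → N = ⊥ ∨ N = ⊤
  hnt : ∀ c, ∃ v : V c, v ≠ 0
  hwt : ∀ c, WtSpan q d (fun j => ρ c (K j : U))
  A : Type
  iA1 : Ring A
  iA2 : Algebra ℂ A
  ι : A →ₗ[ℂ] (U →ₗ[ℂ] ℂ)
  hιinj : Function.Injective ι
  hι1 : ∀ u, ι 1 u = ε u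
  hιmul : ∀ x y u, ι (x * y) u = m2 (ι x) (ι y) (Δ u)
  cf : ∀ c : I, Module.Dual ℂ (V c) → V c → A
  hcf : ∀ c ξ v u, ι (cf c ξ v) u = ξ (ρ c u v)
  hAgen : Algebra.adjoin ℂ {x : A | ∃ c ξ v, x = cf c ξ v} = ⊤
  act : (Fin n → ℂˣ) × (Fin n → ℂˣ) → (A ≃ₐ[ℂ] A)
  hact : ∀ g c (ξ : Module.Dual ℂ (V c)) v (μ η : Fin n → ℤ),
      (∀ ν, ν ≠ μ → ∀ x, IsWt q d (fun j => ρ c (K j : U)) ν x → ξ x = 0) →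
      IsWt q d (fun j => ρ c (K j : U)) η v →
      act g (cf c ξ v) =
        ((((∏ i, g.1 i ^ (-μ i)) * (∏ i, g.2 i ^ η i) : ℂˣ) : ℂ)) • cf c ξ v

attribute [instance] Oq.iU1 Oq.iU2 Oq.iV1 Oq.iV2 Oq.iA1 Oq.iA2 Oq.hfd

namespace Oq
variable (D : Oq)

/-- weights in `V c` -/
def VWt (c : D.I) (μ : Fin D.n → ℤ) (x : D.V c) : Prop :=
  IsWt D.q D.d (fun j => D.ρ c (D.K j : D.U)) μ x

variable {D}

theorem VWt_inv {c : D.I} {μ : Fin D.n → ℤ} {x : D.V c} (h : D.VWt c μ x) (i : Fin D.n) :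
    D.ρ c (((D.K i)⁻¹ : D.Uˣ) : D.U) x = D.q ^ (-((D.d i : ℤ) * μ i)) • x := by
  have h1 : D.ρ c (D.K i : D.U) x = _ := h i
  have h2 := congrArg (D.ρ c (((D.K i)⁻¹ : D.Uˣ) : D.U)) h1
  rw [← Module.End.mul_apply, ← map_mul, Units.inv_mul, map_one, Module.End.one_apply,
    map_smul] at h2
  conv_rhs => rw [h2]
  rw [smul_smul, ← zpow_add₀ D.hq.1, neg_add_cancel, zpow_zero, one_smul]

theorem VWt_of_inv {c : D.I} {μ : Fin D.n → ℤ} {x : D.V c}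
    (h : ∀ i, D.ρ c (((D.K i)⁻¹ : D.Uˣ) : D.U) x = D.q ^ ((D.d i : ℤ) * μ i) • x) :
    D.VWt c (-μ) x := by
  intro i
  show D.ρ c (D.K i : D.U) x = _
  have h2 := congrArg (D.ρ c (D.K i : D.U)) (h i)
  rw [← Module.End.mul_apply, ← map_mul, Units.mul_inv, map_one, Module.End.one_apply,
    map_smul] at h2
  conv_rhs => rw [h2]
  rw [smul_smul, ← zpow_add₀ D.hq.1, Pi.neg_apply, mul_neg, neg_add_cancel, zpow_zero, one_smul]

theorem m2_comm {U : Type} [Ring U] [Algebra ℂ U] (f g : U →ₗ[ℂ] ℂ) (t : U ⊗[ℂ] U) :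
    m2 f g (Algebra.TensorProduct.comm ℂ U U t) = m2 g f t := by
  induction t using TensorProduct.induction_on with
  | zero => simp
  | tmul x y => simp [mul_comm]
  | add x y hx hy => rw [map_add, map_add, map_add, hx, hy]

/-- the algebra `(Aᵐᵒᵖ)` case of the data: exchange `E` and `F`. -/
noncomputable def op (D : Oq) : Oq where
  q := D.q
  n := D.n
  a := D.a
  d := D.d
  hq := D.hq
  ha := D.ha
  hd := D.hd
  hsym := D.hsym
  hR := D.hR
  hdet := D.hdet
  U := D.U
  iU1 := D.iU1
  iU2 := D.iU2
  E := D.F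
  F := D.E
  K := fun i => (D.K i)⁻¹
  hrel := uqRels_swap D.hq D.hrel
  huniv := by
    intro B _ _ E' F' K' h
    obtain ⟨φ, ⟨h1, h2, h3⟩, h4⟩ := D.huniv B F' E' (fun i => (K' i)⁻¹) (uqRels_swap D.hq h)
    have key : ∀ φ : D.U →ₐ[ℂ] B, (∀ i, φ (D.K i : D.U) = (((K' i)⁻¹ : Bˣ) : B)) ↔
        (∀ i, φ (((D.K i)⁻¹ : D.Uˣ) : D.U) = (K' i : B)) := by
      intro φ
      refine forall_congr' fun i => ?_
      have e1 : φ (D.K i : D.U) = ((Units.map (φ : D.U →* B) (D.K i) : Bˣ) : B) := rfl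
      have e2 : φ (((D.K i)⁻¹ : D.Uˣ) : D.U) = (((Units.map (φ : D.U →* B) (D.K i))⁻¹ : Bˣ) : B) := rfl
      rw [e1, e2, Units.val_inj, Units.val_inj, eq_comm, inv_eq_iff_eq_inv, eq_comm,
        inv_eq_iff_eq_inv]
    exact ⟨φ, ⟨h2, h1, (key φ).mp h3⟩, fun ψ hψ => h4 ψ ⟨hψ.2.1, hψ.1, (key ψ).mpr hψ.2.2⟩⟩
  Δ := ((Algebra.TensorProduct.comm ℂ D.U D.U).toAlgHom).comp D.Δ
  ε := D.ε
  hΔE := by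
    intro i
    simp [D.hΔF, add_comm]
  hΔF := by
    intro i
    simp [D.hΔE, add_comm]
  hΔK := by
    intro i
    have h1 : D.Δ (((D.K i)⁻¹ : D.Uˣ) : D.U) =
        (((D.K i)⁻¹ : D.Uˣ) : D.U) ⊗ₜ (((D.K i)⁻¹ : D.Uˣ) : D.U) := by
      have h2 : D.Δ (((D.K i)⁻¹ : D.Uˣ) : D.U) * D.Δ (D.K i : D.U) = 1 := by
        rw [← map_mul, Units.inv_mul, map_one]
      have h3 : D.Δ (D.K i : D.U) *
          ((((D.K i)⁻¹ : D.Uˣ) : D.U) ⊗ₜ (((D.K i)⁻¹ : D.Uˣ) : D.U)) = 1 := by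
        rw [D.hΔK, Algebra.TensorProduct.tmul_mul_tmul, Units.mul_inv]; rfl
      exact left_inv_eq_right_inv h2 h3
    simp [h1]
  hεE := D.hεF
  hεF := D.hεE
  hεK := by
    intro i
    have h2 : D.ε (((D.K i)⁻¹ : D.Uˣ) : D.U) * D.ε (D.K i : D.U) = 1 := by
      rw [← map_mul, Units.inv_mul, map_one]
    rwa [D.hεK, mul_one] at h2
  I := D.I
  V := D.V
  iV1 := D.iV1
  iV2 := D.iV2
  ρ := D.ρ
  hfd := D.hfd
  hsimple := D.hsimple
  hnt := D.hnt
  hwt := by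
    intro c x
    refine Submodule.span_mono ?_ (D.hwt c x)
    rintro y ⟨μ, hμ⟩
    refine ⟨-μ, fun i => ?_⟩
    have := VWt_inv (D := D) hμ i
    rw [Pi.neg_apply, mul_neg]
    exact this
  A := D.Aᵐᵒᵖ
  iA1 := inferInstance
  iA2 := inferInstance
  ι := D.ι ∘ₗ (MulOpposite.opLinearEquiv ℂ).symm.toLinearMap
  hιinj := D.hιinj.comp (MulOpposite.opLinearEquiv ℂ).symm.injective
  hι1 := fun u => D.hι1 u
  hιmul := by
    intro x y u
    have := D.hιmul y.unop x.unop u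
    simp only [AlgHom.comp_apply]
    exact this.trans (m2_comm _ _ _).symm
  cf := fun c ξ v => MulOpposite.op (D.cf c ξ v)
  hcf := fun c ξ v u => D.hcf c ξ v u
  hAgen := by
    rw [eq_top_iff]
    rintro x -
    have h1 : x.unop ∈ Algebra.adjoin ℂ {x : D.A | ∃ c ξ v, x = D.cf c ξ v} := by
      rw [D.hAgen]; trivial
    have key : ∀ y ∈ Algebra.adjoin ℂ {x : D.A | ∃ c ξ v, x = D.cf c ξ v},
        MulOpposite.op y ∈ Algebra.adjoin ℂ
          {x : D.Aᵐᵒᵖ | ∃ c ξ v, x = MulOpposite.op (D.cf c ξ v)} := by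
      intro y hy
      induction hy using Algebra.adjoin_induction with
      | mem y hy =>
        obtain ⟨c, ξ, v, rfl⟩ := hy
        exact Algebra.subset_adjoin ⟨c, ξ, v, rfl⟩
      | algebraMap r => exact Subalgebra.algebraMap_mem _ r
      | add y z _ _ hy hz => exact Subalgebra.add_mem _ hy hz
      | mul y z _ _ hy hz => exact Subalgebra.mul_mem _ hz hy
    exact key _ h1
  act := fun g => AlgEquiv.op (D.act g⁻¹)
  hact := by
    intro g c ξ v μ η h1 h2
    have := D.hact g⁻¹ c ξ v (-μ) (-η) (fun ν hν x hx => h1 (-ν) (by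
      intro h; exact hν (by rw [← h, neg_neg])) x (fun i => by
        have := VWt_inv (D := D) hx i
        rw [Pi.neg_apply, mul_neg]
        exact this)) (VWt_of_inv h2)
    apply MulOpposite.unop_injective
    refine Eq.trans this ?_
    rw [MulOpposite.unop_smul]
    simp
end Oq
end OQ


namespace OQ

open scoped TensorProduct

section serre
variable {B : Type} [Ring B] [Algebra ℂ B]

theorem pow_skew {κ x : B} {α : ℂ} (h : κ * x = α • (x * κ)) (m : ℕ) :
    κ ^ m * x = α ^ m • (x * κ ^ m) := by
  induction m with
  | zero => simp
  | succ m ih =>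
    rw [pow_succ, mul_assoc, h, mul_smul_comm, ← mul_assoc, ih, smul_mul_assoc, smul_smul,
      mul_assoc, ← pow_succ, ← pow_succ']

theorem skew_pow {κ x : B} {α : ℂ} (h : κ * x = α • (x * κ)) (m : ℕ) :
    κ * x ^ m = α ^ m • (x ^ m * κ) := by
  induction m with
  | zero => simp
  | succ m ih =>
    rw [pow_succ, ← mul_assoc, ih, smul_mul_assoc, mul_assoc, h, mul_smul_comm, smul_smul,
      ← mul_assoc, ← pow_succ, mul_assoc]

/-- the scalar -/
noncomputable def serC (s s' α β γ : ℂ) : ℕ → ℂ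
  | 0 => s'
  | m + 1 => s * (α ^ (m + 1) * β) * serC s s' α β γ m

theorem ser_mono {x y κ κ' : B} {α β : ℂ} (γ : ℂ) (h1 : κ * x = α • (x * κ))
    (h2 : κ * y = β • (y * κ)) (h3 : κ' * x = β • (x * κ')) (h4 : κ' * y = γ • (y * κ'))
    (h5 : κ * κ' = κ' * κ) (s s' : ℂ) (k l : ℕ) :
    (s • (κ * x)) ^ k * (s' • (κ' * y)) * (s • (κ * x)) ^ l =
      (γ * serC s s' α β γ (k + l)) • (x ^ k * y * x ^ l * (κ ^ (k + l) * κ')) := by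
  induction l generalizing k with
  | zero =>
    induction k with
    | zero => simp [serC, h4, smul_smul, mul_comm]
    | succ k ih =>
      simp only [pow_zero, mul_one, add_zero] at ih ⊢
      have e1 : κ * (x ^ (k+1) * y) = (α ^ (k+1) * β) • (x ^ (k+1) * y * κ) := by
        rw [← mul_assoc, skew_pow h1, smul_mul_assoc, mul_assoc, h2, mul_smul_comm, smul_smul,
          mul_assoc]
      have e2 : (s • (κ * x)) ^ (k+1) * (s' • (κ' * y)) =
          (s * (γ * serC s s' α β γ k)) • ((κ * (x ^ (k+1) * y)) * (κ ^ k * κ')) := by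
        rw [pow_succ', mul_assoc, ih, smul_mul_smul_comm]
        congr 1
        rw [pow_succ']; simp only [mul_assoc]
      rw [e2, e1, smul_mul_assoc, smul_smul, serC]
      congr 1
      · ring
      · rw [pow_succ' κ]; simp only [mul_assoc]
  | succ l ih =>
    have e1 : κ ^ (k+l+1) * κ' * x = (α ^ (k+l+1) * β) • (x * (κ ^ (k+l+1) * κ')) := by
      rw [mul_assoc, h3, mul_smul_comm, ← mul_assoc, pow_skew h1, smul_mul_assoc, smul_smul,
        mul_assoc, mul_comm β]
    have e3 : κ ^ (k+l) * κ' * κ = κ ^ (k+l+1) * κ' := by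
      rw [mul_assoc, ← h5, ← mul_assoc, pow_succ]
    have e2 : (s • (κ * x)) ^ k * (s' • (κ' * y)) * (s • (κ * x)) ^ (l+1) =
        (γ * serC s s' α β γ (k + l) * s) • (x ^ k * y * x ^ l * (κ ^ (k+l) * κ' * κ * x)) := by
      rw [pow_succ, ← mul_assoc, ih, smul_mul_smul_comm]
      congr 1
      simp only [mul_assoc]
    rw [e2, e3, e1, mul_smul_comm, smul_smul, ← add_assoc, serC]
    congr 1
    · ring
    · rw [pow_succ x l]; simp only [mul_assoc]

theorem qbinom_symm (t : ℂ) {m k : ℕ} (h : k ≤ m) : qbinom t m (m - k) = qbinom t m k := by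
  unfold qbinom
  rw [Nat.sub_sub_self h, mul_comm]

theorem serre_op {x y κ κ' : B} {α β : ℂ} (γ : ℂ) (h1 : κ * x = α • (x * κ))
    (h2 : κ * y = β • (y * κ)) (h3 : κ' * x = β • (x * κ')) (h4 : κ' * y = γ • (y * κ'))
    (h5 : κ * κ' = κ' * κ) (s s' t : ℂ) (m : ℕ)
    (h : ∑ k ∈ Finset.range (m + 1), ((-1 : ℂ) ^ k * qbinom t m k) •
        (x ^ (m - k) * y * x ^ k) = 0) :
    ∑ k ∈ Finset.range (m + 1), ((-1 : ℂ) ^ k * qbinom t m k) •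
        (MulOpposite.op (s • (κ * x)) ^ (m - k) * MulOpposite.op (s' • (κ' * y)) *
          MulOpposite.op (s • (κ * x)) ^ k) = 0 := by
  apply MulOpposite.unop_injective
  rw [MulOpposite.unop_zero, Finset.unop_sum]
  have e1 : ∀ k ∈ Finset.range (m+1), MulOpposite.unop (((-1 : ℂ) ^ k * qbinom t m k) •
        (MulOpposite.op (s • (κ * x)) ^ (m - k) * MulOpposite.op (s' • (κ' * y)) *
          MulOpposite.op (s • (κ * x)) ^ k)) =
      (γ * serC s s' α β γ m) • (((-1 : ℂ) ^ k * qbinom t m k) • (x ^ k * y * x ^ (m - k))) *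
        (κ ^ m * κ') := by
    intro k hk
    have hk : k ≤ m := by simpa [Nat.lt_succ_iff] using hk
    simp only [MulOpposite.unop_smul, MulOpposite.unop_mul, MulOpposite.unop_pow,
      MulOpposite.unop_op]
    rw [← mul_assoc, ser_mono γ h1 h2 h3 h4 h5, Nat.add_sub_cancel' hk, smul_comm,
      smul_mul_assoc, smul_mul_assoc]
  rw [Finset.sum_congr rfl e1, ← Finset.sum_mul, ← Finset.smul_sum]
  have e2 : ∑ k ∈ Finset.range (m + 1), (((-1 : ℂ) ^ k * qbinom t m k) •
      (x ^ k * y * x ^ (m - k))) = 0 := by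
    rw [← Finset.sum_range_reflect]
    have : ∀ k ∈ Finset.range (m+1), ((-1 : ℂ) ^ (m + 1 - 1 - k) * qbinom t m (m + 1 - 1 - k)) •
        (x ^ (m + 1 - 1 - k) * y * x ^ (m - (m + 1 - 1 - k))) =
        ((-1 : ℂ) ^ m) • (((-1 : ℂ) ^ k * qbinom t m k) • (x ^ (m - k) * y * x ^ k)) := by
      intro k hk
      have hk : k ≤ m := by simpa [Nat.lt_succ_iff] using hk
      simp only [Nat.add_sub_cancel, Nat.sub_sub_self hk]
      rw [qbinom_symm t hk, smul_smul, ← mul_assoc, ← pow_add]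
      congr 2
      rw [show m + k = (m - k) + 2 * k by omega, pow_add, pow_mul]; simp
    rw [Finset.sum_congr rfl this, ← Finset.smul_sum, h, smul_zero]
  rw [e2, smul_zero, zero_mul]

end serre

namespace Oq
variable (D : Oq)

/-- `K` -/
abbrev Kp (i : Fin D.n) : D.U := (D.K i : D.U)
/-- `K⁻¹` -/
abbrev Km (i : Fin D.n) : D.U := (((D.K i)⁻¹ : D.Uˣ) : D.U)

variable {D}

theorem KK (i j : Fin D.n) : D.Kp i * D.Kp j = D.Kp j * D.Kp i := D.hrel.1 i j
theorem KE (i j : Fin D.n) : D.Kp i * D.E j = (D.q ^ ((D.d i : ℤ) * D.a i j)) • (D.E j * D.Kp i) :=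
  D.hrel.2.1 i j
theorem KF (i j : Fin D.n) : D.Kp i * D.F j = (D.q ^ (-((D.d i : ℤ) * D.a i j))) • (D.F j * D.Kp i) :=
  D.hrel.2.2.1 i j
theorem EF (i j : Fin D.n) : D.E i * D.F j - D.F j * D.E i =
    if i = j then (D.q ^ (D.d i : ℤ) - D.q ^ (-(D.d i : ℤ)))⁻¹ • (D.Kp i - D.Km i) else 0 :=
  D.hrel.2.2.2.1 i j
theorem KmE (i j : Fin D.n) :
    D.Km i * D.E j = (D.q ^ (-((D.d i : ℤ) * D.a i j))) • (D.E j * D.Km i) :=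
  (uqRels_swap D.hq D.hrel).2.2.1 i j
theorem KmF (i j : Fin D.n) :
    D.Km i * D.F j = (D.q ^ (((D.d i : ℤ) * D.a i j))) • (D.F j * D.Km i) :=
  (uqRels_swap D.hq D.hrel).2.1 i j
theorem KmKm (i j : Fin D.n) : D.Km i * D.Km j = D.Km j * D.Km i :=
  (uqRels_swap D.hq D.hrel).1 i j
theorem KpKm (i j : Fin D.n) : D.Kp i * D.Km j = D.Km j * D.Kp i := by
  have cm : Commute (D.K i) (D.K j) := Units.ext (D.hrel.1 i j)
  exact congrArg Units.val cm.inv_right.eq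
@[simp] theorem KpKm1 (i : Fin D.n) : D.Kp i * D.Km i = 1 := Units.mul_inv _
@[simp] theorem KmKp1 (i : Fin D.n) : D.Km i * D.Kp i = 1 := Units.inv_mul _

theorem EK (i j : Fin D.n) : D.E j * D.Kp i = (D.q ^ (-((D.d i : ℤ) * D.a i j))) • (D.Kp i * D.E j) := by
  rw [KE, smul_smul, ← zpow_add₀ D.hq.1]; simp
theorem FK (i j : Fin D.n) : D.F j * D.Kp i = (D.q ^ (((D.d i : ℤ) * D.a i j))) • (D.Kp i * D.F j) := by
  rw [KF, smul_smul, ← zpow_add₀ D.hq.1]; simp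
theorem FKm (i j : Fin D.n) : D.F j * D.Km i = (D.q ^ (-((D.d i : ℤ) * D.a i j))) • (D.Km i * D.F j) := by
  rw [KmF, smul_smul, ← zpow_add₀ D.hq.1]; simp

theorem hΔKm (i : Fin D.n) : D.Δ (D.Km i) = D.Km i ⊗ₜ D.Km i := D.op.hΔK i |> fun h => by
  have h2 : D.Δ (D.Km i) * D.Δ (D.Kp i) = 1 := by
    rw [← map_mul, KmKp1, map_one]
  have h3 : D.Δ (D.Kp i) * (D.Km i ⊗ₜ D.Km i) = 1 := by
    rw [D.hΔK, Algebra.TensorProduct.tmul_mul_tmul, Units.mul_inv]; rfl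
  exact left_inv_eq_right_inv h2 h3

theorem hεKm (i : Fin D.n) : D.ε (D.Km i) = 1 := D.op.hεK i

/-- generation -/
theorem gen (S : Subalgebra ℂ D.U) (hE : ∀ i, D.E i ∈ S) (hF : ∀ i, D.F i ∈ S)
    (hK : ∀ i, D.Kp i ∈ S) (hK' : ∀ i, D.Km i ∈ S) : ∀ u, u ∈ S := by
  let K' : Fin D.n → Sˣ := fun i => ⟨⟨D.Kp i, hK i⟩, ⟨D.Km i, hK' i⟩,
    Subtype.ext (KpKm1 i), Subtype.ext (KmKp1 i)⟩
  have hr : UqRels D.q D.a D.d S (fun i => ⟨D.E i, hE i⟩) (fun i => ⟨D.F i, hF i⟩) K' := by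
    obtain ⟨h1, h2, h3, h4, h5, h6⟩ := D.hrel
    refine ⟨fun i j => Subtype.ext (h1 i j), fun i j => Subtype.ext (h2 i j),
      fun i j => Subtype.ext (h3 i j), fun i j => ?_, fun i j hij => ?_, fun i j hij => ?_⟩
    · apply Subtype.ext
      have := h4 i j
      split_ifs with h
      · rw [if_pos h] at this; exact this
      · rw [if_neg h] at this; exact this
    · apply Subtype.ext
      have := h5 i j hij
      refine Eq.trans ?_ (this.trans rfl); simp
    · apply Subtype.ext
      have := h6 i j hij
      refine Eq.trans ?_ (this.trans rfl); simp
  obtain ⟨φ, ⟨p1, p2, p3⟩, -⟩ := D.huniv S _ _ _ hr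
  obtain ⟨ψ, -, hψ⟩ := D.huniv D.U _ _ _ D.hrel
  have e1 : S.val.comp φ = AlgHom.id ℂ D.U := by
    rw [hψ (AlgHom.id ℂ D.U) ⟨fun _ => rfl, fun _ => rfl, fun _ => rfl⟩]
    refine hψ _ ⟨fun i => ?_, fun i => ?_, fun i => ?_⟩
    · simp [p1]
    · simp [p2]
    · simp [p3, K']
  intro u
  have := congrArg (fun f => f u) e1
  simp only [AlgHom.comp_apply, AlgHom.id_apply] at this
  rw [← this]; exact (φ u).2

theorem gen_ind {P : D.U → Prop} (h1 : ∀ r : ℂ, P (algebraMap ℂ D.U r))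
    (hadd : ∀ u v, P u → P v → P (u + v)) (hmul : ∀ u v, P u → P v → P (u * v))
    (hE : ∀ i, P (D.E i)) (hF : ∀ i, P (D.F i))
    (hK : ∀ i, P (D.Kp i)) (hK' : ∀ i, P (D.Km i)) (u : D.U) : P u :=
  gen (D := D) { carrier := {u | P u}, mul_mem' := fun {a b} ha hb => hmul a b ha hb,
                 add_mem' := fun {a b} ha hb => hadd a b ha hb,
                 algebraMap_mem' := h1 } hE hF hK hK' u

section modules
variable {M : Type} [AddCommGroup M] [Module ℂ M]

/-- smallest submodule containing `M0` stable under the `f j` -/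
def wspan {n : ℕ} (f : Fin n → M →ₗ[ℂ] M) (M0 : Submodule ℂ M) : Submodule ℂ M :=
  sInf {N | M0 ≤ N ∧ ∀ j, ∀ x ∈ N, f j x ∈ N}

theorem le_wspan {n : ℕ} (f : Fin n → M →ₗ[ℂ] M) (M0 : Submodule ℂ M) : M0 ≤ wspan f M0 :=
  le_sInf fun _ h => h.1

theorem wspan_f {n : ℕ} (f : Fin n → M →ₗ[ℂ] M) (M0 : Submodule ℂ M) (j : Fin n) {x : M}
    (hx : x ∈ wspan f M0) : f j x ∈ wspan f M0 := by
  rw [wspan, Submodule.mem_sInf] at hx ⊢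
  exact fun N hN => hN.2 j _ (hx N hN)

theorem wspan_le {n : ℕ} {f : Fin n → M →ₗ[ℂ] M} {M0 N : Submodule ℂ M} (h : M0 ≤ N)
    (h2 : ∀ j, ∀ x ∈ N, f j x ∈ N) : wspan f M0 ≤ N := sInf_le ⟨h, h2⟩

theorem wspan_le' {n : ℕ} {f : Fin n → M →ₗ[ℂ] M} {M0 N : Submodule ℂ M} (h : M0 ≤ N)
    (h2 : ∀ j, ∀ x ∈ wspan f M0, x ∈ N → f j x ∈ N) : wspan f M0 ≤ N := by
  have : wspan f M0 ≤ N ⊓ wspan f M0 := by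
    refine wspan_le (le_inf h (le_wspan _ _)) ?_
    intro j x hx
    exact ⟨h2 j x hx.2 hx.1, wspan_f _ _ j hx.2⟩
  exact this.trans inf_le_left

theorem wspan_skew {n : ℕ} {f : Fin n → M →ₗ[ℂ] M} {M0 : Submodule ℂ M} (g : M →ₗ[ℂ] M)
    (hg : ∀ x ∈ M0, g x ∈ M0) (c : Fin n → ℂ) (hc : ∀ j x, g (f j x) = c j • f j (g x)) :
    ∀ x ∈ wspan f M0, g x ∈ wspan f M0 := by
  have : wspan f M0 ≤ (wspan f M0).comap g := by
    refine wspan_le' (fun x hx => le_wspan _ _ (hg x hx)) ?_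
    intro j x _ hx
    rw [Submodule.mem_comap, hc]
    exact Submodule.smul_mem _ _ (wspan_f _ _ j hx)
  exact this

theorem stable_of_gens (ρ : D.U →ₐ[ℂ] Module.End ℂ M) (N : Submodule ℂ M)
    (hE : ∀ i, ∀ x ∈ N, ρ (D.E i) x ∈ N) (hF : ∀ i, ∀ x ∈ N, ρ (D.F i) x ∈ N)
    (hK : ∀ i, ∀ x ∈ N, ρ (D.Kp i) x ∈ N) (hK' : ∀ i, ∀ x ∈ N, ρ (D.Km i) x ∈ N) :
    ∀ u, ∀ x ∈ N, ρ u x ∈ N := by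
  intro u
  refine gen_ind (P := fun u => ∀ x ∈ N, ρ u x ∈ N) ?_ ?_ ?_ hE hF hK hK' u
  · intro r x hx
    rw [AlgHom.commutes, Module.algebraMap_end_apply]; exact N.smul_mem _ hx
  · intro u v hu hv x hx
    rw [map_add]; exact N.add_mem (hu x hx) (hv x hx)
  · intro u v hu hv x hx
    rw [map_mul]; exact hu _ (hv x hx)

theorem wspanF_stable (ρ : D.U →ₐ[ℂ] Module.End ℂ M) (M0 : Submodule ℂ M)
    (hE : ∀ i, ∀ x ∈ M0, ρ (D.E i) x ∈ M0)
    (hK : ∀ i, ∀ x ∈ M0, ρ (D.Kp i) x ∈ M0) (hK' : ∀ i, ∀ x ∈ M0, ρ (D.Km i) x ∈ M0) :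
    ∀ u, ∀ x ∈ wspan (fun j => ρ (D.F j)) M0, ρ u x ∈ wspan (fun j => ρ (D.F j)) M0 := by
  have hK1 : ∀ i, ∀ x ∈ wspan (fun j => ρ (D.F j)) M0, ρ (D.Kp i) x ∈
      wspan (fun j => ρ (D.F j)) M0 := fun i => by
    refine wspan_skew (f := fun j => ρ (D.F j)) _ (hK i) (fun j => (D.q ^ (-((D.d i : ℤ) * D.a i j)))) ?_
    intro j x
    rw [← Module.End.mul_apply, ← map_mul, KF, map_smul, map_mul]; rfl
  have hK2 : ∀ i, ∀ x ∈ wspan (fun j => ρ (D.F j)) M0, ρ (D.Km i) x ∈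
      wspan (fun j => ρ (D.F j)) M0 := fun i => by
    refine wspan_skew (f := fun j => ρ (D.F j)) _ (hK' i) (fun j => (D.q ^ (((D.d i : ℤ) * D.a i j)))) ?_
    intro j x
    rw [← Module.End.mul_apply, ← map_mul, KmF, map_smul, map_mul]; rfl
  have hF1 : ∀ i, ∀ x ∈ wspan (fun j => ρ (D.F j)) M0, ρ (D.F i) x ∈
      wspan (fun j => ρ (D.F j)) M0 := fun i x hx => wspan_f (fun j => ρ (D.F j)) _ i hx
  refine stable_of_gens ρ _ (fun i => ?_) hF1 hK1 hK2
  have : wspan (fun j => ρ (D.F j)) M0 ≤ (wspan (fun j => ρ (D.F j)) M0).comap (ρ (D.E i)) := by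
    refine wspan_le' (fun x hx => le_wspan _ _ (hE i x hx)) ?_
    intro j x hx0 hx
    rw [Submodule.mem_comap] at hx ⊢
    have e := EF (D := D) i j
    rw [sub_eq_iff_eq_add] at e
    show ρ (D.E i) (ρ (D.F j) x) ∈ _
    rw [← Module.End.mul_apply, ← map_mul, e, map_add, LinearMap.add_apply, map_mul]
    refine Submodule.add_mem _ ?_ (hF1 j _ hx)
    split_ifs with h
    · rw [map_smul, map_sub]
      exact Submodule.smul_mem _ _ (Submodule.sub_mem _ (hK1 i x hx0) (hK2 i x hx0))
    · simp
  exact this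

end modules

/-- the antipode -/
theorem exists_antipode (D : Oq) : ∃ S : D.U →ₐ[ℂ] D.Uᵐᵒᵖ,
    (∀ i, (S (D.E i)).unop = -(D.Km i * D.E i)) ∧ (∀ i, (S (D.F i)).unop = -(D.F i * D.Kp i)) ∧
    (∀ i, (S (D.Kp i)).unop = D.Km i) ∧ (∀ i, (S (D.Km i)).unop = D.Kp i) := by
  let K' : Fin D.n → D.Uᵐᵒᵖˣ := fun i => ⟨MulOpposite.op (D.Km i), MulOpposite.op (D.Kp i),
    by rw [← MulOpposite.op_mul, KpKm1, MulOpposite.op_one],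
    by rw [← MulOpposite.op_mul, KmKp1, MulOpposite.op_one]⟩
  have hs : ∀ i j, -((D.d i : ℤ) * D.a i j) = -((D.d j : ℤ) * D.a j i) := fun i j => by
    rw [D.hsym]
  have hs' : ∀ i j, ((D.d i : ℤ) * D.a i j) = ((D.d j : ℤ) * D.a j i) := fun i j => by
    rw [D.hsym]
  have hF : ∀ i, -(D.F i * D.Kp i) = (-(D.q ^ ((D.d i : ℤ) * D.a i i))) • (D.Kp i * D.F i) := by
    intro i; rw [FK, neg_smul]
  have hE : ∀ i, -(D.Km i * D.E i) = (-1 : ℂ) • (D.Km i * D.E i) := by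
    intro i; simp
  have hr : UqRels D.q D.a D.d D.Uᵐᵒᵖ (fun i => MulOpposite.op (-(D.Km i * D.E i)))
      (fun i => MulOpposite.op (-(D.F i * D.Kp i))) K' := by
    obtain ⟨-, -, -, -, h5, h6⟩ := D.hrel
    refine ⟨fun i j => ?_, fun i j => ?_, fun i j => ?_, fun i j => ?_, fun i j hij => ?_,
      fun i j hij => ?_⟩
    · exact congrArg MulOpposite.op (KmKm j i)
    · apply MulOpposite.unop_injective
      show -(D.Km j * D.E j) * D.Km i = D.q ^ ((D.d i : ℤ) * D.a i j) • (D.Km i * -(D.Km j * D.E j))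
      rw [mul_neg, ← mul_assoc, KmKm i j, mul_assoc, KmE i j, mul_smul_comm, smul_neg, smul_smul,
        ← zpow_add₀ D.hq.1]
      simp [mul_assoc]
    · apply MulOpposite.unop_injective
      show -(D.F j * D.Kp j) * D.Km i =
        D.q ^ (-((D.d i : ℤ) * D.a i j)) • (D.Km i * -(D.F j * D.Kp j))
      rw [mul_neg, ← mul_assoc, KmF, smul_mul_assoc, smul_neg, smul_smul, ← zpow_add₀ D.hq.1,
        neg_mul, mul_assoc, KpKm]
      simp [mul_assoc]
    · apply MulOpposite.unop_injective
      have e1 : -(D.F j * D.Kp j) * -(D.Km i * D.E i) - -(D.Km i * D.E i) * -(D.F j * D.Kp j) =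
          - (D.Km i * (D.E i * D.F j - D.F j * D.E i) * D.Kp j) := by
        have : D.F j * D.Kp j * (D.Km i * D.E i) = D.Km i * (D.F j * D.E i) * D.Kp j := by
          rw [show D.F j * D.Kp j * (D.Km i * D.E i) = D.F j * (D.Kp j * D.Km i) * D.E i by
            simp only [mul_assoc], KpKm, ← mul_assoc, mul_assoc _ _ (D.E i), KE, FKm,
            smul_mul_assoc, mul_smul_comm, smul_smul, ← zpow_add₀ D.hq.1, hs' j i,
            neg_add_cancel, zpow_zero, one_smul]
          simp only [mul_assoc]
        rw [neg_mul_neg, neg_mul_neg, this]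
        noncomm_ring
      have e2 := EF (D := D) i j
      show -(D.F j * D.Kp j) * -(D.Km i * D.E i) - -(D.Km i * D.E i) * -(D.F j * D.Kp j) = _
      rw [e1, e2]
      split_ifs with h
      · subst h
        show _ = _ • (D.Km i - D.Kp i)
        rw [mul_smul_comm, smul_mul_assoc, ← smul_neg]
        congr 1
        rw [mul_sub, sub_mul, KmKp1, one_mul, mul_assoc, KmKp1, mul_one, neg_sub]
      · simp
    · simp only [hE]
      exact serre_op (κ := D.Km i) (κ' := D.Km j) _ (KmE i i) (KmE i j)
        (by rw [KmE, hs]) (KmE j j) (KmKm i j) _ _ _ _ (h5 i j hij)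
    · simp only [hF]
      exact serre_op (κ := D.Kp i) (κ' := D.Kp j) _ (KF i i) (KF i j)
        (by rw [KF, hs]) (KF j j) (KK i j) _ _ _ _ (h6 i j hij)
  obtain ⟨S, ⟨p1, p2, p3⟩, -⟩ := D.huniv _ _ _ _ hr
  refine ⟨S, fun i => by rw [p1]; rfl, fun i => by rw [p2]; rfl, fun i => ?_, fun i => ?_⟩
  · have : S (D.Kp i) = _ := p3 i
    rw [this]; rfl
  · have h1 : S (D.Kp i) = _ := p3 i
    have h2 : S (D.Km i) * S (D.Kp i) = 1 := by rw [← map_mul, KmKp1, map_one]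
    have h3 : S (D.Kp i) * MulOpposite.op (D.Kp i) = 1 := by
      rw [h1]; exact congrArg MulOpposite.op (KpKm1 i)
    rw [left_inv_eq_right_inv h2 h3]; rfl

/-- the antipode -/
noncomputable def S (D : Oq) (u : D.U) : D.U := ((exists_antipode D).choose u).unop

theorem S_E (i : Fin D.n) : D.S (D.E i) = -(D.Km i * D.E i) := (exists_antipode D).choose_spec.1 i
theorem S_F (i : Fin D.n) : D.S (D.F i) = -(D.F i * D.Kp i) := (exists_antipode D).choose_spec.2.1 i
theorem S_Kp (i : Fin D.n) : D.S (D.Kp i) = D.Km i := (exists_antipode D).choose_spec.2.2.1 i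
theorem S_Km (i : Fin D.n) : D.S (D.Km i) = D.Kp i := (exists_antipode D).choose_spec.2.2.2 i
theorem S_mul (u v : D.U) : D.S (u * v) = D.S v * D.S u := by simp [S]
theorem S_add (u v : D.U) : D.S (u + v) = D.S u + D.S v := by simp [S]
theorem S_smul (c : ℂ) (v : D.U) : D.S (c • v) = c • D.S v := by simp [S]
@[simp] theorem S_one : D.S 1 = 1 := by simp [S]
theorem S_alg (c : ℂ) : D.S (algebraMap ℂ D.U c) = algebraMap ℂ D.U c := by
  simp [S]

/-- the antipode as a linear map -/
noncomputable def Sl (D : Oq) : D.U →ₗ[ℂ] D.U where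
  toFun := D.S
  map_add' := S_add
  map_smul' := S_smul

@[simp] theorem Sl_apply (u : D.U) : D.Sl u = D.S u := rfl

/-- `x ⊗ y ↦ x S(y)` -/
noncomputable def muS (D : Oq) : D.U ⊗[ℂ] D.U →ₗ[ℂ] D.U :=
  LinearMap.mul' ℂ D.U ∘ₗ TensorProduct.map LinearMap.id D.Sl

@[simp] theorem muS_tmul (x y : D.U) : D.muS (x ⊗ₜ y) = x * D.S y := by simp [muS]

theorem muS_mul (s : D.U ⊗[ℂ] D.U) (c : ℂ) (h : D.muS s = algebraMap ℂ _ c) (t : D.U ⊗[ℂ] D.U) :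
    D.muS (t * s) = c • D.muS t := by
  induction t using TensorProduct.induction_on with
  | zero => simp
  | add x y hx hy => rw [add_mul, map_add, hx, hy, map_add, smul_add]
  | tmul x y =>
    have : ∀ s : D.U ⊗[ℂ] D.U, D.muS (x ⊗ₜ y * s) = x * D.muS s * D.S y := by
      intro s
      induction s using TensorProduct.induction_on with
      | zero => simp
      | add x y hx hy => rw [mul_add, map_add, hx, hy, map_add, mul_add, add_mul]
      | tmul x' y' => simp [S_mul, mul_assoc]
    rw [this, h, ← Algebra.commutes, muS_tmul, mul_assoc, Algebra.smul_def]

theorem muS_Δ (u : D.U) : D.muS (D.Δ u) = algebraMap ℂ _ (D.ε u) := by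
  refine gen_ind (P := fun u => D.muS (D.Δ u) = algebraMap ℂ _ (D.ε u)) ?_ ?_ ?_ ?_ ?_ ?_ ?_ u
  · intro r
    rw [AlgHom.commutes, AlgHom.commutes, Algebra.TensorProduct.algebraMap_apply, muS_tmul]
    simp
  · intro u v hu hv; simp only [map_add, hu, hv]
  · intro u v hu hv
    rw [map_mul, muS_mul _ _ hv, hu, map_mul, mul_comm, map_mul, Algebra.smul_def]
  · intro i
    rw [D.hΔE, map_add, muS_tmul, muS_tmul, S_E, D.hεE, S_one, mul_neg, ← mul_assoc, KpKm1]; simp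
  · intro i
    rw [D.hΔF, map_add, muS_tmul, muS_tmul, S_F, D.hεF, S_Km]; simp
  · intro i
    rw [D.hΔK, muS_tmul, S_Kp, D.hεK]; simp
  · intro i
    rw [hΔKm, muS_tmul, S_Km, hεKm]; simp

/-- `x ⊗ y ↦ S(y) ⊗ S(x)` -/
noncomputable def Th (D : Oq) : D.U ⊗[ℂ] D.U →ₗ[ℂ] D.U ⊗[ℂ] D.U :=
  (TensorProduct.comm ℂ D.U D.U).toLinearMap ∘ₗ TensorProduct.map D.Sl D.Sl

@[simp] theorem Th_tmul (x y : D.U) : D.Th (x ⊗ₜ y) = D.S y ⊗ₜ D.S x := by simp [Th]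

theorem Th_mul (s t : D.U ⊗[ℂ] D.U) : D.Th (s * t) = D.Th t * D.Th s := by
  induction s using TensorProduct.induction_on with
  | zero => simp
  | add x y hx hy => rw [add_mul, map_add, hx, hy, map_add, mul_add]
  | tmul x y =>
    induction t using TensorProduct.induction_on with
    | zero => simp
    | add x y hx hy => rw [mul_add, map_add, hx, hy, map_add, add_mul]
    | tmul x' y' => simp [S_mul]

theorem Δ_S (u : D.U) : D.Δ (D.S u) = D.Th (D.Δ u) := by
  refine gen_ind (P := fun u => D.Δ (D.S u) = D.Th (D.Δ u)) ?_ ?_ ?_ ?_ ?_ ?_ ?_ u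
  · intro r
    rw [S_alg, AlgHom.commutes, Algebra.TensorProduct.algebraMap_apply, Th_tmul, S_alg, S_one,
      Algebra.algebraMap_eq_smul_one, TensorProduct.smul_tmul]
  · intro u v hu hv; simp only [map_add, S_add, hu, hv]
  · intro u v hu hv; rw [S_mul, map_mul, map_mul, hu, hv, Th_mul]
  · intro i
    rw [S_E, map_neg, map_mul, hΔKm, D.hΔE, map_add, Th_tmul, Th_tmul, S_E, S_one, S_Kp, mul_add,
      Algebra.TensorProduct.tmul_mul_tmul, Algebra.TensorProduct.tmul_mul_tmul, KmKp1, mul_one,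
      TensorProduct.tmul_neg, TensorProduct.neg_tmul, neg_add, add_comm]
  · intro i
    rw [S_F, map_neg, map_mul, D.hΔK, D.hΔF, map_add, Th_tmul, Th_tmul, S_F, S_one, S_Km, add_mul,
      Algebra.TensorProduct.tmul_mul_tmul, Algebra.TensorProduct.tmul_mul_tmul, KmKp1, one_mul,
      TensorProduct.tmul_neg, TensorProduct.neg_tmul, neg_add, add_comm]
  · intro i
    rw [S_Kp, hΔKm, D.hΔK, Th_tmul, S_Kp]
  · intro i
    rw [S_Km, hΔKm, D.hΔK, Th_tmul, S_Km]

end Oq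
end OQ


namespace OQ

open scoped TensorProduct

section
variable {U : Type} [Ring U] [Algebra ℂ U]

theorem m2_mulR {f g f' g' : U →ₗ[ℂ] ℂ} {s s' : U} (h : ∀ x, f' x = f (x * s))
    (h' : ∀ x, g' x = g (x * s')) (t : U ⊗[ℂ] U) : m2 f g (t * (s ⊗ₜ s')) = m2 f' g' t := by
  induction t using TensorProduct.induction_on with
  | zero => simp
  | tmul x y => simp [h, h']
  | add x y hx hy => rw [add_mul, map_add, map_add, hx, hy]

theorem m2_mulL {f g f' g' : U →ₗ[ℂ] ℂ} {s s' : U} (h : ∀ x, f' x = f (s * x))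
    (h' : ∀ x, g' x = g (s' * x)) (t : U ⊗[ℂ] U) : m2 f g ((s ⊗ₜ s') * t) = m2 f' g' t := by
  induction t using TensorProduct.induction_on with
  | zero => simp
  | tmul x y => simp [h, h']
  | add x y hx hy => rw [mul_add, map_add, map_add, hx, hy]

end

namespace Oq
variable {D : Oq}

theorem A_eq {x y : D.A} (h : ∀ u, D.ι x u = D.ι y u) : x = y :=
  D.hιinj (LinearMap.ext h)

theorem ι_alg (r : ℂ) (u : D.U) : D.ι (algebraMap ℂ D.A r) u = r * D.ε u := by
  rw [Algebra.algebraMap_eq_smul_one, map_smul, LinearMap.smul_apply, D.hι1, smul_eq_mul]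

theorem A_ind0 {P : D.A → Prop} (h1 : ∀ r : ℂ, P (algebraMap ℂ D.A r))
    (hadd : ∀ u v, P u → P v → P (u + v)) (hmul : ∀ u v, P u → P v → P (u * v))
    (hcf : ∀ c ξ v, P (D.cf c ξ v)) (x : D.A) : P x := by
  have hx : x ∈ Algebra.adjoin ℂ {x : D.A | ∃ c ξ v, x = D.cf c ξ v} := by rw [D.hAgen]; trivial
  induction hx using Algebra.adjoin_induction with
  | mem y hy => obtain ⟨c, ξ, v, rfl⟩ := hy; exact hcf c ξ v
  | algebraMap r => exact h1 r
  | add y z _ _ hy hz => exact hadd _ _ hy hz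
  | mul y z _ _ hy hz => exact hmul _ _ hy hz

theorem exists_L (u : D.U) : ∀ a : D.A, ∃ b : D.A, ∀ x, D.ι b x = D.ι a (x * u) := by
  have base : ∀ u : D.U, (∀ a a' : D.A, (∃ b : D.A, ∀ x, D.ι b x = D.ι a (x * u)) →
      (∃ b : D.A, ∀ x, D.ι b x = D.ι a' (x * u)) → ∃ b : D.A, ∀ x, D.ι b x = D.ι (a * a') (x * u)) →
      ∀ a : D.A, ∃ b : D.A, ∀ x, D.ι b x = D.ι a (x * u) := by
    intro u hm a
    refine A_ind0 ?_ ?_ hm ?_ a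
    · intro r
      refine ⟨D.ε u • algebraMap ℂ D.A r, fun x => ?_⟩
      rw [map_smul, LinearMap.smul_apply, ι_alg, ι_alg, map_mul, smul_eq_mul]; ring
    · rintro a a' ⟨b, hb⟩ ⟨b', hb'⟩
      exact ⟨b + b', fun x => by rw [map_add, map_add, LinearMap.add_apply, hb, hb']; rfl⟩
    · intro c ξ v
      refine ⟨D.cf c ξ (D.ρ c u v), fun x => ?_⟩
      rw [D.hcf, D.hcf, map_mul]; rfl
  have hK : ∀ i, ∀ a : D.A, ∃ b : D.A, ∀ x, D.ι b x = D.ι a (x * D.Kp i) := by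
    intro i
    refine base _ ?_
    rintro a a' ⟨b, hb⟩ ⟨b', hb'⟩
    exact ⟨b * b', fun x => by rw [D.hιmul, D.hιmul, map_mul, D.hΔK, m2_mulR hb hb']⟩
  have hK' : ∀ i, ∀ a : D.A, ∃ b : D.A, ∀ x, D.ι b x = D.ι a (x * D.Km i) := by
    intro i
    refine base _ ?_
    rintro a a' ⟨b, hb⟩ ⟨b', hb'⟩
    exact ⟨b * b', fun x => by rw [D.hιmul, D.hιmul, map_mul, hΔKm, m2_mulR hb hb']⟩
  refine gen_ind (P := fun u => ∀ a : D.A, ∃ b : D.A, ∀ x, D.ι b x = D.ι a (x * u))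
    ?_ ?_ ?_ ?_ ?_ hK hK' u
  · intro r a
    refine ⟨r • a, fun x => ?_⟩
    rw [← Algebra.commutes, ← Algebra.smul_def, map_smul, map_smul]; rfl
  · intro u v hu hv a
    obtain ⟨b, hb⟩ := hu a
    obtain ⟨b', hb'⟩ := hv a
    exact ⟨b + b', fun x => by rw [mul_add, map_add, map_add, LinearMap.add_apply, hb, hb']⟩
  · intro u v hu hv a
    obtain ⟨b, hb⟩ := hv a
    obtain ⟨b', hb'⟩ := hu b
    exact ⟨b', fun x => by rw [hb', hb, mul_assoc]⟩
  · intro i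
    refine base _ ?_
    rintro a a' ⟨b, hb⟩ ⟨b', hb'⟩
    obtain ⟨b2, hb2⟩ := hK i a
    exact ⟨b * a' + b2 * b', fun x => by
      rw [map_add, LinearMap.add_apply, D.hιmul, D.hιmul, D.hιmul, map_mul, D.hΔE, mul_add,
        map_add, m2_mulR hb (g' := D.ι a') (by simp), m2_mulR hb2 hb']⟩
  · intro i
    refine base _ ?_
    rintro a a' ⟨b, hb⟩ ⟨b', hb'⟩
    obtain ⟨b2, hb2⟩ := hK' i a'
    exact ⟨b * b2 + a * b', fun x => by
      rw [map_add, LinearMap.add_apply, D.hιmul, D.hιmul, D.hιmul, map_mul, D.hΔF, mul_add,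
        map_add, m2_mulR hb hb2, m2_mulR (f' := D.ι a) (by simp) hb']⟩

theorem exists_R (u : D.U) : ∀ a : D.A, ∃ b : D.A, ∀ x, D.ι b x = D.ι a (u * x) := by
  have base : ∀ u : D.U, (∀ a a' : D.A, (∃ b : D.A, ∀ x, D.ι b x = D.ι a (u * x)) →
      (∃ b : D.A, ∀ x, D.ι b x = D.ι a' (u * x)) → ∃ b : D.A, ∀ x, D.ι b x = D.ι (a * a') (u * x)) →
      ∀ a : D.A, ∃ b : D.A, ∀ x, D.ι b x = D.ι a (u * x) := by
    intro u hm a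
    refine A_ind0 ?_ ?_ hm ?_ a
    · intro r
      refine ⟨D.ε u • algebraMap ℂ D.A r, fun x => ?_⟩
      rw [map_smul, LinearMap.smul_apply, ι_alg, ι_alg, map_mul, smul_eq_mul]; ring
    · rintro a a' ⟨b, hb⟩ ⟨b', hb'⟩
      exact ⟨b + b', fun x => by rw [map_add, map_add, LinearMap.add_apply, hb, hb']; rfl⟩
    · intro c ξ v
      refine ⟨D.cf c (ξ ∘ₗ D.ρ c u) v, fun x => ?_⟩
      rw [D.hcf, D.hcf, map_mul]; rfl
  have hK : ∀ i, ∀ a : D.A, ∃ b : D.A, ∀ x, D.ι b x = D.ι a (D.Kp i * x) := by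
    intro i
    refine base _ ?_
    rintro a a' ⟨b, hb⟩ ⟨b', hb'⟩
    exact ⟨b * b', fun x => by rw [D.hιmul, D.hιmul, map_mul, D.hΔK, m2_mulL hb hb']⟩
  have hK' : ∀ i, ∀ a : D.A, ∃ b : D.A, ∀ x, D.ι b x = D.ι a (D.Km i * x) := by
    intro i
    refine base _ ?_
    rintro a a' ⟨b, hb⟩ ⟨b', hb'⟩
    exact ⟨b * b', fun x => by rw [D.hιmul, D.hιmul, map_mul, hΔKm, m2_mulL hb hb']⟩
  refine gen_ind (P := fun u => ∀ a : D.A, ∃ b : D.A, ∀ x, D.ι b x = D.ι a (u * x))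
    ?_ ?_ ?_ ?_ ?_ hK hK' u
  · intro r a
    refine ⟨r • a, fun x => ?_⟩
    rw [← Algebra.smul_def, map_smul, map_smul]; rfl
  · intro u v hu hv a
    obtain ⟨b, hb⟩ := hu a
    obtain ⟨b', hb'⟩ := hv a
    exact ⟨b + b', fun x => by rw [add_mul, map_add, map_add, LinearMap.add_apply, hb, hb']⟩
  · intro u v hu hv a
    obtain ⟨b, hb⟩ := hu a
    obtain ⟨b', hb'⟩ := hv b
    exact ⟨b', fun x => by rw [hb', hb, mul_assoc]⟩
  · intro i
    refine base _ ?_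
    rintro a a' ⟨b, hb⟩ ⟨b', hb'⟩
    obtain ⟨b2, hb2⟩ := hK i a
    exact ⟨b * a' + b2 * b', fun x => by
      rw [map_add, LinearMap.add_apply, D.hιmul, D.hιmul, D.hιmul, map_mul, D.hΔE, add_mul,
        map_add, m2_mulL hb (g' := D.ι a') (by simp), m2_mulL hb2 hb']⟩
  · intro i
    refine base _ ?_
    rintro a a' ⟨b, hb⟩ ⟨b', hb'⟩
    obtain ⟨b2, hb2⟩ := hK' i a'
    exact ⟨b * b2 + a * b', fun x => by
      rw [map_add, LinearMap.add_apply, D.hιmul, D.hιmul, D.hιmul, map_mul, D.hΔF, add_mul,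
        map_add, m2_mulL hb hb2, m2_mulL (f' := D.ι a) (by simp) hb']⟩

/-- left action of `U` on `A`: `(u.a)(x) = a(xu)` -/
noncomputable def L (D : Oq) (u : D.U) : D.A →ₗ[ℂ] D.A where
  toFun a := (exists_L u a).choose
  map_add' a b := A_eq fun x => by
    rw [(exists_L u (a + b)).choose_spec, map_add, map_add, LinearMap.add_apply,
      LinearMap.add_apply, (exists_L u a).choose_spec, (exists_L u b).choose_spec]
  map_smul' c a := A_eq fun x => by
    rw [(exists_L u (c • a)).choose_spec, map_smul, map_smul, LinearMap.smul_apply,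
      RingHom.id_apply, LinearMap.smul_apply, (exists_L u a).choose_spec]

/-- right action of `U` on `A`: `(a.u)(x) = a(ux)` -/
noncomputable def R (D : Oq) (u : D.U) : D.A →ₗ[ℂ] D.A where
  toFun a := (exists_R u a).choose
  map_add' a b := A_eq fun x => by
    rw [(exists_R u (a + b)).choose_spec, map_add, map_add, LinearMap.add_apply,
      LinearMap.add_apply, (exists_R u a).choose_spec, (exists_R u b).choose_spec]
  map_smul' c a := A_eq fun x => by
    rw [(exists_R u (c • a)).choose_spec, map_smul, map_smul, LinearMap.smul_apply,
      RingHom.id_apply, LinearMap.smul_apply, (exists_R u a).choose_spec]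

theorem ιL (u : D.U) (a : D.A) (x : D.U) : D.ι (D.L u a) x = D.ι a (x * u) :=
  (exists_L u a).choose_spec x
theorem ιR (u : D.U) (a : D.A) (x : D.U) : D.ι (D.R u a) x = D.ι a (u * x) :=
  (exists_R u a).choose_spec x

theorem L_mul (u v : D.U) (a : D.A) : D.L (u * v) a = D.L u (D.L v a) :=
  A_eq fun x => by rw [ιL, ιL, ιL, mul_assoc]
theorem R_mul (u v : D.U) (a : D.A) : D.R (u * v) a = D.R v (D.R u a) :=
  A_eq fun x => by rw [ιR, ιR, ιR, mul_assoc]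
theorem L_add (u v : D.U) (a : D.A) : D.L (u + v) a = D.L u a + D.L v a :=
  A_eq fun x => by rw [map_add, LinearMap.add_apply, ιL, ιL, ιL, mul_add, map_add]
theorem R_add (u v : D.U) (a : D.A) : D.R (u + v) a = D.R u a + D.R v a :=
  A_eq fun x => by rw [map_add, LinearMap.add_apply, ιR, ιR, ιR, add_mul, map_add]
theorem L_smul (c : ℂ) (v : D.U) (a : D.A) : D.L (c • v) a = c • D.L v a :=
  A_eq fun x => by rw [map_smul, LinearMap.smul_apply, ιL, ιL, mul_smul_comm, map_smul]
theorem R_smul (c : ℂ) (v : D.U) (a : D.A) : D.R (c • v) a = c • D.R v a :=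
  A_eq fun x => by rw [map_smul, LinearMap.smul_apply, ιR, ιR, smul_mul_assoc, map_smul]
theorem L_one (a : D.A) : D.L 1 a = a := A_eq fun x => by rw [ιL, mul_one]
theorem R_one (a : D.A) : D.R 1 a = a := A_eq fun x => by rw [ιR, one_mul]
theorem LR (u v : D.U) (a : D.A) : D.L u (D.R v a) = D.R v (D.L u a) :=
  A_eq fun x => by rw [ιL, ιR, ιR, ιL, mul_assoc]
theorem L_cf (u : D.U) (c ξ v) : D.L u (D.cf c ξ v) = D.cf c ξ (D.ρ c u v) :=
  A_eq fun x => by rw [ιL, D.hcf, D.hcf, map_mul]; rfl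
theorem R_cf (u : D.U) (c ξ v) : D.R u (D.cf c ξ v) = D.cf c (ξ ∘ₗ D.ρ c u) v :=
  A_eq fun x => by rw [ιR, D.hcf, D.hcf, map_mul]; rfl
theorem L_unit (u : D.U) : D.L u 1 = D.ε u • (1 : D.A) :=
  A_eq fun x => by rw [ιL, map_smul, LinearMap.smul_apply, D.hι1, D.hι1, map_mul, mul_comm]; rfl
theorem R_unit (u : D.U) : D.R u 1 = D.ε u • (1 : D.A) :=
  A_eq fun x => by rw [ιR, map_smul, LinearMap.smul_apply, D.hι1, D.hι1, map_mul]; rfl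

theorem L_Kp_mul (i) (x y : D.A) : D.L (D.Kp i) (x * y) = D.L (D.Kp i) x * D.L (D.Kp i) y :=
  A_eq fun u => by rw [ιL, D.hιmul, D.hιmul, map_mul, D.hΔK, m2_mulR (ιL _ _) (ιL _ _)]
theorem L_Km_mul (i) (x y : D.A) : D.L (D.Km i) (x * y) = D.L (D.Km i) x * D.L (D.Km i) y :=
  A_eq fun u => by rw [ιL, D.hιmul, D.hιmul, map_mul, hΔKm, m2_mulR (ιL _ _) (ιL _ _)]
theorem R_Kp_mul (i) (x y : D.A) : D.R (D.Kp i) (x * y) = D.R (D.Kp i) x * D.R (D.Kp i) y :=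
  A_eq fun u => by rw [ιR, D.hιmul, D.hιmul, map_mul, D.hΔK, m2_mulL (ιR _ _) (ιR _ _)]
theorem R_Km_mul (i) (x y : D.A) : D.R (D.Km i) (x * y) = D.R (D.Km i) x * D.R (D.Km i) y :=
  A_eq fun u => by rw [ιR, D.hιmul, D.hιmul, map_mul, hΔKm, m2_mulL (ιR _ _) (ιR _ _)]
theorem L_E_mul (i) (x y : D.A) :
    D.L (D.E i) (x * y) = D.L (D.E i) x * y + D.L (D.Kp i) x * D.L (D.E i) y :=
  A_eq fun u => by
    rw [ιL, map_add, LinearMap.add_apply, D.hιmul, D.hιmul, D.hιmul, map_mul, D.hΔE, mul_add,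
      map_add, m2_mulR (ιL _ _) (ιL _ _), m2_mulR (ιL _ _) (ιL _ _), L_one]
theorem L_F_mul (i) (x y : D.A) :
    D.L (D.F i) (x * y) = D.L (D.F i) x * D.L (D.Km i) y + x * D.L (D.F i) y :=
  A_eq fun u => by
    rw [ιL, map_add, LinearMap.add_apply, D.hιmul, D.hιmul, D.hιmul, map_mul, D.hΔF, mul_add,
      map_add, m2_mulR (ιL _ _) (ιL _ _), m2_mulR (ιL _ _) (ιL _ _), L_one]
theorem R_E_mul (i) (x y : D.A) :
    D.R (D.E i) (x * y) = D.R (D.E i) x * y + D.R (D.Kp i) x * D.R (D.E i) y :=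
  A_eq fun u => by
    rw [ιR, map_add, LinearMap.add_apply, D.hιmul, D.hιmul, D.hιmul, map_mul, D.hΔE, add_mul,
      map_add, m2_mulL (ιR _ _) (ιR _ _), m2_mulL (ιR _ _) (ιR _ _), R_one]
theorem R_F_mul (i) (x y : D.A) :
    D.R (D.F i) (x * y) = D.R (D.F i) x * D.R (D.Km i) y + x * D.R (D.F i) y :=
  A_eq fun u => by
    rw [ιR, map_add, LinearMap.add_apply, D.hιmul, D.hιmul, D.hιmul, map_mul, D.hΔF, add_mul,
      map_add, m2_mulL (ιR _ _) (ιR _ _), m2_mulL (ιR _ _) (ιR _ _), R_one]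

theorem ι_one_mul (x y : D.A) : D.ι (x * y) 1 = D.ι x 1 * D.ι y 1 := by
  rw [D.hιmul, map_one, Algebra.TensorProduct.one_def, m2_tmul]

theorem Kp_inj (i) {x : D.A} (h : D.L (D.Kp i) x = 0) : x = 0 := by
  have := L_mul (D := D) (D.Km i) (D.Kp i) x
  rw [KmKp1, L_one, h, map_zero] at this; exact this

/-- `K_i` acting on `A` as algebra map -/
noncomputable def LK (D : Oq) (i : Fin D.n) : D.A →ₐ[ℂ] D.A :=
  AlgHom.ofLinearMap (D.L (D.Kp i)) (by rw [L_unit, D.hεK, one_smul]) (L_Kp_mul i)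
/-- `K_i` acting on `A` on the right as algebra map -/
noncomputable def RK (D : Oq) (i : Fin D.n) : D.A →ₐ[ℂ] D.A :=
  AlgHom.ofLinearMap (D.R (D.Kp i)) (by rw [R_unit, D.hεK, one_smul]) (R_Kp_mul i)
@[simp] theorem LK_apply (i) (x : D.A) : D.LK i x = D.L (D.Kp i) x := rfl
@[simp] theorem RK_apply (i) (x : D.A) : D.RK i x = D.R (D.Kp i) x := rfl

theorem qq_ne (i : Fin D.n) : (D.q ^ (D.d i : ℤ) - D.q ^ (-(D.d i : ℤ))) ≠ 0 := by
  rw [sub_ne_zero]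
  intro h
  have := D.hq.inj h
  have := D.hd i
  omega

/-- The action of the quantum group on `A`. -/
noncomputable def Q (D : Oq) : QAct D.q D.d D.a D.A where
  k := D.LK
  e i := D.L (D.E i)
  f i := D.L (D.F i * D.Kp i)
  cc i := (D.q ^ (D.d i : ℤ) - D.q ^ (-(D.d i : ℤ)))⁻¹
  cc_ne i := inv_ne_zero (qq_ne i)
  kk i j x := by rw [LK_apply, LK_apply, LK_apply, LK_apply, ← L_mul, KK, L_mul]
  ke i j x := by rw [LK_apply, LK_apply, ← L_mul, KE, L_smul, L_mul]
  kf i j x := by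
    rw [LK_apply, LK_apply, ← L_mul, ← mul_assoc, KF, smul_mul_assoc, L_smul, mul_assoc, KK,
      ← mul_assoc, L_mul]
  e_mul i x y := L_E_mul i x y
  f_mul i x y := by
    rw [L_mul, L_mul, L_Kp_mul, L_F_mul, ← L_mul (D.Km i), KmKp1, L_one, LK_apply, L_mul]
  ef i j x := by
    have e := EF (D := D) i j
    rw [sub_eq_iff_eq_add] at e
    rw [← L_mul, ← mul_assoc, e, add_mul, L_add, add_comm]
    congr 1
    · rw [mul_assoc, EK, mul_smul_comm, L_smul, ← L_mul, D.hsym j i, mul_assoc]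
    · split_ifs with h
      · subst h
        rw [smul_mul_assoc, L_smul, sub_mul, KmKp1, sub_eq_add_neg (D.Kp i * D.Kp i), L_add, L_mul,
          ← neg_one_smul ℂ (1 : D.U), L_smul, L_one, neg_one_smul, ← sub_eq_add_neg]
        rfl
      · rw [zero_mul, ← zero_smul ℂ (1 : D.U), L_smul, zero_smul]

@[simp] theorem Q_k (i) (x : D.A) : D.Q.k i x = D.L (D.Kp i) x := rfl
@[simp] theorem Q_e (i) (x : D.A) : D.Q.e i x = D.L (D.E i) x := rfl
@[simp] theorem Q_f (i) (x : D.A) : D.Q.f i x = D.L (D.F i * D.Kp i) x := rfl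

end Oq
end OQ


namespace OQ

open scoped TensorProduct

section generic
variable {n : ℕ} {q : ℂ} {d : Fin n → ℕ} {M : Type} [AddCommGroup M] [Module ℂ M]

theorem wt_basis [FiniteDimensional ℂ M] {k : Fin n → M →ₗ[ℂ] M}
    (h : WtSpan q d (fun i => k i)) :
    ∃ (κ : Type) (_ : Fintype κ) (b : Module.Basis κ ℂ M) (μ : κ → Fin n → ℤ),
      ∀ i, IsWt q d (fun i => k i) (μ i) (b i) := by
  have h1 : ⊤ ≤ Submodule.span ℂ {y : M | ∃ μ, IsWt q d (fun i => k i) μ y} := fun x _ => h x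
  let b := Module.Basis.ofSpan h1
  have h2 : ∀ i, b i ∈ {y : M | ∃ μ, IsWt q d (fun i => k i) μ y} := fun i =>
    Module.Basis.ofSpan_subset h1 ⟨i, rfl⟩
  choose μ hμ using h2
  exact ⟨_, FiniteDimensional.fintypeBasisIndex b, b, μ, hμ⟩

theorem coord_wt {k : Fin n → M →ₗ[ℂ] M} {κ : Type} (b : Module.Basis κ ℂ M) {μ : κ → Fin n → ℤ}
    (hb : ∀ i, IsWt q d (fun i => k i) (μ i) (b i)) (i : κ) (j : Fin n) (x : M) :
    b.coord i (k j x) = q ^ ((d j : ℤ) * μ i j) * b.coord i x := by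
  have : (b.coord i) ∘ₗ (k j) = (q ^ ((d j : ℤ) * μ i j)) • b.coord i := by
    apply b.ext
    intro l
    have h1 : k j (b l) = _ := hb l j
    rw [LinearMap.comp_apply, h1, map_smul, LinearMap.smul_apply, smul_eq_mul, smul_eq_mul,
      Module.Basis.coord_apply, Module.Basis.repr_self]
    by_cases hl : l = i
    · subst hl; rfl
    · simp [Finsupp.single_eq_of_ne (Ne.symm hl)]
  exact congrArg (fun f => f x) this

theorem wt_mem (hq : NotRU q) (hd : ∀ i, 0 < d i) {k : Fin n → M →ₗ[ℂ] M} {κ : Type}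
    (b : Module.Basis κ ℂ M) {μ : κ → Fin n → ℤ}
    (hb : ∀ i, IsWt q d (fun i => k i) (μ i) (b i)) {ν : Fin n → ℤ} {x : M}
    (hx : IsWt q d (fun i => k i) ν x) (h0 : x ≠ 0) : ∃ i, ν = μ i := by
  have : ∃ i, b.coord i x ≠ 0 := by
    by_contra hc
    push Not at hc
    exact h0 (b.ext_elem (fun i => by simpa using hc i))
  obtain ⟨i, hi⟩ := this
  refine ⟨i, funext fun j => ?_⟩
  have h1 := coord_wt b hb i j x
  have h2 : k j x = _ := hx j
  rw [h2, map_smul, smul_eq_mul] at h1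
  have h3 := hq.inj (mul_right_cancel₀ hi h1)
  have := hd j
  have h4 : (d j : ℤ) ≠ 0 := by omega
  exact mul_left_cancel₀ h4 h3

theorem nil_of_bdd {a : Fin n → Fin n → ℤ} (hR : RefBound a) (hq : NotRU q) (hd : ∀ i, 0 < d i)
    [FiniteDimensional ℂ M] {k : Fin n → M →ₗ[ℂ] M} (hw : WtSpan q d (fun i => k i))
    (e : Fin n → M →ₗ[ℂ] M) (t : ℤ) (ht : t = 1 ∨ t = -1)
    (he : ∀ i j x, k i (e j x) = q ^ (t * ((d i : ℤ) * a i j)) • e j (k i x)) :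
    ∃ m, ∀ x, x ∈ nilE e m := by
  obtain ⟨κ, _, b, μ, hb⟩ := wt_basis hw
  obtain ⟨h, C, hC, hr, -⟩ := hR
  let B : ℤ := ∑ i, |h (μ i)|
  have hB : ∀ ν x, IsWt q d (fun i => k i) ν x → x ≠ 0 → |h ν| ≤ B := by
    intro ν x hx h0
    obtain ⟨i, rfl⟩ := wt_mem hq hd b hb hx h0
    exact Finset.single_le_sum (f := fun i => |h (μ i)|) (fun i _ => abs_nonneg _) (Finset.mem_univ i)
  have key : ∀ m : ℕ, ∀ ν x, IsWt q d (fun i => k i) ν x → B < t * h ν + m * C → x ∈ nilE e m := by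
    intro m
    induction m with
    | zero =>
      intro ν x hx hlt
      rw [mem_nilE_zero]
      by_contra h0
      have h1 := abs_le.mp (hB ν x hx h0)
      rcases ht with rfl | rfl <;> simp at hlt <;> omega
    | succ m ih =>
      intro ν x hx hlt
      rw [mem_nilE_succ]
      intro j
      refine ih (ν + t • root a j) _ ?_ ?_
      · intro i
        have h1 : k i x = _ := hx i
        show k i (e j x) = _
        rw [he, h1, map_smul, smul_smul, ← zpow_add₀ hq.1]
        congr 2
        simp [root]; ring
      · rw [map_add, map_zsmul, hr, smul_eq_mul]
        have : t * t = 1 := by rcases ht with rfl | rfl <;> norm_num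
        push_cast at hlt
        nlinarith
  refine ⟨(2 * B + 1).toNat, fun x => ?_⟩
  rw [← b.sum_repr x]
  refine Submodule.sum_mem _ fun i _ => Submodule.smul_mem _ _ ?_
  by_cases h0 : b i = 0
  · rw [h0]; exact Submodule.zero_mem _
  · refine key _ _ _ (hb i) ?_
    have h1 := abs_le.mp (hB _ _ (hb i) h0)
    have h2 : 0 ≤ B := Finset.sum_nonneg fun i _ => abs_nonneg _
    rw [Int.toNat_of_nonneg (by omega)]
    rcases ht with rfl | rfl <;> nlinarith

theorem nilE_map {N : Type} [AddCommGroup N] [Module ℂ N] {e : Fin n → M →ₗ[ℂ] M}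
    {e' : Fin n → N →ₗ[ℂ] N} (φ : M →ₗ[ℂ] N) (h : ∀ j x, φ (e j x) = e' j (φ x)) (m : ℕ) :
    ∀ x ∈ nilE e m, φ x ∈ nilE e' m := by
  induction m with
  | zero => intro x hx; rw [mem_nilE_zero] at hx ⊢; rw [hx, map_zero]
  | succ m ih =>
    intro x hx
    rw [mem_nilE_succ] at hx ⊢
    intro j
    rw [← h]; exact ih _ (hx j)

theorem nilE_mulmem {A : Type} [Ring A] [Algebra ℂ A] (k e : Fin n → A →ₗ[ℂ] A)
    (c : Fin n → Fin n → ℂ) (hke : ∀ i j x, e j (k i x) = c i j • k i (e j x))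
    (hmul : ∀ i x y, e i (x * y) = e i x * y + k i x * e i y) (N : ℕ) :
    ∀ m m', m + m' = N → ∀ x ∈ nilE e m, ∀ y ∈ nilE e m', x * y ∈ nilE e N := by
  induction N with
  | zero =>
    intro m m' h x hx y hy
    obtain rfl : m = 0 := by omega
    rw [mem_nilE_zero] at hx
    rw [hx, zero_mul]; exact Submodule.zero_mem _
  | succ N ih =>
    intro m m' h x hx y hy
    rcases m with _ | m
    · rw [mem_nilE_zero] at hx
      rw [hx, zero_mul]; exact Submodule.zero_mem _
    rcases m' with _ | m'
    · rw [mem_nilE_zero] at hy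
      rw [hy, mul_zero]; exact Submodule.zero_mem _
    rw [mem_nilE_succ]
    intro j
    rw [hmul]
    refine Submodule.add_mem _ (ih m (m'+1) (by omega) _ (mem_nilE_succ.mp hx j) y hy) ?_
    exact ih (m+1) m' (by omega) _ (nilE_stable e (k j) (fun l => ⟨c j l, fun x => hke j l x⟩) _ x hx)
      _ (mem_nilE_succ.mp hy j)

end generic

/-- characters of the torus -/
noncomputable def chi {n : ℕ} (g : Fin n → ℂˣ) (μ : Fin n → ℤ) : ℂ := ((∏ i, g i ^ μ i : ℂˣ) : ℂ)

section
variable {n : ℕ} (g h : Fin n → ℂˣ) (μ ν : Fin n → ℤ)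
theorem chi_ne : chi g μ ≠ 0 := Units.ne_zero _
theorem chi_add : chi g (μ + ν) = chi g μ * chi g ν := by
  rw [chi, chi, chi, ← Units.val_mul, ← Finset.prod_mul_distrib]; simp [zpow_add]
theorem chi_zero : chi g 0 = 1 := by simp [chi]
theorem chi_neg_mul : chi g (-μ) * chi g μ = 1 := by
  rw [← chi_add, neg_add_cancel, chi_zero]
theorem chi_neg : chi g (-μ) = (chi g μ)⁻¹ := eq_inv_of_mul_eq_one_left (chi_neg_mul g μ)
theorem chi_mul : chi (g * h) μ = chi g μ * chi h μ := by
  rw [chi, chi, chi, ← Units.val_mul, ← Finset.prod_mul_distrib]; simp [mul_zpow]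
theorem chi_one : chi (1 : Fin n → ℂˣ) μ = 1 := by simp [chi]
theorem chi_inv : chi g⁻¹ μ = (chi g μ)⁻¹ := by
  refine eq_inv_of_mul_eq_one_left ?_
  rw [← chi_mul, inv_mul_cancel, chi_one]
end

namespace Oq
variable {D : Oq}

/-- dual weights -/
def DWt (D : Oq) (c : D.I) (μ : Fin D.n → ℤ) (ξ : Module.Dual ℂ (D.V c)) : Prop :=
  ∀ i x, ξ (D.ρ c (D.Kp i) x) = D.q ^ ((D.d i : ℤ) * μ i) * ξ x

theorem VWt.wt {c : D.I} {μ : Fin D.n → ℤ} {x : D.V c} (h : D.VWt c μ x) (i) :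
    D.ρ c (D.Kp i) x = D.q ^ ((D.d i : ℤ) * μ i) • x := h i

theorem VWt.E {c : D.I} {μ : Fin D.n → ℤ} {x : D.V c} (h : D.VWt c μ x) (j : Fin D.n) :
    D.VWt c (μ + root D.a j) (D.ρ c (D.E j) x) := by
  intro i
  show D.ρ c (D.Kp i) _ = _
  rw [← Module.End.mul_apply, ← map_mul, KE, map_smul, map_mul, LinearMap.smul_apply,
    Module.End.mul_apply, h.wt, map_smul, smul_smul, ← zpow_add₀ D.hq.1]
  congr 2; simp [root]; ring

theorem VWt.F {c : D.I} {μ : Fin D.n → ℤ} {x : D.V c} (h : D.VWt c μ x) (j : Fin D.n) :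
    D.VWt c (μ - root D.a j) (D.ρ c (D.F j) x) := by
  intro i
  show D.ρ c (D.Kp i) _ = _
  rw [← Module.End.mul_apply, ← map_mul, KF, map_smul, map_mul, LinearMap.smul_apply,
    Module.End.mul_apply, h.wt, map_smul, smul_smul, ← zpow_add₀ D.hq.1]
  congr 2; simp [root]; ring

theorem DWt.E {c : D.I} {μ : Fin D.n → ℤ} {ξ} (h : D.DWt c μ ξ) (j : Fin D.n) :
    D.DWt c (μ - root D.a j) (ξ ∘ₗ D.ρ c (D.E j)) := by
  intro i x
  rw [LinearMap.comp_apply, ← Module.End.mul_apply, ← map_mul, EK, map_smul, map_mul,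
    LinearMap.smul_apply, map_smul, Module.End.mul_apply, h, smul_eq_mul, ← mul_assoc,
    ← zpow_add₀ D.hq.1, LinearMap.comp_apply]
  congr 2; simp [root]; ring

theorem DWt.F {c : D.I} {μ : Fin D.n → ℤ} {ξ} (h : D.DWt c μ ξ) (j : Fin D.n) :
    D.DWt c (μ + root D.a j) (ξ ∘ₗ D.ρ c (D.F j)) := by
  intro i x
  rw [LinearMap.comp_apply, ← Module.End.mul_apply, ← map_mul, FK, map_smul, map_mul,
    LinearMap.smul_apply, map_smul, Module.End.mul_apply, h, smul_eq_mul, ← mul_assoc,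
    ← zpow_add₀ D.hq.1, LinearMap.comp_apply]
  congr 2; simp [root]; ring

theorem DWt.pair {c : D.I} {μ ν : Fin D.n → ℤ} {ξ x} (h : D.DWt c μ ξ) (h' : D.VWt c ν x)
    (hne : ν ≠ μ) : ξ x = 0 := by
  obtain ⟨i, hi⟩ := Function.ne_iff.mp hne
  have h1 := h i x
  rw [h'.wt, map_smul, smul_eq_mul] at h1
  by_contra h0
  have h3 := D.hq.inj (mul_right_cancel₀ h0 h1)
  have := D.hd i
  exact hi (mul_left_cancel₀ (by omega) h3)

theorem act_cf (g) {c : D.I} {μ η : Fin D.n → ℤ} {ξ v} (h : D.DWt c μ ξ) (h' : D.VWt c η v) :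
    D.act g (D.cf c ξ v) = (chi g.1 (-μ) * chi g.2 η) • D.cf c ξ v := by
  rw [D.hact g c ξ v μ η (fun ν hν x hx => h.pair hx hν) h']
  simp [chi]

/-- `cf` is linear in the vector -/
noncomputable def cfv (D : Oq) (c : D.I) (ξ : Module.Dual ℂ (D.V c)) : D.V c →ₗ[ℂ] D.A where
  toFun v := D.cf c ξ v
  map_add' v w := A_eq fun u => by simp [D.hcf]
  map_smul' r v := A_eq fun u => by simp [D.hcf]
/-- `cf` is linear in the covector -/
noncomputable def cfx (D : Oq) (c : D.I) (v : D.V c) : Module.Dual ℂ (D.V c) →ₗ[ℂ] D.A where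
  toFun ξ := D.cf c ξ v
  map_add' v w := A_eq fun u => by simp [D.hcf]
  map_smul' r v := A_eq fun u => by simp [D.hcf]

/-- transposed `K` -/
noncomputable def KT (D : Oq) (c : D.I) (u : D.U) :
    Module.Dual ℂ (D.V c) →ₗ[ℂ] Module.Dual ℂ (D.V c) := (D.ρ c u).dualMap

theorem KT_apply (c : D.I) (u : D.U) (ξ) : D.KT c u ξ = ξ ∘ₗ D.ρ c u := rfl

theorem dual_wt (c : D.I) : WtSpan D.q D.d (fun i => D.KT c (D.Kp i)) := by
  intro ξ
  obtain ⟨κ, _, b, μ, hb⟩ := wt_basis (k := fun j => D.ρ c (D.Kp j)) (D.hwt c)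
  have : ξ = ∑ i, ξ (b i) • b.coord i := by
    apply b.ext
    intro j
    classical
    simp [Finsupp.single_apply]
  rw [this]
  refine Submodule.sum_mem _ fun i _ => Submodule.smul_mem _ _ (Submodule.subset_span ⟨μ i, fun j => ?_⟩)
  ext x
  exact coord_wt (k := fun j => D.ρ c (D.Kp j)) b hb i j x

theorem A_ind {P : D.A → Prop} (h1 : ∀ r : ℂ, P (algebraMap ℂ D.A r))
    (hadd : ∀ u v, P u → P v → P (u + v)) (hmul : ∀ u v, P u → P v → P (u * v))
    (hcf : ∀ c ξ v μ η, D.DWt c μ ξ → D.VWt c η v → P (D.cf c ξ v)) (x : D.A) : P x := by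
  have hsm : ∀ (r : ℂ) y, P y → P (r • y) := fun r y hy => by
    rw [Algebra.smul_def]; exact hmul _ _ (h1 r) hy
  have h0 : P 0 := by have := h1 0; rwa [map_zero] at this
  refine A_ind0 h1 hadd hmul ?_ x
  intro c ξ v
  have s1 : ∀ η v, D.VWt c η v → P (D.cf c ξ v) := by
    intro η v hv
    refine Submodule.span_induction (p := fun ξ _ => P (D.cfx c v ξ)) ?_ ?_ ?_ ?_ (D.dual_wt c ξ)
    · rintro ξ ⟨μ, hμ⟩
      exact hcf c ξ v μ η (fun i x => congrArg (fun f => f x) (hμ i)) hv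
    · rw [map_zero]; exact h0
    · intro x y _ _ hx hy; rw [map_add]; exact hadd _ _ hx hy
    · intro r y _ hy; rw [map_smul]; exact hsm _ _ hy
  refine Submodule.span_induction (p := fun v _ => P (D.cfv c ξ v)) ?_ ?_ ?_ ?_ (D.hwt c v)
  · rintro v ⟨μ, hμ⟩; exact s1 μ v hμ
  · rw [map_zero]; exact h0
  · intro x y _ _ hx hy; rw [map_add]; exact hadd _ _ hx hy
  · intro r y _ hy; rw [map_smul]; exact hsm _ _ hy

theorem A_algext {B : Type} [Ring B] [Algebra ℂ B] (φ ψ : D.A →ₐ[ℂ] B)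
    (h : ∀ c ξ v μ η, D.DWt c μ ξ → D.VWt c η v → φ (D.cf c ξ v) = ψ (D.cf c ξ v)) (x : D.A) :
    φ x = ψ x := by
  refine A_ind (P := fun x => φ x = ψ x) ?_ ?_ ?_ h x
  · intro r; rw [AlgHom.commutes, AlgHom.commutes]
  · intro u v hu hv; rw [map_add, map_add, hu, hv]
  · intro u v hu hv; rw [map_mul, map_mul, hu, hv]

theorem act_act (g h) (x : D.A) : D.act g (D.act h x) = D.act (g * h) x := by
  refine A_algext ((D.act g).toAlgHom.comp (D.act h).toAlgHom) (D.act (g * h)).toAlgHom ?_ x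
  intro c ξ v μ η h1 h2
  show D.act g (D.act h (D.cf c ξ v)) = D.act (g * h) (D.cf c ξ v)
  rw [act_cf h h1 h2, map_smul, act_cf g h1 h2, act_cf (g * h) h1 h2, smul_smul, Prod.fst_mul,
    Prod.snd_mul, chi_mul, chi_mul]
  congr 1; ring

theorem act_one (x : D.A) : D.act 1 x = x := by
  refine A_algext (D.act 1).toAlgHom (AlgHom.id ℂ _) ?_ x
  intro c ξ v μ η h1 h2
  show D.act 1 (D.cf c ξ v) = D.cf c ξ v
  rw [act_cf _ h1 h2, Prod.fst_one, Prod.snd_one, chi_one, chi_one]; simp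

theorem act_comm (g h) (x : D.A) : D.act g (D.act h x) = D.act h (D.act g x) := by
  rw [act_act, act_act, mul_comm]

/-- the torus element giving `K_i` -/
noncomputable def gK (D : Oq) (i : Fin D.n) : Fin D.n → ℂˣ :=
  Pi.mulSingle i (Units.mk0 (D.q ^ (D.d i : ℤ)) (D.hq.zpow_ne _))

theorem chi_gK (i) (μ : Fin D.n → ℤ) : chi (D.gK i) μ = D.q ^ ((D.d i : ℤ) * μ i) := by
  rw [chi, Finset.prod_eq_single i]
  · rw [gK, Pi.mulSingle_eq_same, Units.val_zpow_eq_zpow_val, Units.val_mk0, zpow_mul]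
  · intro j _ hj; rw [gK, Pi.mulSingle_eq_of_ne hj, one_zpow]
  · simp

theorem LK_act (i) (x : D.A) : D.L (D.Kp i) x = D.act (1, D.gK i) x := by
  refine A_algext (D.LK i) (D.act (1, D.gK i)).toAlgHom ?_ x
  intro c ξ v μ η h1 h2
  show D.L (D.Kp i) (D.cf c ξ v) = D.act _ (D.cf c ξ v)
  rw [act_cf _ h1 h2, chi_one, chi_gK, one_mul, L_cf, h2.wt]
  exact (D.cfv c ξ).map_smul _ _

theorem RK_act (i) (x : D.A) : D.R (D.Kp i) x = D.act ((D.gK i)⁻¹, 1) x := by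
  refine A_algext (D.RK i) (D.act ((D.gK i)⁻¹, 1)).toAlgHom ?_ x
  intro c ξ v μ η h1 h2
  show D.R (D.Kp i) (D.cf c ξ v) = D.act _ (D.cf c ξ v)
  rw [act_cf _ h1 h2, chi_one, chi_inv, chi_neg, inv_inv, chi_gK, mul_one, R_cf]
  have : ξ ∘ₗ D.ρ c (D.Kp i) = D.q ^ ((D.d i : ℤ) * μ i) • ξ := by
    ext x; exact h1 i x
  rw [this]
  exact (D.cfx c v).map_smul _ _

theorem act_L_E (g) (j) (x : D.A) :
    D.act g (D.L (D.E j) x) = chi g.2 (root D.a j) • D.L (D.E j) (D.act g x) := by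
  refine A_ind (P := fun x => D.act g (D.L (D.E j) x) = chi g.2 (root D.a j) • D.L (D.E j) (D.act g x))
    ?_ ?_ ?_ ?_ x
  · intro r
    rw [AlgEquiv.commutes, Algebra.algebraMap_eq_smul_one, map_smul, L_unit, D.hεE]; simp
  · intro u v hu hv; simp only [map_add, hu, hv, smul_add]
  · intro u v hu hv
    rw [L_E_mul, map_add, map_mul, map_mul, hu, hv, map_mul, L_E_mul, LK_act, act_comm, ← LK_act,
      smul_add, smul_mul_assoc, mul_smul_comm]
  · intro c ξ v μ η h1 h2
    rw [L_cf, act_cf g h1 (h2.E j), act_cf g h1 h2, map_smul, L_cf, smul_smul, chi_add]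
    congr 1; ring

theorem act_L_F (g) (j) (x : D.A) :
    D.L (D.F j) (D.act g x) = chi g.2 (root D.a j) • D.act g (D.L (D.F j) x) := by
  have hm : ∀ y : D.A, D.L (D.Km j) (D.act g y) = D.act g (D.L (D.Km j) y) := by
    intro y
    have h1 := LK_act (D := D) j (D.act g (D.L (D.Km j) y))
    rw [act_comm, ← LK_act, ← L_mul (D.Kp j), KpKm1, L_one] at h1
    rw [← h1, ← L_mul, KmKp1, L_one]
  refine A_ind (P := fun x => D.L (D.F j) (D.act g x) = chi g.2 (root D.a j) • D.act g (D.L (D.F j) x))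
    ?_ ?_ ?_ ?_ x
  · intro r
    rw [AlgEquiv.commutes, Algebra.algebraMap_eq_smul_one, map_smul, L_unit, D.hεF]; simp
  · intro u v hu hv; simp only [map_add, hu, hv, smul_add]
  · intro u v hu hv
    rw [map_mul, L_F_mul, hu, hv, hm, L_F_mul, map_add, map_mul, map_mul, 
      smul_add, smul_mul_assoc, mul_smul_comm]
  · intro c ξ v μ η h1 h2
    rw [L_cf, act_cf g h1 (h2.F j), act_cf g h1 h2, map_smul, L_cf, smul_smul, sub_eq_add_neg,
      chi_add, chi_neg g.2 (root D.a j)]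
    congr 1
    have := chi_ne g.2 (root D.a j)
    field_simp

theorem act_R_E (g) (j) (x : D.A) :
    D.act g (D.R (D.E j) x) = chi g.1 (root D.a j) • D.R (D.E j) (D.act g x) := by
  refine A_ind (P := fun x => D.act g (D.R (D.E j) x) = chi g.1 (root D.a j) • D.R (D.E j) (D.act g x))
    ?_ ?_ ?_ ?_ x
  · intro r
    rw [AlgEquiv.commutes, Algebra.algebraMap_eq_smul_one, map_smul, R_unit, D.hεE]; simp
  · intro u v hu hv; simp only [map_add, hu, hv, smul_add]
  · intro u v hu hv
    rw [R_E_mul, map_add, map_mul, map_mul, hu, hv, map_mul, R_E_mul, RK_act, act_comm, ← RK_act,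
      smul_add, smul_mul_assoc, mul_smul_comm]
  · intro c ξ v μ η h1 h2
    rw [R_cf, act_cf g (h1.E j) h2, act_cf g h1 h2, map_smul, R_cf, smul_smul, neg_sub,
      sub_eq_add_neg, chi_add]
    congr 1; ring

/-- evaluation at `1` is preserved by the diagonal -/
theorem act_diag (g : Fin D.n → ℂˣ) (x : D.A) : D.ι (D.act (g, g) x) 1 = D.ι x 1 := by
  refine A_ind (P := fun x => D.ι (D.act (g, g) x) 1 = D.ι x 1) ?_ ?_ ?_ ?_ x
  · intro r; rw [AlgEquiv.commutes]
  · intro u v hu hv; rw [map_add, map_add, map_add, LinearMap.add_apply, LinearMap.add_apply, hu, hv]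
  · intro u v hu hv; rw [map_mul, ι_one_mul, ι_one_mul, hu, hv]
  · intro c ξ v μ η h1 h2
    rw [act_cf _ h1 h2, map_smul, LinearMap.smul_apply, D.hcf, map_one, Module.End.one_apply]
    by_cases h : η = μ
    · subst h
      rw [chi_neg_mul, one_smul]
    · rw [h1.pair h2 h, smul_zero]

theorem wtspan_mul {k : Fin D.n → D.A →ₐ[ℂ] D.A}
    (hcf : ∀ c ξ v, D.cf c ξ v ∈ Submodule.span ℂ {y : D.A | ∃ μ, IsWt D.q D.d (fun i => k i) μ y}) :
    WtSpan D.q D.d (fun i => k i) := by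
  intro x
  refine A_ind0 (P := fun x => x ∈ Submodule.span ℂ {y : D.A | ∃ μ, IsWt D.q D.d (fun i => k i) μ y})
    ?_ ?_ ?_ hcf x
  · intro r
    refine Submodule.subset_span ⟨0, fun i => ?_⟩
    simp
  · intro u v hu hv; exact Submodule.add_mem _ hu hv
  · intro u v hu hv
    have := Submodule.mul_mem_mul hu hv
    rw [Submodule.span_mul_span] at this
    refine Submodule.span_mono ?_ this
    rintro _ ⟨u, ⟨μ, hu⟩, v, ⟨ν, hv⟩, rfl⟩
    refine ⟨μ + ν, fun i => ?_⟩
    have h1 : k i u = _ := hu i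
    have h2 : k i v = _ := hv i
    show k i (u * v) = _
    rw [map_mul, h1, h2, smul_mul_smul_comm, ← zpow_add₀ D.hq.1, Pi.add_apply, mul_add]

theorem wtsL (D : Oq) : WtSpan D.q D.d (fun i => D.LK i) := by
  refine wtspan_mul ?_
  intro c ξ v
  refine Submodule.span_induction (p := fun v _ => D.cfv c ξ v ∈ Submodule.span ℂ {y : D.A | ∃ μ, IsWt D.q D.d (fun i => D.LK i) μ y})
     ?_ ?_ ?_ ?_ (D.hwt c v)
  · rintro v ⟨μ, hμ⟩
    refine Submodule.subset_span ⟨μ, fun i => ?_⟩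
    show D.L (D.Kp i) (D.cf c ξ v) = _
    rw [L_cf, VWt.wt hμ i]
    exact (D.cfv c ξ).map_smul _ _
  · rw [map_zero]; exact Submodule.zero_mem _
  · intro x y _ _ hx hy; rw [map_add]; exact Submodule.add_mem _ hx hy
  · intro r y _ hy; rw [map_smul]; exact Submodule.smul_mem _ _ hy

theorem wtsR (D : Oq) : WtSpan D.q D.d (fun i => D.RK i) := by
  refine wtspan_mul ?_
  intro c ξ v
  refine Submodule.span_induction (p := fun ξ _ => D.cfx c v ξ ∈ Submodule.span ℂ {y : D.A | ∃ μ, IsWt D.q D.d (fun i => D.RK i) μ y})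
     ?_ ?_ ?_ ?_ (D.dual_wt c ξ)
  · rintro ξ ⟨μ, hμ⟩
    refine Submodule.subset_span ⟨μ, fun i => ?_⟩
    show D.R (D.Kp i) (D.cf c ξ v) = _
    have h1 : D.KT c (D.Kp i) ξ = _ := hμ i
    rw [R_cf, ← KT_apply, h1]
    exact (D.cfx c v).map_smul _ _
  · rw [map_zero]; exact Submodule.zero_mem _
  · intro x y _ _ hx hy; rw [map_add]; exact Submodule.add_mem _ hx hy
  · intro r y _ hy; rw [map_smul]; exact Submodule.smul_mem _ _ hy

theorem nilA (k : Fin D.n → D.A →ₗ[ℂ] D.A) (e : Fin D.n → D.A →ₗ[ℂ] D.A)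
    (c : Fin D.n → Fin D.n → ℂ) (hke : ∀ i j x, e j (k i x) = c i j • k i (e j x))
    (hmul : ∀ i x y, e i (x * y) = e i x * y + k i x * e i y) (h1 : ∀ i, e i 1 = 0)
    (hcf : ∀ c ξ v, ∃ m, D.cf c ξ v ∈ nilE e m) (x : D.A) : ∃ m, x ∈ nilE e m := by
  refine A_ind0 (P := fun x => ∃ m, x ∈ nilE e m) ?_ ?_ ?_ hcf x
  · intro r
    refine ⟨1, ?_⟩
    rw [mem_nilE_succ]
    intro j
    rw [mem_nilE_zero, Algebra.algebraMap_eq_smul_one, map_smul, h1, smul_zero]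
  · rintro u v ⟨m, hm⟩ ⟨m', hm'⟩
    exact ⟨max m m', Submodule.add_mem _ (nilE_mono e (le_max_left _ _) hm)
      (nilE_mono e (le_max_right _ _) hm')⟩
  · rintro u v ⟨m, hm⟩ ⟨m', hm'⟩
    exact ⟨m + m', nilE_mulmem k e c hke hmul _ m m' rfl _ hm _ hm'⟩

theorem nilV_E (D : Oq) (c : D.I) : ∃ m, ∀ x, x ∈ nilE (fun j => D.ρ c (D.E j)) m :=
  nil_of_bdd D.hR D.hq D.hd (D.hwt c) _ 1 (Or.inl rfl) (fun i j x => by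
    show D.ρ c (D.Kp i) (D.ρ c (D.E j) x) = _
    rw [← Module.End.mul_apply, ← map_mul, KE, map_smul, map_mul, one_mul]; rfl)

theorem nilV_FK (D : Oq) (c : D.I) : ∃ m, ∀ x, x ∈ nilE (fun j => D.ρ c (D.F j * D.Kp j)) m :=
  nil_of_bdd D.hR D.hq D.hd (D.hwt c) _ (-1) (Or.inr rfl) (fun i j x => by
    show D.ρ c (D.Kp i) (D.ρ c (D.F j * D.Kp j) x) = _
    rw [← Module.End.mul_apply, ← map_mul, ← mul_assoc, KF, smul_mul_assoc, mul_assoc, KK,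
      ← mul_assoc, map_smul, map_mul, neg_one_mul]; rfl)

theorem nilVd_KF (D : Oq) (c : D.I) : ∃ m, ∀ x, x ∈ nilE (fun j => D.KT c (D.Kp j * D.F j)) m :=
  nil_of_bdd D.hR D.hq D.hd (D.dual_wt c) _ 1 (Or.inl rfl) (fun i j ξ => by
    ext x
    show ξ (D.ρ c (D.Kp j * D.F j) (D.ρ c (D.Kp i) x)) = _ * ξ (D.ρ c (D.Kp i) (D.ρ c (D.Kp j * D.F j) x))
    rw [← Module.End.mul_apply, ← map_mul, ← Module.End.mul_apply, ← map_mul, mul_assoc, FK,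
      mul_smul_comm, ← mul_assoc, KK, mul_assoc, map_smul, one_mul]
    simp)

theorem enil (D : Oq) (x : D.A) : ∃ m, x ∈ nilE (fun j => D.L (D.E j)) m := by
  refine nilA (fun i => D.L (D.Kp i)) _ (fun i j => D.q ^ (-((D.d i : ℤ) * D.a i j))) ?_ L_E_mul ?_ ?_ x
  · intro i j x
    rw [← L_mul, EK, L_smul, L_mul]
  · intro i; rw [L_unit, D.hεE, zero_smul]
  · intro c ξ v
    obtain ⟨m, hm⟩ := D.nilV_E c
    exact ⟨m, nilE_map (D.cfv c ξ) (fun j x => (L_cf _ _ _ _).symm) m v (hm v)⟩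

theorem fnil (D : Oq) (x : D.A) : ∃ m, x ∈ nilE (fun j => D.L (D.F j * D.Kp j)) m := by
  refine nilA (fun i => D.L (D.Kp i)) _ (fun i j => D.q ^ (((D.d i : ℤ) * D.a i j))) ?_ D.Q.f_mul ?_ ?_ x
  · intro i j x
    show D.L (D.F j * D.Kp j) (D.L (D.Kp i) x) = _ • D.L (D.Kp i) (D.L (D.F j * D.Kp j) x)
    rw [← L_mul, mul_assoc, KK, ← mul_assoc, FK, smul_mul_assoc, L_smul, mul_assoc, L_mul]
  · intro i
    show D.L (D.F i * D.Kp i) 1 = 0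
    rw [L_unit, map_mul, D.hεF, zero_mul, zero_smul]
  · intro c ξ v
    obtain ⟨m, hm⟩ := D.nilV_FK c
    exact ⟨m, nilE_map (D.cfv c ξ) (fun j x => (L_cf _ _ _ _).symm) m v (hm v)⟩

theorem R_KF_mul (i) (x y : D.A) : D.R (D.Kp i * D.F i) (x * y) =
    D.R (D.Kp i * D.F i) x * y + D.R (D.Kp i) x * D.R (D.Kp i * D.F i) y := by
  rw [R_mul, R_mul, R_mul, R_Kp_mul, R_F_mul, ← R_mul (D.Kp i) (D.Km i) y, KpKm1, R_one]

theorem R_KF_K (i j) (x : D.A) : D.R (D.Kp j * D.F j) (D.R (D.Kp i) x) =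
    D.q ^ (-((D.d i : ℤ) * D.a i j)) • D.R (D.Kp i) (D.R (D.Kp j * D.F j) x) := by
  rw [← R_mul, ← R_mul, mul_assoc, FK, mul_smul_comm, R_smul, smul_smul, ← zpow_add₀ D.hq.1,
    neg_add_cancel, zpow_zero, one_smul, ← mul_assoc, ← mul_assoc, KK]

theorem knil (D : Oq) (x : D.A) : ∃ m, x ∈ nilE (fun j => D.R (D.Kp j * D.F j)) m := by
  refine nilA (fun i => D.R (D.Kp i)) _ (fun i j => D.q ^ (-((D.d i : ℤ) * D.a i j))) R_KF_K R_KF_mul ?_ ?_ x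
  · intro i; rw [R_unit, map_mul, D.hεF, mul_zero, zero_smul]
  · intro c ξ v
    obtain ⟨m, hm⟩ := D.nilVd_KF c
    exact ⟨m, nilE_map (D.cfx c v) (fun j x => (R_cf _ _ _ _).symm) m ξ (hm ξ)⟩

end Oq
end OQ

open scoped TensorProduct
namespace OQ

/-- `(t;t)_m` -/
noncomputable def tf (t : ℂ) (m : ℕ) : ℂ := ∏ i ∈ Finset.range m, (1 - t ^ (i + 1))
theorem tf_succ (t : ℂ) (m : ℕ) : tf t (m + 1) = tf t m * (1 - t ^ (m + 1)) := Finset.prod_range_succ _ _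
theorem tf_ne {t : ℂ} (h : ∀ m : ℕ, t ^ (m + 1) ≠ 1) (m : ℕ) : tf t m ≠ 0 :=
  Finset.prod_ne_zero_iff.mpr fun i _ => sub_ne_zero.mpr (h i).symm

section
variable {A : Type} [Ring A] [Algebra ℂ A]

theorem tops (k e : A →ₗ[ℂ] A) (t : ℂ) (hke : ∀ x, k (e x) = t • e (k x))
    (hmul : ∀ x y, e (x * y) = e x * y + k x * e y) (N : ℕ) :
    ∀ m m', m + m' = N → ∀ (χ : ℂ) (a b : A), k a = χ • a → (e ^ (m + 1)) a = 0 →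
      (e ^ (m' + 1)) b = 0 →
      (tf t m * tf t m') • (e ^ N) (a * b) = (χ ^ m' * tf t N) • ((e ^ m) a * (e ^ m') b) := by
  induction N with
  | zero =>
    intro m m' h χ a b _ _ _
    obtain ⟨rfl, rfl⟩ : m = 0 ∧ m' = 0 := by omega
    simp [tf]
  | succ N ih =>
    intro m m' h χ a b hk ha hb
    have hk' : k (e a) = (t * χ) • e a := by rw [hke, hk, map_smul, smul_smul]
    have hexp : (e ^ (N + 1)) (a * b) = (e ^ N) (e a * b) + χ • (e ^ N) (a * e b) := by
      rw [pow_succ, Module.End.mul_apply, hmul, map_add, hk, smul_mul_assoc, map_smul]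
    rw [hexp]
    have p : ∀ l (x : A), (e ^ l) (e x) = (e ^ (l + 1)) x := fun l x => by
      rw [pow_succ, Module.End.mul_apply]
    rcases m with _ | m
    · obtain rfl : m' = N + 1 := by omega
      have h1 : e a = 0 := by simpa using ha
      have h2 := ih 0 N (by omega) χ a (e b) hk ha (by rw [p]; exact hb)
      rw [h1, zero_mul, map_zero, zero_add, tf_succ, p] at *
      rw [smul_smul, show tf t 0 * (tf t N * (1 - t ^ (N + 1))) * χ = (1 - t ^ (N+1)) * χ * (tf t 0 * tf t N) by ring,
        mul_smul _ (tf t 0 * tf t N), h2, smul_smul]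
      congr 1; ring
    · rcases m' with _ | m'
      · obtain rfl : m = N := by omega
        have h1 : e b = 0 := by simpa using hb
        have h2 := ih m 0 (by omega) (t * χ) (e a) b hk' (by rw [p]; exact ha) hb
        rw [h1, mul_zero, map_zero, smul_zero, add_zero, tf_succ, p] at *
        rw [show tf t m * (1 - t ^ (m + 1)) * tf t 0 = (1 - t ^ (m + 1)) * (tf t m * tf t 0) by ring,
          mul_smul, h2, smul_smul]
        congr 1; ring
      · have h1 := ih m (m' + 1) (by omega) (t * χ) (e a) b hk' (by rw [p]; exact ha) hb
        have h2 := ih (m + 1) m' (by omega) χ a (e b) hk ha (by rw [p]; exact hb)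
        rw [p] at h1 h2
        rw [smul_add, smul_smul, tf_succ t m, tf_succ t m']
        rw [show tf t m * (1 - t ^ (m + 1)) * (tf t m' * (1 - t ^ (m' + 1))) * χ =
          (χ * (1 - t ^ (m' + 1))) * (tf t (m + 1) * tf t m') by rw [tf_succ]; ring,
          show tf t m * (1 - t ^ (m + 1)) * (tf t m' * (1 - t ^ (m' + 1))) =
          (1 - t ^ (m + 1)) * (tf t m * tf t (m' + 1)) by rw [tf_succ]; ring, mul_smul, h1,
          mul_smul (χ * _), h2, smul_smul, smul_smul, ← add_smul]
        congr 1
        rw [tf_succ t N]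
        have : N = m + m' + 1 := by omega
        subst this
        ring

theorem dom_top {n : ℕ} (k e : Fin n → A →ₗ[ℂ] A) (c : Fin n → Fin n → ℂ)
    (hc : ∀ i (m : ℕ), c i i ^ (m + 1) ≠ 1) (hinj : ∀ i x, k i x = 0 → x = 0)
    (hke : ∀ i j x, k i (e j x) = c i j • e j (k i x))
    (hmul : ∀ i x y, e i (x * y) = e i x * y + k i x * e i y)
    (S S' : Submodule ℂ A) (hS : ∀ j, ∀ x ∈ S, e j x ∈ S) (hS' : ∀ j, ∀ x ∈ S', e j x ∈ S') (N : ℕ) :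
    ∀ m m', m + m' ≤ N → ∀ (χ χ' : Fin n → ℂ) (a b : A), (∀ i, k i a = χ i • a) → (∀ i, k i b = χ' i • b) →
      a ∈ S → b ∈ S' → a ∈ nilE e m → b ∈ nilE e m' → a ≠ 0 → b ≠ 0 → a * b = 0 →
      ∃ (χ χ' : Fin n → ℂ) (a b : A), (∀ i, k i a = χ i • a) ∧ (∀ i, k i b = χ' i • b) ∧
      a ∈ S ∧ b ∈ S' ∧ (∀ j, e j a = 0) ∧ (∀ j, e j b = 0) ∧ a ≠ 0 ∧ b ≠ 0 ∧ a * b = 0 := by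
  have hpw : ∀ (T : Submodule ℂ A), (∀ j, ∀ x ∈ T, e j x ∈ T) → ∀ j (l : ℕ), ∀ x ∈ T, (e j ^ l) x ∈ T := by
    intro T hT j l x hx
    induction l with
    | zero => simpa
    | succ l ih => rw [pow_succ', Module.End.mul_apply]; exact hT _ _ ih
  have hch : ∀ j (l : ℕ) x (χ : Fin n → ℂ), (∀ i, k i x = χ i • x) →
      ∀ i, k i ((e j ^ l) x) = (c i j ^ l * χ i) • (e j ^ l) x := by
    intro j l x χ h
    induction l with
    | zero => simpa using h
    | succ l ih => intro i; rw [pow_succ', Module.End.mul_apply, hke, ih, map_smul, smul_smul]; congr 1; ring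
  have hnil : ∀ j (p m : ℕ) x, x ∈ nilE e m → (e j ^ p) x ≠ 0 → ∃ m1, m = m1 + p ∧ (e j ^ p) x ∈ nilE e m1 := by
    intro j p m x hx h0
    have hp : p ≤ m := by
      by_contra hlt
      refine h0 (mem_nilE_zero.mp (nilE_epow e j 0 p _ (nilE_mono e (by omega) hx)))
    exact ⟨m - p, by omega, nilE_epow e j (m - p) p _ (by rwa [Nat.sub_add_cancel hp])⟩
  induction N with
  | zero =>
    intro m m' h χ χ' a b _ _ _ _ ha _ h0
    obtain rfl : m = 0 := by omega
    exact absurd (mem_nilE_zero.mp ha) h0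
  | succ N ih =>
    intro m m' h χ χ' a b hχ hχ' haS hbS ha hb h0 h0' hab
    by_cases hall : (∀ j, e j a = 0) ∧ (∀ j, e j b = 0)
    · exact ⟨χ, χ', a, b, hχ, hχ', haS, hbS, hall.1, hall.2, h0, h0', hab⟩
    · have hj : ∃ j, ¬ (e j a = 0 ∧ e j b = 0) := by
        by_contra hcon
        push Not at hcon
        exact hall ⟨fun j => (hcon j).1, fun j => (hcon j).2⟩
      obtain ⟨j, hj⟩ := hj
      have hz : ∀ m x, x ∈ nilE e m → (e j ^ m) x = 0 := fun m x hx =>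
        mem_nilE_zero.mp (nilE_epow e j 0 m _ (by rwa [zero_add]))
      obtain ⟨p, hp, hp1⟩ := last_pow (e j) h0 (hz m a ha)
      obtain ⟨p', hp', hp1'⟩ := last_pow (e j) h0' (hz m' b hb)
      obtain ⟨m1, rfl, hm1⟩ := hnil j p m a ha hp
      obtain ⟨m1', rfl, hm1'⟩ := hnil j p' m' b hb hp'
      have hpos : 0 < p + p' := by
        by_contra hcon
        obtain ⟨rfl, rfl⟩ : p = 0 ∧ p' = 0 := by omega
        simp only [zero_add, pow_one] at hp1 hp1'
        exact hj ⟨hp1, hp1'⟩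
      have ht := tops (k j) (e j) (c j j) (hke j j) (hmul j) (p + p') p p' rfl (χ j) a b (hχ j) hp1 hp1'
      rw [hab, map_zero, smul_zero] at ht
      have hχj : χ j ≠ 0 := fun hz => h0 (hinj j a (by rw [hχ, hz, zero_smul]))
      have hprod : (e j ^ p) a * (e j ^ p') b = 0 := by
        refine (smul_eq_zero.mp ht.symm).resolve_left (mul_ne_zero (pow_ne_zero _ hχj) (tf_ne (hc j) _))
      exact ih m1 m1' (by omega) _ _ _ _ (hch j p a χ hχ) (hch j p' b χ' hχ') (hpw S hS j p a haS)
        (hpw S' hS' j p' b hbS) hm1 hm1' hp hp' hprod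

theorem dom_wt {n : ℕ} {q : ℂ} (hq : NotRU q) {d : Fin n → ℕ} (hd : ∀ i, 0 < d i)
    (k : Fin n → A →ₐ[ℂ] A) (hw : WtSpan q d (fun i => k i))
    (S S' : Submodule ℂ A) (hS : ∀ j, ∀ x ∈ S, k j x ∈ S) (hS' : ∀ j, ∀ x ∈ S', k j x ∈ S')
    (a b : A) (haS : a ∈ S) (hbS : b ∈ S') (h0 : a ≠ 0) (h0' : b ≠ 0) (hab : a * b = 0) :
    ∃ (χ χ' : Fin n → ℂ) (a b : A), (∀ i, k i a = χ i • a) ∧ (∀ i, k i b = χ' i • b) ∧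
      a ∈ S ∧ b ∈ S' ∧ a ≠ 0 ∧ b ≠ 0 ∧ a * b = 0 := by
  classical
  have dec : ∀ (T : Submodule ℂ A), (∀ j, ∀ x ∈ T, k j x ∈ T) → ∀ x ∈ T, x ≠ 0 →
      ∃ (s : Finset (Fin n → ℤ)) (w : (Fin n → ℤ) → A), s.Nonempty ∧
      (∀ μ, IsWt q d (fun i => k i) μ (w μ)) ∧ (∀ μ ∈ s, w μ ≠ 0) ∧ (∀ μ ∈ s, w μ ∈ T) ∧ x = ∑ μ ∈ s, w μ := by
    intro T hT x hx hx0
    obtain ⟨s, w, h1, h2, h3⟩ := WtSpan.exists_sum (k := fun i => (k i).toLinearMap) hw x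
    have h4 : x = ∑ μ ∈ s.filter (fun μ => w μ ≠ 0), w μ := by
      rw [Finset.sum_filter_ne_zero]; exact h3
    refine ⟨s.filter (fun μ => w μ ≠ 0), w, ?_, h1, fun μ hμ => (Finset.mem_filter.mp hμ).2, ?_, h4⟩
    · by_contra hne
      rw [Finset.not_nonempty_iff_eq_empty] at hne
      rw [hne, Finset.sum_empty] at h4
      exact hx0 h4
    · intro μ hμ
      exact comp_mem hq hd (fun i => (k i).toLinearMap) T hT s w (fun μ _ => h1 μ) (h3 ▸ hx) μ
        (Finset.mem_filter.mp hμ).1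
  obtain ⟨s, w, hs, hw1, hw2, hw3, rfl⟩ := dec S hS a haS h0
  obtain ⟨s', w', hs', hw1', hw2', hw3', rfl⟩ := dec S' hS' b hbS h0'
  obtain ⟨μ0, hμ0, ν0, hν0, huniq⟩ := UniqueSums.uniqueAdd_of_nonempty hs hs'
  refine ⟨_, _, w μ0, w' ν0, hw1 μ0, hw1' ν0, hw3 _ hμ0, hw3' _ hν0, hw2 _ hμ0, hw2' _ hν0, ?_⟩
  let W : (Fin n → ℤ) → A := fun τ => ∑ p ∈ (s ×ˢ s').filter (fun p => p.1 + p.2 = τ), w p.1 * w' p.2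
  have hW : ∀ τ, IsWt q d (fun i => (k i).toLinearMap) τ (W τ) := by
    intro τ i
    show k i (∑ p ∈ _, _) = _ • ∑ p ∈ _, _
    rw [map_sum, Finset.smul_sum]
    refine Finset.sum_congr rfl fun p hp => ?_
    have h1 : k i (w p.1) = _ := hw1 p.1 i
    have h2 : k i (w' p.2) = _ := hw1' p.2 i
    rw [map_mul, h1, h2, smul_mul_smul_comm, ← zpow_add₀ hq.1, ← mul_add, ← Pi.add_apply,
      (Finset.mem_filter.mp hp).2]
  have hsum : ∑ τ ∈ (s ×ˢ s').image (fun p => p.1 + p.2), W τ = 0 := by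
    rw [← hab, Finset.sum_mul_sum, ← Finset.sum_product']
    exact Finset.sum_fiberwise_of_maps_to (fun p hp => Finset.mem_image_of_mem _ hp) _
  have h3 := comp_mem hq hd (fun i => (k i).toLinearMap) ⊥ (by simp) _ W (fun τ _ => hW τ)
    (by rw [hsum]; exact Submodule.zero_mem _) (μ0 + ν0)
    (Finset.mem_image.mpr ⟨(μ0, ν0), Finset.mem_product.mpr ⟨hμ0, hν0⟩, rfl⟩)
  have h4 : W (μ0 + ν0) = w μ0 * w' ν0 := by
    show ∑ p ∈ _, _ = _
    rw [Finset.sum_eq_single_of_mem (μ0, ν0)]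
    · simp [hμ0, hν0]
    · intro p hp hne
      exfalso
      rw [Finset.mem_filter, Finset.mem_product] at hp
      obtain ⟨h5, h6⟩ := huniq hp.1.1 hp.1.2 hp.2
      exact hne (Prod.ext h5 h6)
  rw [← h4]
  exact h3

theorem dom_step {n : ℕ} {q : ℂ} (hq : NotRU q) {d : Fin n → ℕ} (hd : ∀ i, 0 < d i)
    (k : Fin n → A →ₐ[ℂ] A) (hw : WtSpan q d (fun i => k i)) (e : Fin n → A →ₗ[ℂ] A) (c : Fin n → Fin n → ℂ)
    (hc : ∀ i (m : ℕ), c i i ^ (m + 1) ≠ 1) (hinj : ∀ i x, k i x = 0 → x = 0)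
    (hke : ∀ i j x, k i (e j x) = c i j • e j (k i x))
    (hmul : ∀ i x y, e i (x * y) = e i x * y + k i x * e i y) (hnil : ∀ x, ∃ m, x ∈ nilE e m)
    (S S' : Submodule ℂ A) (hS : ∀ j, ∀ x ∈ S, k j x ∈ S) (hS' : ∀ j, ∀ x ∈ S', k j x ∈ S')
    (heS : ∀ j, ∀ x ∈ S, e j x ∈ S) (heS' : ∀ j, ∀ x ∈ S', e j x ∈ S')
    (a b : A) (haS : a ∈ S) (hbS : b ∈ S') (h0 : a ≠ 0) (h0' : b ≠ 0) (hab : a * b = 0) :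
    ∃ (χ χ' : Fin n → ℂ) (a b : A), (∀ i, k i a = χ i • a) ∧ (∀ i, k i b = χ' i • b) ∧
      a ∈ S ∧ b ∈ S' ∧ (∀ j, e j a = 0) ∧ (∀ j, e j b = 0) ∧ a ≠ 0 ∧ b ≠ 0 ∧ a * b = 0 := by
  obtain ⟨χ, χ', a, b, h1, h2, h3, h4, h5, h6, h7⟩ :=
    dom_wt hq hd k hw S S' hS hS' a b haS hbS h0 h0' hab
  obtain ⟨m, hm⟩ := hnil a
  obtain ⟨m', hm'⟩ := hnil b
  exact dom_top (fun i => (k i).toLinearMap) e c hc hinj hke hmul S S' heS heS' (m + m') m m' le_rfl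
    χ χ' a b h1 h2 h3 h4 hm hm' h5 h6 h7

end

namespace Oq
variable {D : Oq}

/-- common kernel-eigenspace -/
def eigL (D : Oq) (χ : Fin D.n → ℂ) : Submodule ℂ D.A where
  carrier := {x | (∀ i, D.L (D.Kp i) x = χ i • x) ∧ ∀ i, D.L (D.E i) x = 0}
  add_mem' := by
    rintro x y ⟨h1, h2⟩ ⟨h3, h4⟩
    exact ⟨fun i => by rw [map_add, h1, h3, smul_add], fun i => by rw [map_add, h2, h4, add_zero]⟩
  zero_mem' := ⟨fun i => by simp, fun i => by simp⟩
  smul_mem' := by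
    rintro r x ⟨h1, h2⟩
    exact ⟨fun i => by rw [map_smul, h1, smul_comm], fun i => by rw [map_smul, h2, smul_zero]⟩

theorem eigL_R (χ : Fin D.n → ℂ) (u : D.U) {x : D.A} (hx : x ∈ D.eigL χ) : D.R u x ∈ D.eigL χ :=
  ⟨fun i => by rw [LR, hx.1 i, map_smul], fun i => by rw [LR, hx.2 i, map_zero]⟩

/-- an element which is highest on one side and killed on the other by `F` is nonzero at `1` -/
theorem ι_one_ne {b : D.A} (χ : Fin D.n → ℂ) (hb : b ∈ D.eigL χ) (hF : ∀ i, D.R (D.F i) b = 0)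
    (h1 : D.ι b 1 = 0) : b = 0 := by
  have hKm : ∀ i, D.L (D.Km i) b = (χ i)⁻¹ • b := by
    intro i
    have h2 := congrArg (D.L (D.Km i)) (hb.1 i)
    rw [← L_mul, KmKp1, L_one, map_smul] at h2
    by_cases hz : χ i = 0
    · rw [hz, zero_smul] at h2; rw [h2]; simp
    · rw [eq_inv_smul_iff₀ hz]; exact h2.symm
  let M0 : Submodule ℂ D.U :=
    { carrier := {z | ∃ c : ℂ, D.L z b = c • b}
      add_mem' := by rintro x y ⟨c, hc⟩ ⟨c', hc'⟩; exact ⟨c + c', by rw [L_add, hc, hc', add_smul]⟩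
      zero_mem' := ⟨0, by simpa using L_smul (D := D) 0 0 b⟩
      smul_mem' := by rintro r x ⟨c, hc⟩; exact ⟨r * c, by rw [L_smul, hc, smul_smul]⟩ }
  have hst := wspanF_stable (D := D) (Algebra.lmul ℂ D.U) M0
    (by rintro i x ⟨c, hc⟩
        exact ⟨0, by show D.L (D.E i * x) b = _; rw [L_mul, hc, map_smul, hb.2, smul_zero, zero_smul]⟩)
    (by rintro i x ⟨c, hc⟩
        exact ⟨c * χ i, by show D.L (D.Kp i * x) b = _; rw [L_mul, hc, map_smul, hb.1, smul_smul]⟩)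
    (by rintro i x ⟨c, hc⟩
        exact ⟨c * (χ i)⁻¹, by show D.L (D.Km i * x) b = _; rw [L_mul, hc, map_smul, hKm, smul_smul]⟩)
  have hone : (1 : D.U) ∈ wspan (fun j => Algebra.lmul ℂ D.U (D.F j)) M0 :=
    le_wspan _ _ ⟨1, by rw [L_one, one_smul]⟩
  have hle : wspan (fun j => Algebra.lmul ℂ D.U (D.F j)) M0 ≤ LinearMap.ker (D.ι b) := by
    refine wspan_le ?_ ?_
    · rintro z ⟨c, hc⟩
      rw [LinearMap.mem_ker]
      have := ιL z b 1
      rw [one_mul, hc, map_smul, LinearMap.smul_apply, h1, smul_zero] at this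
      exact this.symm
    · intro j x hx
      rw [LinearMap.mem_ker]
      show D.ι b (D.F j * x) = 0
      rw [← ιR, hF, map_zero, LinearMap.zero_apply]
  refine A_eq fun u => ?_
  have h3 := hle (hst u 1 hone)
  rw [LinearMap.mem_ker] at h3
  rw [map_zero, LinearMap.zero_apply, ← h3]
  show _ = D.ι b (u * 1)
  rw [mul_one]

theorem pow_ne_aux (D : Oq) (i : Fin D.n) (m : ℕ) : (D.q ^ ((D.d i : ℤ) * D.a i i)) ^ (m + 1) ≠ 1 := by
  rw [← zpow_natCast, ← zpow_mul]
  refine D.hq.ne_one ?_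
  have := D.hd i
  rw [D.ha]
  positivity

theorem dom (D : Oq) (x y : D.A) (hxy : x * y = 0) : x = 0 ∨ y = 0 := by
  by_contra hcon
  push Not at hcon
  obtain ⟨hx, hy⟩ := hcon
  obtain ⟨χ, χ', a, b, h1, h2, -, -, h3, h4, h5, h6, h7⟩ :=
    dom_step D.hq D.hd D.LK D.wtsL (fun j => D.L (D.E j)) (fun i j => D.q ^ ((D.d i : ℤ) * D.a i j))
      (fun i m => D.pow_ne_aux i m) (fun i x h => Kp_inj i h)
      (fun i j x => by rw [LK_apply, LK_apply, ← L_mul, KE, L_smul, L_mul]) L_E_mul D.enil ⊤ ⊤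
      (fun _ _ _ => trivial) (fun _ _ _ => trivial) (fun _ _ _ => trivial) (fun _ _ _ => trivial)
      x y trivial trivial hx hy hxy
  obtain ⟨φ, φ', a', b', f1, f2, g1, g2, g3, g4, g5, g6, g7⟩ :=
    dom_step D.hq D.hd D.RK D.wtsR (fun j => D.R (D.Kp j * D.F j)) (fun i j => D.q ^ ((D.d i : ℤ) * D.a i j))
      (fun i m => D.pow_ne_aux i m) (fun i x h => by
        have h9 := R_mul (D := D) (D.Kp i) (D.Km i) x
        rw [KpKm1, R_one] at h9
        rw [RK_apply] at h
        rw [h9, h, map_zero])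
      (fun i j x => by
        rw [RK_apply, RK_apply, R_KF_K, smul_smul, ← zpow_add₀ D.hq.1, add_neg_cancel, zpow_zero, one_smul])
      R_KF_mul D.knil (D.eigL χ) (D.eigL χ')
      (fun j x hx => eigL_R _ _ hx) (fun j x hx => eigL_R _ _ hx)
      (fun j x hx => eigL_R _ _ hx) (fun j x hx => eigL_R _ _ hx)
      a b ⟨h1, h3⟩ ⟨h2, h4⟩ h5 h6 h7
  have hR : ∀ (z : D.A) (φ : Fin D.n → ℂ), z ≠ 0 → (∀ j, D.RK j z = φ j • z) →
      (∀ j, D.R (D.Kp j * D.F j) z = 0) → ∀ j, D.R (D.F j) z = 0 := by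
    intro z φ hz h1 h2 j
    have h3 := h2 j
    have h4 := h1 j
    rw [RK_apply] at h4
    rw [R_mul, h4, map_smul, smul_eq_zero] at h3
    refine h3.resolve_left fun h5 => hz ?_
    rw [h5, zero_smul] at h4
    have h9 := R_mul (D := D) (D.Kp j) (D.Km j) z
    rwa [KpKm1, R_one, h4, map_zero] at h9
  have e1 : D.ι a' 1 ≠ 0 := fun h => g5 (ι_one_ne χ g1 (hR a' φ g5 f1 g3) h)
  have e2 : D.ι b' 1 ≠ 0 := fun h => g6 (ι_one_ne χ' g2 (hR b' φ' g6 f2 g4) h)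
  have e3 := ι_one_mul a' b'
  rw [g7, map_zero, LinearMap.zero_apply] at e3
  exact mul_ne_zero e1 e2 e3.symm

end Oq
end OQ

open scoped TensorProduct
namespace OQ
namespace Oq
variable {D : Oq} {M : Type} [AddCommGroup M] [Module ℂ M]

theorem wspanE_stable (ρ : D.U →ₐ[ℂ] Module.End ℂ M) (M0 : Submodule ℂ M)
    (hF : ∀ i, ∀ x ∈ M0, ρ (D.F i) x ∈ M0)
    (hK : ∀ i, ∀ x ∈ M0, ρ (D.Kp i) x ∈ M0) (hK' : ∀ i, ∀ x ∈ M0, ρ (D.Km i) x ∈ M0) :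
    ∀ u, ∀ x ∈ wspan (fun j => ρ (D.E j)) M0, ρ u x ∈ wspan (fun j => ρ (D.E j)) M0 :=
  wspanF_stable (D := D.op) ρ M0 hF hK' hK

/-- simplicity of a representation -/
def Simp (D : Oq) (ρ : D.U →ₐ[ℂ] Module.End ℂ M) : Prop :=
  ∀ N : Submodule ℂ M, (∀ (u : D.U), ∀ v ∈ N, ρ u v ∈ N) → N = ⊥ ∨ N = ⊤

/-- weight vectors of a representation -/
def RWt (D : Oq) (ρ : D.U →ₐ[ℂ] Module.End ℂ M) (μ : Fin D.n → ℤ) (x : M) : Prop :=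
  ∀ i, ρ (D.Kp i) x = D.q ^ ((D.d i : ℤ) * μ i) • x

theorem RWt.inv {ρ : D.U →ₐ[ℂ] Module.End ℂ M} {μ : Fin D.n → ℤ} {x : M} (h : D.RWt ρ μ x) (i) :
    ρ (D.Km i) x = D.q ^ (-((D.d i : ℤ) * μ i)) • x := by
  have h2 := congrArg (ρ (D.Km i)) (h i)
  rw [← Module.End.mul_apply, ← map_mul, KmKp1, map_one, Module.End.one_apply, map_smul] at h2
  conv_rhs => rw [h2]
  rw [smul_smul, ← zpow_add₀ D.hq.1, neg_add_cancel, zpow_zero, one_smul]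

theorem genF {ρ : D.U →ₐ[ℂ] Module.End ℂ M} (hs : D.Simp ρ) {μ : Fin D.n → ℤ} {x : M}
    (h : D.RWt ρ μ x) (h0 : x ≠ 0) (hE : ∀ i, ρ (D.E i) x = 0) :
    wspan (fun j => ρ (D.F j)) (Submodule.span ℂ {x}) = ⊤ := by
  refine (hs _ (wspanF_stable ρ _ ?_ ?_ ?_)).resolve_left ?_
  · intro i y hy
    obtain ⟨c, rfl⟩ := Submodule.mem_span_singleton.mp hy
    rw [map_smul, hE, smul_zero]; exact Submodule.zero_mem _
  · intro i y hy
    obtain ⟨c, rfl⟩ := Submodule.mem_span_singleton.mp hy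
    rw [map_smul, h i]
    exact Submodule.smul_mem _ _ (Submodule.smul_mem _ _ (Submodule.mem_span_singleton_self _))
  · intro i y hy
    obtain ⟨c, rfl⟩ := Submodule.mem_span_singleton.mp hy
    rw [map_smul, h.inv i]
    exact Submodule.smul_mem _ _ (Submodule.smul_mem _ _ (Submodule.mem_span_singleton_self _))
  · intro hb
    have := le_wspan (fun j => ρ (D.F j)) _ (Submodule.mem_span_singleton_self (R := ℂ) x)
    rw [hb] at this
    exact h0 this

/-- a functional killing `F M` and a highest weight vector is zero -/
theorem killF {ρ : D.U →ₐ[ℂ] Module.End ℂ M} (hs : D.Simp ρ) {μ : Fin D.n → ℤ} {x : M}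
    (h : D.RWt ρ μ x) (h0 : x ≠ 0) (hE : ∀ i, ρ (D.E i) x = 0) (ξ : M →ₗ[ℂ] ℂ)
    (hξ : ∀ i y, ξ (ρ (D.F i) y) = 0) (hx : ξ x = 0) (y : M) : ξ y = 0 := by
  have h1 : wspan (fun j => ρ (D.F j)) (Submodule.span ℂ {x}) ≤ LinearMap.ker ξ :=
    wspan_le (by rw [Submodule.span_singleton_le_iff_mem]; exact hx) (fun j y _ => hξ j y)
  rw [genF hs h h0 hE] at h1
  exact h1 trivial

/-- two simple modules with the same highest weight -/
theorem iso {M' : Type} [AddCommGroup M'] [Module ℂ M']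
    {ρ : D.U →ₐ[ℂ] Module.End ℂ M} {ρ' : D.U →ₐ[ℂ] Module.End ℂ M'} (hs : D.Simp ρ) (hs' : D.Simp ρ')
    {μ : Fin D.n → ℤ} {x : M} {x' : M'} (h : D.RWt ρ μ x) (h' : D.RWt ρ' μ x')
    (h0 : x ≠ 0) (h0' : x' ≠ 0) (hE : ∀ i, ρ (D.E i) x = 0) (hE' : ∀ i, ρ' (D.E i) x' = 0)
    (ξ : M →ₗ[ℂ] ℂ) (hξ : ∀ i y, ξ (ρ (D.F i) y) = 0) (hx : ξ x ≠ 0)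
    (ξ' : M' →ₗ[ℂ] ℂ) (hξ' : ∀ i y, ξ' (ρ' (D.F i) y) = 0) (hx' : ξ' x' ≠ 0) :
    ∃ φ : M →ₗ[ℂ] M', (∀ u y, φ (ρ u y) = ρ' u (φ y)) ∧ Function.Bijective φ := by
  let τ : D.U →ₐ[ℂ] Module.End ℂ (M × M') := AlgHom.ofLinearMap
    { toFun := fun u => LinearMap.prodMap (ρ u) (ρ' u)
      map_add' := fun u v => by ext <;> simp
      map_smul' := fun u v => by ext <;> simp }
    (by ext <;> simp) (fun u v => by ext <;> simp)
  have hτ : ∀ u p, τ u p = (ρ u p.1, ρ' u p.2) := fun _ _ => rfl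
  let N := wspan (fun j => τ (D.F j)) (Submodule.span ℂ {(x, x')})
  have hN : ∀ u, ∀ y ∈ N, τ u y ∈ N := by
    refine wspanF_stable τ _ ?_ ?_ ?_
    · intro i y hy
      obtain ⟨c, rfl⟩ := Submodule.mem_span_singleton.mp hy
      rw [map_smul, hτ, hE, hE', Prod.mk_zero_zero, smul_zero]; exact Submodule.zero_mem _
    · intro i y hy
      obtain ⟨c, rfl⟩ := Submodule.mem_span_singleton.mp hy
      rw [map_smul, hτ, h i, h' i, ← Prod.smul_mk]
      exact Submodule.smul_mem _ _ (Submodule.smul_mem _ _ (Submodule.mem_span_singleton_self _))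
    · intro i y hy
      obtain ⟨c, rfl⟩ := Submodule.mem_span_singleton.mp hy
      rw [map_smul, hτ, h.inv i, h'.inv i, ← Prod.smul_mk]
      exact Submodule.smul_mem _ _ (Submodule.smul_mem _ _ (Submodule.mem_span_singleton_self _))
  have hxN : (x, x') ∈ N := le_wspan _ _ (Submodule.mem_span_singleton_self _)
  -- functional
  have hfun : ∀ p ∈ N, ξ' x' * ξ p.1 = ξ x * ξ' p.2 := by
    let Z : M × M' →ₗ[ℂ] ℂ := (ξ' x') • (ξ ∘ₗ LinearMap.fst ℂ M M') - (ξ x) • (ξ' ∘ₗ LinearMap.snd ℂ M M')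
    have hZ : N ≤ LinearMap.ker Z := by
      refine wspan_le ?_ ?_
      · rw [Submodule.span_singleton_le_iff_mem, LinearMap.mem_ker]
        simp [Z, mul_comm]
      · intro j p _
        rw [LinearMap.mem_ker, hτ]
        simp [Z, hξ, hξ']
    intro p hp
    have := hZ hp
    rw [LinearMap.mem_ker] at this
    simpa [Z, sub_eq_zero] using this
  have k1 : ∀ y', ((0 : M), y') ∈ N → y' = 0 := by
    have h1 := hs' (N.comap (LinearMap.inr ℂ M M')) (fun u v hv => by
      have := hN u _ hv
      rw [hτ] at this
      simpa using this)
    rcases h1 with h1 | h1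
    · intro y' hy'
      have : y' ∈ N.comap (LinearMap.inr ℂ M M') := hy'
      rw [h1] at this; exact this
    · exfalso
      have : x' ∈ N.comap (LinearMap.inr ℂ M M') := by rw [h1]; trivial
      have := hfun _ this
      simp at this
      exact this.elim hx hx'
  have k2 : ∀ y, (y, (0 : M')) ∈ N → y = 0 := by
    have h1 := hs (N.comap (LinearMap.inl ℂ M M')) (fun u v hv => by
      have := hN u _ hv
      rw [hτ] at this
      simpa using this)
    rcases h1 with h1 | h1
    · intro y' hy'
      have : y' ∈ N.comap (LinearMap.inl ℂ M M') := hy'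
      rw [h1] at this; exact this
    · exfalso
      have : x ∈ N.comap (LinearMap.inl ℂ M M') := by rw [h1]; trivial
      have := hfun _ this
      simp at this
      exact this.elim hx' hx
  have s1 : N.map (LinearMap.fst ℂ M M') = ⊤ := by
    refine (hs _ ?_).resolve_left ?_
    · rintro u _ ⟨p, hp, rfl⟩
      exact ⟨τ u p, hN u p hp, rfl⟩
    · intro hb
      have : x ∈ N.map (LinearMap.fst ℂ M M') := ⟨_, hxN, rfl⟩
      rw [hb] at this; exact h0 this
  have s2 : N.map (LinearMap.snd ℂ M M') = ⊤ := by
    refine (hs' _ ?_).resolve_left ?_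
    · rintro u _ ⟨p, hp, rfl⟩
      exact ⟨τ u p, hN u p hp, rfl⟩
    · intro hb
      have : x' ∈ N.map (LinearMap.snd ℂ M M') := ⟨_, hxN, rfl⟩
      rw [hb] at this; exact h0' this
  let p1 : N →ₗ[ℂ] M := (LinearMap.fst ℂ M M').comp N.subtype
  let p2 : N →ₗ[ℂ] M' := (LinearMap.snd ℂ M M').comp N.subtype
  have b1 : Function.Bijective p1 := by
    constructor
    · rw [← LinearMap.ker_eq_bot, LinearMap.ker_eq_bot']
      rintro ⟨⟨y, y'⟩, hp⟩ h1
      obtain rfl : y = 0 := h1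
      obtain rfl := k1 y' hp
      rfl
    · intro y
      have : y ∈ N.map (LinearMap.fst ℂ M M') := by rw [s1]; trivial
      obtain ⟨p, hp, rfl⟩ := this
      exact ⟨⟨p, hp⟩, rfl⟩
  have b2 : Function.Bijective p2 := by
    constructor
    · rw [← LinearMap.ker_eq_bot, LinearMap.ker_eq_bot']
      rintro ⟨⟨y, y'⟩, hp⟩ h1
      obtain rfl : y' = 0 := h1
      obtain rfl := k2 y hp
      rfl
    · intro y
      have : y ∈ N.map (LinearMap.snd ℂ M M') := by rw [s2]; trivial
      obtain ⟨p, hp, rfl⟩ := this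
      exact ⟨⟨p, hp⟩, rfl⟩
  let ψ := LinearEquiv.ofBijective p1 b1
  refine ⟨p2 ∘ₗ ψ.symm.toLinearMap, ?_, b2.comp ψ.symm.bijective⟩
  intro u y
  obtain ⟨p, rfl⟩ := ψ.surjective y
  have e1 : ρ u (ψ p) = ψ ⟨τ u p, hN u p p.2⟩ := rfl
  rw [e1]
  show p2 (ψ.symm (ψ _)) = ρ' u (p2 (ψ.symm (ψ p)))
  rw [ψ.symm_apply_apply, ψ.symm_apply_apply]
  rfl

/-- the dual representation -/
noncomputable def dρ (D : Oq) (c : D.I) : D.U →ₐ[ℂ] Module.End ℂ (Module.Dual ℂ (D.V c)) :=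
  AlgHom.ofLinearMap
    { toFun := fun u => (D.ρ c (D.S u)).dualMap
      map_add' := fun u v => by ext; simp [S_add]
      map_smul' := fun u v => by ext; simp [S_smul] }
    (by ext; simp) (fun u v => by ext; simp [S_mul])

theorem dρ_apply (c : D.I) (u : D.U) (ξ x) : D.dρ c u ξ x = ξ (D.ρ c (D.S u) x) := rfl

theorem dρ_simp (c : D.I) : D.Simp (D.dρ c) := by
  intro N hN
  let T : Submodule ℂ (D.V c) := N.dualCoannihilator
  have hT : ∀ u, ∀ x ∈ T, D.ρ c (D.S u) x ∈ T := by
    intro u x hx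
    rw [Submodule.mem_dualCoannihilator] at hx ⊢
    intro ξ hξ
    exact hx _ (hN u ξ hξ)
  have hK : ∀ i, ∀ x ∈ T, D.ρ c (D.Kp i) x ∈ T := fun i x hx => by
    have := hT (D.Km i) x hx; rwa [S_Km] at this
  have hK' : ∀ i, ∀ x ∈ T, D.ρ c (D.Km i) x ∈ T := fun i x hx => by
    have := hT (D.Kp i) x hx; rwa [S_Kp] at this
  have h1 : T = ⊥ ∨ T = ⊤ := by
    refine D.hsimple c T (stable_of_gens (D.ρ c) T ?_ ?_ hK hK')
    · intro i x hx
      have h2 := hK i _ (Submodule.neg_mem _ (hT (D.E i) x hx))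
      rw [S_E, map_neg (D.ρ c), LinearMap.neg_apply, neg_neg, ← Module.End.mul_apply, ← map_mul, ← mul_assoc, KpKm1, one_mul] at h2
      exact h2
    · intro i x hx
      have h2 := (Submodule.neg_mem _ (hT (D.F i) _ (hK' i x hx)))
      rw [S_F, map_neg, LinearMap.neg_apply, neg_neg, ← Module.End.mul_apply, ← map_mul, mul_assoc, KpKm1, mul_one] at h2
      exact h2
  have h3 : N = T.dualAnnihilator := (Subspace.dualCoannihilator_dualAnnihilator_eq).symm
  rcases h1 with h1 | h1
  · right; rw [h3, h1]; simp
  · left; rw [h3, h1]; simp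

theorem ρ_simp (c : D.I) : D.Simp (D.ρ c) := D.hsimple c

theorem expneg (D : Oq) (μ : Fin D.n → ℤ) (i : Fin D.n) :
    (D.d i : ℤ) * (-μ) i = -((D.d i : ℤ) * μ i) := by rw [Pi.neg_apply, mul_neg]

theorem VWt_op {c : D.I} {μ : Fin D.n → ℤ} {x : D.V c} : D.op.VWt c μ x ↔ D.VWt c (-μ) x := by
  constructor
  · intro h; exact VWt_of_inv h
  · intro h i
    have := VWt_inv h i
    rw [expneg D μ i, neg_neg] at this
    exact this

theorem DWt.inv {c : D.I} {μ : Fin D.n → ℤ} {ξ} (h : D.DWt c μ ξ) (i x) :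
    ξ (D.ρ c (D.Km i) x) = D.q ^ (-((D.d i : ℤ) * μ i)) * ξ x := by
  have h2 := h i (D.ρ c (D.Km i) x)
  rw [← Module.End.mul_apply, ← map_mul, KpKm1, map_one, Module.End.one_apply] at h2
  rw [h2, ← mul_assoc, ← zpow_add₀ D.hq.1, neg_add_cancel, zpow_zero, one_mul]

theorem DWt_op {c : D.I} {μ : Fin D.n → ℤ} {ξ} : D.op.DWt c μ ξ ↔ D.DWt c (-μ) ξ := by
  constructor
  · intro h i x
    have := DWt.inv (D := D.op) h i x
    rw [expneg D μ i]
    exact this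
  · intro h i x
    have := DWt.inv h i x
    rw [expneg D μ i, neg_neg] at this
    exact this

theorem exists_wt {n : ℕ} {q : ℂ} {d : Fin n → ℕ} {k : Fin n → M →ₗ[ℂ] M} (h : WtSpan q d (fun i => k i))
    (hnt : ∃ x : M, x ≠ 0) : ∃ μ x, x ≠ 0 ∧ IsWt q d (fun i => k i) μ x := by
  by_contra hcon
  push Not at hcon
  obtain ⟨x, hx⟩ := hnt
  refine hx ?_
  have h1 := h x
  have h2 : {y : M | ∃ μ, IsWt q d (fun i => k i) μ y} ⊆ {0} := by
    rintro y ⟨μ, hy⟩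
    by_contra hne
    exact hcon μ y hne hy
  have h3 := Submodule.span_mono (R := ℂ) h2 h1
  simpa using h3

theorem exists_hw (D : Oq) (c : D.I) : ∃ (v : D.V c) (μ : Fin D.n → ℤ), v ≠ 0 ∧ D.VWt c μ v ∧
    ∀ i, D.ρ c (D.E i) v = 0 := by
  obtain ⟨μ, x, hx, hw⟩ := exists_wt (k := fun j => D.ρ c (D.Kp j)) (D.hwt c) (D.hnt c)
  obtain ⟨m, hm⟩ := D.nilV_E c
  obtain ⟨y, hy, ⟨ν, hν⟩, hE⟩ := nilE_top (fun j => D.ρ c (D.E j)) (fun y => ∃ μ, D.VWt c μ y)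
    (fun j y ⟨μ, h⟩ => ⟨_, h.E j⟩) m x (hm x) hx ⟨μ, hw⟩
  exact ⟨y, ν, hy, hν, hE⟩

theorem exists_lw (D : Oq) (c : D.I) : ∃ (v : D.V c) (μ : Fin D.n → ℤ), v ≠ 0 ∧ D.VWt c μ v ∧
    ∀ i, D.ρ c (D.F i) v = 0 := by
  obtain ⟨v, μ, h1, h2, h3⟩ := exists_hw D.op c
  exact ⟨v, -μ, h1, VWt_op.mp h2, h3⟩

theorem nilVd_E (D : Oq) (c : D.I) : ∃ m, ∀ x, x ∈ nilE (fun j => D.KT c (D.E j)) m :=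
  nil_of_bdd D.hR D.hq D.hd (D.dual_wt c) _ (-1) (Or.inr rfl) (fun i j ξ => by
    ext x
    show ξ (D.ρ c (D.E j) (D.ρ c (D.Kp i) x)) = _ * ξ (D.ρ c (D.Kp i) (D.ρ c (D.E j) x))
    rw [← Module.End.mul_apply, ← map_mul, EK, map_smul, LinearMap.smul_apply, map_smul, map_mul,
      neg_one_mul]; rfl)

theorem exists_dl (D : Oq) (c : D.I) : ∃ (ξ : Module.Dual ℂ (D.V c)) (μ : Fin D.n → ℤ), ξ ≠ 0 ∧ D.DWt c μ ξ ∧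
    ∀ i x, ξ (D.ρ c (D.E i) x) = 0 := by
  have hnt : ∃ x : Module.Dual ℂ (D.V c), x ≠ 0 := by
    obtain ⟨v, hv⟩ := D.hnt c
    obtain ⟨f, hf⟩ := Module.Projective.exists_dual_ne_zero ℂ hv
    exact ⟨f, fun h => hf (by rw [h]; rfl)⟩
  obtain ⟨μ, x, hx, hw⟩ := exists_wt (k := fun j => D.KT c (D.Kp j)) (D.dual_wt c) hnt
  obtain ⟨m, hm⟩ := D.nilVd_E c
  obtain ⟨y, hy, ⟨ν, hν⟩, hE⟩ := nilE_top (fun j => D.KT c (D.E j)) (fun y => ∃ μ, D.DWt c μ y)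
    (fun j y ⟨μ, h⟩ => ⟨_, h.E j⟩) m x (hm x) hx ⟨μ, fun i v => by
      have h1 : D.KT c (D.Kp i) x = _ := hw i
      exact congrArg (fun f : Module.Dual ℂ (D.V c) => f v) h1⟩
  exact ⟨y, ν, hy, hν, fun i x => congrArg (fun f : Module.Dual ℂ (D.V c) => f x) (hE i)⟩

theorem exists_dh (D : Oq) (c : D.I) : ∃ (ξ : Module.Dual ℂ (D.V c)) (μ : Fin D.n → ℤ), ξ ≠ 0 ∧ D.DWt c μ ξ ∧
    ∀ i x, ξ (D.ρ c (D.F i) x) = 0 := by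
  obtain ⟨v, μ, h1, h2, h3⟩ := exists_dl D.op c
  exact ⟨v, -μ, h1, DWt_op.mp h2, h3⟩

/-- extreme vectors -/
structure HL (D : Oq) (c : D.I) where
  vh : D.V c
  vl : D.V c
  xh : Module.Dual ℂ (D.V c)
  xl : Module.Dual ℂ (D.V c)
  hw : Fin D.n → ℤ
  lw : Fin D.n → ℤ
  γ : Fin D.n → ℕ
  vh0 : vh ≠ 0
  vl0 : vl ≠ 0
  vhw : D.VWt c hw vh
  vlw : D.VWt c lw vl
  xhw : D.DWt c hw xh
  xlw : D.DWt c lw xl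
  vhE : ∀ i, D.ρ c (D.E i) vh = 0
  vlF : ∀ i, D.ρ c (D.F i) vl = 0
  xlE : ∀ i x, xl (D.ρ c (D.E i) x) = 0
  xhF : ∀ i x, xh (D.ρ c (D.F i) x) = 0
  xhv : xh vh ≠ 0
  xlv : xl vl ≠ 0
  hγ : lw = hw - ∑ i, γ i • root D.a i

theorem killE {ρ : D.U →ₐ[ℂ] Module.End ℂ M} (hs : D.Simp ρ) {μ : Fin D.n → ℤ} {x : M}
    (h : D.RWt ρ μ x) (h0 : x ≠ 0) (hE : ∀ i, ρ (D.F i) x = 0) (ξ : M →ₗ[ℂ] ℂ)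
    (hξ : ∀ i y, ξ (ρ (D.E i) y) = 0) (hx : ξ x = 0) (y : M) : ξ y = 0 :=
  killF (D := D.op) (μ := -μ) hs (fun i => by
    have := h.inv i
    rw [← expneg D μ i] at this; exact this) h0 hE ξ hξ hx y

theorem exists_HL (D : Oq) (c : D.I) : Nonempty (HL D c) := by
  obtain ⟨vh, hw, vh0, vhw, vhE⟩ := D.exists_hw c
  obtain ⟨vl, lw, vl0, vlw, vlF⟩ := D.exists_lw c
  obtain ⟨xh, hw', xh0, xhw, xhF⟩ := D.exists_dh c
  obtain ⟨xl, lw', xl0, xlw, xlE⟩ := D.exists_dl c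
  have xhv : xh vh ≠ 0 := fun h => xh0 (LinearMap.ext fun y => killF (D.ρ_simp c) vhw vh0 vhE xh xhF h y)
  have xlv : xl vl ≠ 0 := fun h => xl0 (LinearMap.ext fun y => killE (D.ρ_simp c) vlw vl0 vlF xl xlE h y)
  obtain rfl : hw = hw' := by by_contra hne; exact xhv (xhw.pair vhw hne)
  obtain rfl : lw = lw' := by by_contra hne; exact xlv (xlw.pair vlw hne)
  have hγ : ∃ γ : Fin D.n → ℕ, lw = hw - ∑ i, γ i • root D.a i := by
    by_contra hcon
    push Not at hcon
    refine xl0 (LinearMap.ext fun y => ?_)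
    have hle : wspan (fun j => D.ρ c (D.F j)) (Submodule.span ℂ {vh}) ≤
        Submodule.span ℂ {y : D.V c | ∃ γ : Fin D.n → ℕ, D.VWt c (hw - ∑ i, γ i • root D.a i) y} := by
      refine wspan_le ?_ ?_
      · rw [Submodule.span_singleton_le_iff_mem]
        exact Submodule.subset_span ⟨0, by simpa using vhw⟩
      · intro j x hx
        refine Submodule.span_induction (p := fun x _ => D.ρ c (D.F j) x ∈ Submodule.span ℂ {y : D.V c | ∃ γ : Fin D.n → ℕ, D.VWt c (hw - ∑ i, γ i • root D.a i) y}) ?_ ?_ ?_ ?_ hx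
        · rintro x ⟨γ, hx⟩
          refine Submodule.subset_span ⟨γ + Pi.single j 1, ?_⟩
          have h1 := hx.F j
          have h2 : ∑ i, (γ + Pi.single j 1 : Fin D.n → ℕ) i • root D.a i = ∑ i, γ i • root D.a i + root D.a j := by
            simp only [Pi.add_apply, add_smul, Finset.sum_add_distrib]
            congr 1
            rw [Finset.sum_eq_single j] <;> simp +contextual [Pi.single_apply]
          rw [h2, ← sub_sub]
          exact h1
        · simp
        · intro x y _ _ hx hy; rw [map_add]; exact Submodule.add_mem _ hx hy
        · intro r x _ hx; rw [map_smul]; exact Submodule.smul_mem _ _ hx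
    rw [genF (D.ρ_simp c) vhw vh0 vhE] at hle
    refine Submodule.span_induction (p := fun y _ => xl y = 0) ?_ (by simp) ?_ ?_ (hle (trivial : y ∈ ⊤))
    · rintro y ⟨γ, hy⟩
      exact xlw.pair hy (hcon γ).symm
    · intro x y _ _ hx hy; rw [map_add, hx, hy, add_zero]
    · intro r x _ hx; rw [map_smul, hx, smul_zero]
  obtain ⟨γ, hγ⟩ := hγ
  exact ⟨⟨vh, vl, xh, xl, hw, lw, γ, vh0, vl0, vhw, vlw, xhw, xlw, vhE, vlF, xlE, xhF, xhv, xlv, hγ⟩⟩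

/-- highest weights are dominant -/
theorem dominant {c : D.I} {v : D.V c} {μ : Fin D.n → ℤ} (h0 : v ≠ 0) (hw : D.VWt c μ v)
    (hE : ∀ i, D.ρ c (D.E i) v = 0) (i) : 0 ≤ μ i := by
  obtain ⟨ξ, hξ⟩ := Module.Projective.exists_dual_ne_zero ℂ h0
  obtain ⟨m, hm⟩ := D.fnil (D.cf c ξ v)
  refine QAct.dominant (D := D.Q) D.hq D.hd D.ha (x := D.cf c ξ v) (μ := μ) ?_ i ?_ ?_ (m := m) ?_
  · intro j
    show D.L (D.Kp j) _ = _
    rw [L_cf, hw.wt j]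
    exact (D.cfv c ξ).map_smul _ _
  · intro hz
    have := D.hcf c ξ v 1
    rw [hz, map_zero, map_one (D.ρ c)] at this
    exact hξ this.symm
  · show D.L (D.E i) _ = _
    rw [L_cf, hE]
    exact (D.cfv c ξ).map_zero
  · exact mem_nilE_zero.mp (nilE_epow (fun j => D.L (D.F j * D.Kp j)) i 0 m _ (by rwa [zero_add]))

/-- every dominant weight is a highest weight -/
def Surj (D : Oq) : Prop := ∀ μ : Fin D.n → ℤ, (∀ i, 0 ≤ μ i) → ∃ (c : D.I) (v : D.V c),
  v ≠ 0 ∧ D.VWt c μ v ∧ ∀ i, D.ρ c (D.E i) v = 0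

/-- duals -/
theorem exists_dual (hS : Surj D) (c : D.I) : ∃ (c' : D.I) (φ : D.V c' →ₗ[ℂ] Module.Dual ℂ (D.V c)),
    (∀ u y, φ (D.ρ c' u y) = D.dρ c u (φ y)) ∧ Function.Bijective φ := by
  obtain ⟨H⟩ := D.exists_HL c
  have hdom : ∀ i, 0 ≤ (-H.lw) i := dominant (D := D.op) H.vl0 (VWt_op.mpr (by rw [neg_neg]; exact H.vlw)) H.vlF
  obtain ⟨c', v, hv0, hvw, hvE⟩ := hS _ hdom
  obtain ⟨xh, hw', xh0, xhw, xhF⟩ := D.exists_dh c'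
  have xhv : xh v ≠ 0 := fun h => xh0 (LinearMap.ext fun y => killF (D.ρ_simp c') hvw hv0 hvE xh xhF h y)
  obtain ⟨φ, h1, h2⟩ := iso (D := D) (ρ := D.ρ c') (ρ' := D.dρ c) (D.ρ_simp c') (D.dρ_simp c) (μ := -H.lw) (x := v)
    (x' := H.xl) hvw (fun i => by
      ext x
      rw [dρ_apply, S_Kp, H.xlw.inv, Pi.neg_apply, mul_neg]; rfl) hv0
    (fun h => H.xlv (by rw [h]; rfl)) hvE (fun i => by
      ext x
      rw [dρ_apply, S_E, map_neg, map_mul, LinearMap.neg_apply, map_neg, Module.End.mul_apply, H.xlw.inv, H.xlE]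
      simp) xh xhF xhv (Module.Dual.eval ℂ _ H.vl) (fun i ξ => by
      show D.dρ c (D.F i) ξ H.vl = 0
      rw [dρ_apply, S_F, map_neg, map_mul, LinearMap.neg_apply, map_neg, Module.End.mul_apply, H.vlw.wt, map_smul,
        H.vlF, smul_zero, map_zero, neg_zero]) H.xlv
  exact ⟨c', φ, h1, h2⟩

theorem surj_op (hS : Surj D) : Surj D.op := by
  intro μ' hμ
  obtain ⟨μ, hμ'⟩ : ∃ μ : Fin D.n → ℤ, μ = μ' := ⟨μ', rfl⟩
  subst hμ'
  obtain ⟨c, v, hv0, hvw, hvE⟩ := hS μ hμ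
  obtain ⟨xh, hw', xh0, xhw, xhF⟩ := D.exists_dh c
  have xhv : xh v ≠ 0 := fun h => xh0 (LinearMap.ext fun y => killF (D.ρ_simp c) hvw hv0 hvE xh xhF h y)
  obtain rfl : μ = hw' := by by_contra hne; exact xhv (xhw.pair hvw hne)
  obtain ⟨c', φ, h1, h2⟩ := exists_dual hS c
  obtain ⟨w, rfl⟩ := h2.2 xh
  have w0 : w ≠ 0 := fun h => xh0 (by rw [h, map_zero])
  have ww : D.VWt c' (-μ) w := fun (i : Fin D.n) => h2.1 (by
    show φ (D.ρ c' (D.Kp i) w) = φ (D.q ^ ((D.d i : ℤ) * (-μ) i) • w)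
    rw [h1, map_smul]
    ext x
    rw [dρ_apply, S_Kp, xhw.inv, expneg D μ i]; rfl)
  have wF : ∀ i : Fin D.n, D.ρ c' (D.F i) w = 0 := fun i => h2.1 (by
    rw [h1, map_zero]
    ext x
    rw [dρ_apply, S_F, map_neg, map_mul, LinearMap.neg_apply, map_neg, Module.End.mul_apply, xhF]
    simp)
  exact ⟨c', w, w0, VWt_op.mpr ww, wF⟩

/-- composition with the antipode -/
theorem exists_aS (hS : Surj D) (x : D.A) : ∃ y : D.A, ∀ u, D.ι y u = D.ι x (D.S u) := by
  refine A_ind0 (P := fun x => ∃ y : D.A, ∀ u, D.ι y u = D.ι x (D.S u)) ?_ ?_ ?_ ?_ x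
  · intro r
    refine ⟨algebraMap ℂ _ r, fun u => ?_⟩
    have h : D.ε (D.S u) = D.ε u := by
      refine gen_ind (P := fun u => D.ε (D.S u) = D.ε u) ?_ ?_ ?_ ?_ ?_ ?_ ?_ u
      · intro r; rw [S_alg]
      · intro u v hu hv; rw [S_add, map_add, hu, hv, map_add]
      · intro u v hu hv; rw [S_mul, map_mul, hu, hv, map_mul, mul_comm]
      · intro i; rw [S_E, map_neg, map_mul, D.hεE]; simp
      · intro i; rw [S_F, map_neg, map_mul, D.hεF]; simp
      · intro i; rw [S_Kp, hεKm, D.hεK]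
      · intro i; rw [S_Km, hεKm, D.hεK]
    rw [ι_alg, ι_alg, h]
  · rintro x y ⟨x', hx⟩ ⟨y', hy⟩
    exact ⟨x' + y', fun u => by rw [map_add, map_add, LinearMap.add_apply, LinearMap.add_apply, hx, hy]⟩
  · rintro x y ⟨x', hx⟩ ⟨y', hy⟩
    refine ⟨y' * x', fun u => ?_⟩
    rw [D.hιmul, D.hιmul, Δ_S]
    generalize D.Δ u = t
    induction t using TensorProduct.induction_on with
    | zero => simp
    | tmul a b => rw [Th_tmul, m2_tmul, m2_tmul, hx, hy, mul_comm]
    | add a b ha hb => rw [map_add, map_add, map_add, ha, hb]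
  · intro c ξ v
    obtain ⟨c', φ, h1, h2⟩ := exists_dual hS c
    obtain ⟨w, rfl⟩ := h2.2 ξ
    refine ⟨D.cf c' (Module.Dual.eval ℂ _ v ∘ₗ φ) w, fun u => ?_⟩
    rw [D.hcf, D.hcf, LinearMap.comp_apply, h1]
    rfl

end Oq
end OQ

open scoped TensorProduct
namespace OQ
namespace Oq
variable {D : Oq}

/-- the left regular representation on `A` -/
noncomputable def LA (D : Oq) : D.U →ₐ[ℂ] Module.End ℂ D.A := AlgHom.ofLinearMap
  { toFun := D.L
    map_add' := fun u v => LinearMap.ext fun x => L_add u v x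
    map_smul' := fun r v => LinearMap.ext fun x => L_smul r v x }
  (LinearMap.ext fun x => L_one x) (fun u v => LinearMap.ext fun x => L_mul u v x)

theorem LA_apply (u : D.U) (x : D.A) : D.LA u x = D.L u x := rfl

theorem coprod (x : D.A) : ∃ (κ : Type) (_ : Fintype κ) (e φ : κ → D.A),
    ∀ u v, D.ι x (u * v) = ∑ k, D.ι (e k) u * D.ι (φ k) v := by
  refine A_ind0 (P := fun x => ∃ (κ : Type) (_ : Fintype κ) (e φ : κ → D.A),
    ∀ u v, D.ι x (u * v) = ∑ k, D.ι (e k) u * D.ι (φ k) v) ?_ ?_ ?_ ?_ x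
  · intro r
    refine ⟨Unit, inferInstance, fun _ => algebraMap ℂ _ r, fun _ => 1, fun u v => ?_⟩
    simp [ι_alg, D.hι1, mul_assoc]
  · rintro x y ⟨κ, _, e, φ, h⟩ ⟨κ', _, e', φ', h'⟩
    refine ⟨κ ⊕ κ', inferInstance, Sum.elim e e', Sum.elim φ φ', fun u v => ?_⟩
    simp [h, h']
  · rintro x y ⟨κ, _, e, φ, h⟩ ⟨κ', _, e', φ', h'⟩
    refine ⟨κ × κ', inferInstance, fun p => e p.1 * e' p.2, fun p => φ p.1 * φ' p.2, fun u v => ?_⟩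
    simp only [D.hιmul, map_mul]
    generalize D.Δ u = s
    generalize D.Δ v = t
    induction s using TensorProduct.induction_on with
    | zero => simp
    | add a b ha hb => rw [add_mul, map_add, ha, hb, ← Finset.sum_add_distrib]; simp [add_mul]
    | tmul a b =>
      induction t using TensorProduct.induction_on with
      | zero => simp
      | add a b ha hb => rw [mul_add, map_add, ha, hb, ← Finset.sum_add_distrib]; simp [mul_add]
      | tmul a' b' =>
        rw [Algebra.TensorProduct.tmul_mul_tmul, m2_tmul, h, h', Finset.sum_mul_sum,
          Fintype.sum_prod_type]
        refine Finset.sum_congr rfl fun k _ => Finset.sum_congr rfl fun l _ => ?_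
        rw [m2_tmul, m2_tmul]; ring
  · intro c ξ v
    let b := Module.finBasis ℂ (D.V c)
    refine ⟨Fin (Module.finrank ℂ (D.V c)), inferInstance, fun k => D.cf c ξ (b k),
      fun k => D.cf c (b.coord k) v, fun u w => ?_⟩
    simp only [D.hcf]
    rw [map_mul, Module.End.mul_apply]
    conv_lhs => rw [← b.sum_repr (D.ρ c w v), map_sum, map_sum]
    refine Finset.sum_congr rfl fun k _ => ?_
    rw [map_smul, map_smul, smul_eq_mul, mul_comm]; rfl

theorem hopf0 (hS : Surj D) (Y : Submodule ℂ D.A) (hY : Y ≠ ⊥) (hR : ∀ y ∈ Y, ∀ b, y * b ∈ Y)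
    (hL : ∀ u, ∀ y ∈ Y, D.L u y ∈ Y) : 1 ∈ Y := by
  obtain ⟨a0, ha0, hne⟩ := Y.exists_mem_ne_zero_of_ne_bot hY
  obtain ⟨a, ha, h1⟩ : ∃ a ∈ Y, D.ι a 1 ≠ 0 := by
    by_contra hcon
    push Not at hcon
    refine hne (A_eq fun u => ?_)
    have := hcon _ (hL u _ ha0)
    rw [ιL, one_mul] at this
    rw [this]; simp
  obtain ⟨κ, _, e, φ, h⟩ := coprod a
  have hLa : ∀ u, D.L u a = ∑ k, D.ι (φ k) u • e k := fun u => A_eq fun x => by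
    rw [ιL, h, map_sum, LinearMap.sum_apply]
    refine Finset.sum_congr rfl fun k _ => ?_
    rw [map_smul, LinearMap.smul_apply, smul_eq_mul, mul_comm]
  let W : Submodule ℂ D.A := Submodule.span ℂ (Set.range fun u => D.L u a)
  have hWle : W ≤ Submodule.span ℂ (Set.range e) := by
    refine Submodule.span_le.mpr ?_
    rintro _ ⟨u, rfl⟩
    show D.L u a ∈ _
    rw [hLa]
    exact Submodule.sum_mem _ fun k _ => Submodule.smul_mem _ _ (Submodule.subset_span ⟨k, rfl⟩)
  have hWY : W ≤ Y := Submodule.span_le.mpr (by rintro _ ⟨u, rfl⟩; exact hL u a ha)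
  have : FiniteDimensional ℂ (Submodule.span ℂ (Set.range e)) :=
    FiniteDimensional.span_of_finite ℂ (Set.finite_range e)
  have : FiniteDimensional ℂ W := Submodule.finiteDimensional_of_le hWle
  let b := Module.finBasis ℂ W
  have hex : ∀ k, ∃ f : D.A →ₗ[ℂ] ℂ, f ∘ₗ W.subtype = b.coord k := fun k =>
    LinearMap.exists_extend _
  choose f hf using hex
  have hmem : ∀ u, D.L u a ∈ W := fun u => Submodule.subset_span ⟨u, rfl⟩
  have hrep : ∀ u, D.L u a = ∑ k, f k (D.L u a) • (b k : D.A) := by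
    intro u
    have h2 := b.sum_repr ⟨D.L u a, hmem u⟩
    have h3 := congrArg Subtype.val h2
    conv_lhs => rw [show D.L u a = ((⟨D.L u a, hmem u⟩ : W) : D.A) from rfl, ← h3]
    rw [AddSubmonoidClass.coe_finsetSum]
    refine Finset.sum_congr rfl fun k _ => ?_
    have h4 := congrArg (fun g : W →ₗ[ℂ] ℂ => g ⟨D.L u a, hmem u⟩) (hf k)
    simp only [LinearMap.comp_apply, Submodule.subtype_apply] at h4
    rw [h4]; rfl
  have hpsi : ∀ k, ∃ ψ : D.A, ∀ u, D.ι ψ u = f k (D.L (D.S u) a) := by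
    intro k
    obtain ⟨ψ, hψ⟩ := exists_aS hS (∑ m, f k (e m) • φ m)
    refine ⟨ψ, fun u => ?_⟩
    rw [hψ, hLa, map_sum, map_sum, LinearMap.sum_apply]
    refine Finset.sum_congr rfl fun m _ => ?_
    rw [map_smul, map_smul, LinearMap.smul_apply, smul_eq_mul, smul_eq_mul, mul_comm]
  choose ψ hψ using hpsi
  have hsum : ∑ k, (b k : D.A) * ψ k ∈ Y := Submodule.sum_mem _ fun k _ => hR _ (hWY (b k).2) _
  have hone : ∑ k, (b k : D.A) * ψ k = D.ι a 1 • (1 : D.A) := by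
    refine A_eq fun u => ?_
    have key : ∀ t, ∑ k, m2 (D.ι (b k : D.A)) (D.ι (ψ k)) t = D.ι a (D.muS t) := by
      intro t
      induction t using TensorProduct.induction_on with
      | zero => simp
      | add x y hx hy => simp only [map_add, Finset.sum_add_distrib, hx, hy]
      | tmul x y =>
        simp only [m2_tmul, muS_tmul, hψ]
        have h5 := congrArg (fun z => D.ι z x) (hrep (D.S y))
        simp only [ιL, map_sum, LinearMap.sum_apply, map_smul, LinearMap.smul_apply, smul_eq_mul] at h5
        rw [h5]
        exact Finset.sum_congr rfl fun k _ => mul_comm _ _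
    rw [map_sum, LinearMap.sum_apply]
    simp only [D.hιmul]
    rw [key, muS_Δ, map_smul, LinearMap.smul_apply, D.hι1, Algebra.algebraMap_eq_smul_one, map_smul,
      smul_eq_mul, smul_eq_mul, mul_comm]
  rw [hone] at hsum
  have := Y.smul_mem (D.ι a 1)⁻¹ hsum
  rwa [smul_smul, inv_mul_cancel₀ h1, one_smul] at this

theorem Km_stable (Y : Submodule ℂ D.A) (hK : ∀ i, ∀ y ∈ Y, D.L (D.Kp i) y ∈ Y) (i) (y : D.A) (hy : y ∈ Y) :
    D.L (D.Km i) y ∈ Y := by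
  have hle : Y ≤ Y.comap (D.L (D.Km i)) :=
    WtSpan.le (k := fun i => D.L (D.Kp i)) D.hq D.hd D.wtsL Y _ hK (by
      intro μ x hx hw
      have h1 : D.L (D.Kp i) x = _ := hw i
      have h2 := congrArg (D.L (D.Km i)) h1
      rw [← L_mul, KmKp1, L_one, map_smul] at h2
      have h3 : D.L (D.Km i) x = (D.q ^ ((D.d i : ℤ) * μ i))⁻¹ • x := by
        conv_rhs => rw [h2]
        rw [smul_smul, inv_mul_cancel₀ (D.hq.zpow_ne _), one_smul]
      show D.L (D.Km i) x ∈ Y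
      rw [h3]; exact Y.smul_mem _ hx)
  exact hle hy

theorem hopf (hS : Surj D) (Y : Submodule ℂ D.A) (hY : Y ≠ ⊥) (hR : ∀ y ∈ Y, ∀ b, y * b ∈ Y)
    (h : ∀ i, ∀ y ∈ Y, D.Q.e i y ∈ Y ∧ D.Q.f i y ∈ Y ∧ D.Q.k i y ∈ Y) : 1 ∈ Y := by
  have hK : ∀ i, ∀ y ∈ Y, D.L (D.Kp i) y ∈ Y := fun i y hy => (h i y hy).2.2
  have hKm := Km_stable Y hK
  refine hopf0 hS Y hY hR (stable_of_gens D.LA Y (fun i y hy => (h i y hy).1) ?_ hK hKm)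
  intro i y hy
  have h1 : D.L (D.F i * D.Kp i) (D.L (D.Km i) y) ∈ Y := (h i _ (hKm i y hy)).2.1
  rw [← L_mul, mul_assoc, KpKm1, mul_one] at h1
  exact h1

/-! ### vectors -/

theorem hw_unique {c : D.I} (H : HL D c) {μ : Fin D.n → ℤ} {x : D.V c} (hx : D.VWt c μ x)
    (hE : ∀ i, D.ρ c (D.E i) x = 0) (h : H.xh x = 0) : x = 0 := by
  by_contra h0
  exact H.xhv (killF (D.ρ_simp c) hx h0 hE H.xh H.xhF h H.vh)

theorem EF_apply (c : D.I) (i j) (x : D.V c) : D.ρ c (D.E i) (D.ρ c (D.F j) x) =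
    D.ρ c (D.F j) (D.ρ c (D.E i) x) + if i = j then (D.q ^ (D.d i : ℤ) - D.q ^ (-(D.d i : ℤ)))⁻¹ •
      (D.ρ c (D.Kp i) x - D.ρ c (D.Km i) x) else 0 := by
  have h1 := sub_eq_iff_eq_add'.mp (EF (D := D) i j)
  rw [← Module.End.mul_apply, ← map_mul, h1, map_add, map_mul, LinearMap.add_apply, Module.End.mul_apply]
  congr 1
  split_ifs <;> simp

theorem F_vh {c : D.I} (H : HL D c) {j : Fin D.n} (hw : H.hw = Pi.single j 1) (i) (hij : i ≠ j) :
    D.ρ c (D.F i) H.vh = 0 := by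
  refine hw_unique H (H.vhw.F i) (fun l => ?_) (H.xhF _ _)
  rw [EF_apply, H.vhE, map_zero, zero_add]
  split_ifs with h
  · subst h
    rw [H.vhw.wt, show D.ρ c (D.Km l) H.vh = _ from VWt_inv H.vhw l]
    simp [hw, hij]
  · rfl

theorem FF_vh {c : D.I} (H : HL D c) {j : Fin D.n} (hw : H.hw = Pi.single j 1) :
    D.ρ c (D.F j) (D.ρ c (D.F j) H.vh) = 0 := by
  refine hw_unique H ((H.vhw.F j).F j) (fun l => ?_) (H.xhF _ _)
  rw [EF_apply, EF_apply, H.vhE, map_zero, zero_add]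
  split_ifs with h
  · subst h
    have e1 : D.ρ c (D.Km l) H.vh = _ := VWt_inv H.vhw l
    have e2 : D.ρ c (D.Km l) (D.ρ c (D.F l) H.vh) = _ := VWt_inv (H.vhw.F l) l
    rw [H.vhw.wt, e1, (H.vhw.F l).wt, e2, ← sub_smul, smul_smul, map_smul, ← sub_smul, smul_smul,
      ← add_smul]
    simp only [hw, Pi.sub_apply, Pi.single_eq_same, root, D.ha]
    convert zero_smul ℂ _
    rw [← mul_add]
    convert mul_zero _
    norm_num
  · simp

theorem gen_vl {c : D.I} (H : HL D c) : wspan (fun j => D.ρ c (D.E j)) (Submodule.span ℂ {H.vl}) = ⊤ :=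
  genF (D := D.op) (ρ := D.ρ c) (D.ρ_simp c) (μ := -H.lw) (fun i => by
    have : D.ρ c (D.Km i) H.vl = _ := VWt_inv H.vlw i
    rw [← expneg D H.lw i] at this; exact this) H.vl0 H.vlF

theorem gen_xh {c : D.I} (H : HL D c) : wspan (fun j => D.KT c (D.E j)) (Submodule.span ℂ {H.xh}) = ⊤ := by
  have p1 : ∀ i : Fin D.n, D.dρ c (D.Km i) H.xh = D.q ^ ((D.d i : ℤ) * H.hw i) • H.xh := by
    intro i
    ext x
    rw [dρ_apply, S_Km, H.xhw]; rfl
  have p2 : ∀ i : Fin D.n, D.dρ c (D.F i) H.xh = 0 := by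
    intro i
    ext x
    rw [dρ_apply, S_F, map_neg, map_mul, LinearMap.neg_apply, map_neg, Module.End.mul_apply, H.xhF]
    simp
  have p3 : H.xh ≠ 0 := fun h => H.xhv (by rw [h]; rfl)
  have h1 : wspan (fun j => D.dρ c (D.E j)) (Submodule.span ℂ {H.xh}) = ⊤ :=
    genF (D := D.op) (ρ := D.dρ c) (D.dρ_simp c) (μ := H.hw) p1 p3 p2
  have hKm : ∀ i, ∀ x ∈ wspan (fun j => D.KT c (D.E j)) (Submodule.span ℂ {H.xh}),
      D.KT c (D.Km i) x ∈ wspan (fun j => D.KT c (D.E j)) (Submodule.span ℂ {H.xh}) := by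
    intro i
    refine wspan_skew _ ?_ (fun j => D.q ^ ((D.d i : ℤ) * D.a i j)) ?_
    · intro x hx
      obtain ⟨r, rfl⟩ := Submodule.mem_span_singleton.mp hx
      have : D.KT c (D.Km i) H.xh = D.q ^ (-((D.d i : ℤ) * H.hw i)) • H.xh := by
        ext x
        exact H.xhw.inv i x
      rw [map_smul, this]
      exact Submodule.smul_mem _ _ (Submodule.smul_mem _ _ (Submodule.mem_span_singleton_self _))
    · intro j ξ
      ext x
      show ξ (D.ρ c (D.E j) (D.ρ c (D.Km i) x)) = _ * ξ (D.ρ c (D.Km i) (D.ρ c (D.E j) x))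
      rw [← Module.End.mul_apply, ← Module.End.mul_apply, ← map_mul, ← map_mul, KmE, map_smul,
        LinearMap.smul_apply, map_smul, smul_eq_mul, ← mul_assoc, ← zpow_add₀ D.hq.1, add_neg_cancel,
        zpow_zero, one_mul]
  rw [eq_top_iff, ← h1]
  refine wspan_le (le_wspan _ _) ?_
  intro j ξ hξ
  have : D.dρ c (D.E j) ξ = -(D.KT c (D.E j) (D.KT c (D.Km j) ξ)) := by
    ext x
    rw [dρ_apply, S_E, map_neg, map_mul, LinearMap.neg_apply, map_neg]; rfl
  rw [this]
  exact Submodule.neg_mem _ (wspan_f (fun j => D.KT c (D.E j)) _ j (hKm j ξ hξ))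

end Oq
end OQ

open scoped TensorProduct
namespace OQ
namespace Oq
variable {D : Oq}

/-- the triangular decomposition as a spanning statement -/
theorem tri (N : Submodule ℂ D.U) (h1 : (1 : D.U) ∈ N) (P : Submodule ℂ D.U) (hP : P ≤ N)
    (hE : ∀ i, ∀ u ∈ N, D.E i * u ∈ N) (hPF : ∀ i, ∀ u ∈ P, D.F i * u ∈ P)
    (T : Submodule ℂ D.U) (hT : T ≤ P) (hT1 : 1 ∈ T) (hTK : ∀ i, ∀ u ∈ T, D.Kp i * u ∈ T)
    (hTK' : ∀ i, ∀ u ∈ T, D.Km i * u ∈ T) (u : D.U) : u ∈ N := by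
  let B := wspan (fun j => LinearMap.mulLeft ℂ (D.F j)) T
  have hBP : B ≤ P := wspan_le hT hPF
  have hK : ∀ i, ∀ x ∈ B, D.Kp i * x ∈ B := by
    intro i
    refine wspan_skew (LinearMap.mulLeft ℂ (D.Kp i)) (hTK i) (fun j => D.q ^ (-((D.d i : ℤ) * D.a i j))) ?_
    intro j x
    show D.Kp i * (D.F j * x) = _ • (D.F j * (D.Kp i * x))
    rw [← mul_assoc, KF, smul_mul_assoc, mul_assoc]
  have hK' : ∀ i, ∀ x ∈ B, D.Km i * x ∈ B := by
    intro i
    refine wspan_skew (LinearMap.mulLeft ℂ (D.Km i)) (hTK' i) (fun j => D.q ^ ((D.d i : ℤ) * D.a i j)) ?_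
    intro j x
    show D.Km i * (D.F j * x) = _ • (D.F j * (D.Km i * x))
    rw [← mul_assoc, KmF, smul_mul_assoc, mul_assoc]
  have h2 := wspanE_stable (D := D) (Algebra.lmul ℂ D.U) B
    (fun i x hx => wspan_f (fun j => LinearMap.mulLeft ℂ (D.F j)) T i hx) hK hK'
  have h3 := h2 u 1 (le_wspan _ _ (le_wspan _ _ hT1))
  have h4 : wspan (fun j => Algebra.lmul ℂ D.U (D.E j)) B ≤ N := wspan_le (hBP.trans hP) hE
  have := h4 h3
  simpa using this

/-- a highest/lowest weight matrix coefficient -/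
structure RElt (D : Oq) (r : D.A) (hw lw : Fin D.n → ℤ) : Prop where
  EL : ∀ i, D.L (D.E i) r = 0
  ER : ∀ i, D.R (D.E i) r = 0
  ac : ∀ g, D.act g r = (chi g.1 (-lw) * chi g.2 hw) • r

theorem RElt.Kp {r : D.A} {hw lw} (H : RElt D r hw lw) (i) :
    D.L (D.Kp i) r = D.q ^ ((D.d i : ℤ) * hw i) • r := by
  rw [LK_act, H.ac, chi_one, one_mul, chi_gK]

theorem RElt.RKp {r : D.A} {hw lw} (H : RElt D r hw lw) (i) :
    D.R (D.Kp i) r = D.q ^ ((D.d i : ℤ) * lw i) • r := by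
  rw [RK_act, H.ac, chi_one, mul_one, chi_inv, chi_gK]
  congr 1
  rw [← zpow_neg, Pi.neg_apply, mul_neg, neg_neg]

theorem Km_of_Kp {x : D.A} {i} {m : ℤ} (h : D.L (D.Kp i) x = D.q ^ m • x) :
    D.L (D.Km i) x = D.q ^ (-m) • x := by
  have h2 := congrArg (D.L (D.Km i)) h
  rw [← L_mul, KmKp1, L_one, map_smul] at h2
  conv_rhs => rw [h2]
  rw [smul_smul, ← zpow_add₀ D.hq.1, neg_add_cancel, zpow_zero, one_smul]

theorem normal_base {r : D.A} {hw lw : Fin D.n → ℤ} (H : RElt D r hw lw) {lam : Fin D.n → ℤ}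
    (g1 h : Fin D.n → ℂˣ) (hg1 : ∀ i, chi g1 (root D.a i) = D.q ^ (-((D.d i : ℤ) * lw i)))
    (hh : ∀ i, chi h (root D.a i) = D.q ^ ((D.d i : ℤ) * lam i)) (b0 : D.A)
    (hF0 : ∀ i, D.L (D.F i) b0 = 0) (hac0 : ∀ g, D.act (1, g) b0 = chi g lam • b0) :
    r * D.act (g1⁻¹, 1) b0 = (chi h (lw - hw) * chi g1 lam) • (b0 * r) := by
  let Cb : D.A → Prop := fun b => (∀ i, D.L (D.F i) b = 0) ∧ ∀ g, D.act (1, g) b = chi g lam • b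
  have hCbE : ∀ i b, Cb b → Cb (D.R (D.E i) b) := by
    intro i b hb
    refine ⟨fun j => by rw [LR, hb.1, map_zero], fun g => ?_⟩
    rw [act_R_E, chi_one, one_smul, hb.2, map_smul]
  have hCbK : ∀ i b, Cb b → D.L (D.Kp i) b = D.q ^ ((D.d i : ℤ) * lam i) • b := by
    intro i b hb
    rw [LK_act, hb.2, chi_gK]
  have hCbG : ∀ b, Cb b → Cb (D.act (g1⁻¹, 1) b) := by
    intro b hb
    refine ⟨fun i => by rw [act_L_F, hb.1]; simp, fun g => ?_⟩
    rw [act_comm, hb.2, map_smul]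
  let s : ℂ := chi h (lw - hw) * chi g1 lam
  let N : Submodule ℂ D.U :=
    { carrier := {u | ∀ b, Cb b → D.ι (r * D.act (g1⁻¹, 1) b) u = s * D.ι (b * r) u}
      add_mem' := fun {u v} hu hv b hb => by rw [map_add, map_add, hu b hb, hv b hb, mul_add]
      zero_mem' := fun b hb => by simp
      smul_mem' := fun c u hu b hb => by
        rw [map_smul, map_smul, hu b hb, smul_eq_mul, smul_eq_mul]; ring }
  let P : Submodule ℂ D.U :=
    { carrier := {u | ∃ c' : D.A, (∀ g, D.act (g, 1) c' = chi g (-lw) • c') ∧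
        (∀ b, Cb b → D.L u (r * b) = D.act (1, h) c' * b) ∧
        (∀ b, Cb b → D.L u (b * r) = chi h hw • (b * c'))}
      add_mem' := by
        rintro u v ⟨c, h1, h2, h3⟩ ⟨c', h1', h2', h3'⟩
        refine ⟨c + c', fun g => by rw [map_add, h1, h1', smul_add], fun b hb => ?_, fun b hb => ?_⟩
        · rw [L_add, h2 b hb, h2' b hb, map_add, add_mul]
        · rw [L_add, h3 b hb, h3' b hb, mul_add, smul_add]
      zero_mem' := ⟨0, by simp, fun b hb => by rw [← zero_smul ℂ (1 : D.U), L_smul]; simp,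
        fun b hb => by rw [← zero_smul ℂ (1 : D.U), L_smul]; simp⟩
      smul_mem' := by
        rintro t u ⟨c, h1, h2, h3⟩
        refine ⟨t • c, fun g => by rw [map_smul, h1, smul_comm], fun b hb => ?_, fun b hb => ?_⟩
        · rw [L_smul, h2 b hb, map_smul, smul_mul_assoc]
        · rw [L_smul, h3 b hb, mul_smul_comm, smul_comm] }
  let T : Submodule ℂ D.U :=
    { carrier := {u | ∃ t : ℂ, (∀ b, Cb b → D.L u (r * b) = t • (r * b)) ∧
        (∀ b, Cb b → D.L u (b * r) = t • (b * r))}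
      add_mem' := by
        rintro u v ⟨c, h2, h3⟩ ⟨c', h2', h3'⟩
        exact ⟨c + c', fun b hb => by rw [L_add, h2 b hb, h2' b hb, add_smul],
          fun b hb => by rw [L_add, h3 b hb, h3' b hb, add_smul]⟩
      zero_mem' := ⟨0, fun b hb => by rw [← zero_smul ℂ (1 : D.U), L_smul]; simp,
        fun b hb => by rw [← zero_smul ℂ (1 : D.U), L_smul]; simp⟩
      smul_mem' := by
        rintro t u ⟨c, h2, h3⟩
        exact ⟨t * c, fun b hb => by rw [L_smul, h2 b hb, smul_smul],
          fun b hb => by rw [L_smul, h3 b hb, smul_smul]⟩ }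
  have hTP : T ≤ P := by
    rintro u ⟨t, h2, h3⟩
    refine ⟨((chi h hw)⁻¹ * t) • r, fun g => ?_, fun b hb => ?_, fun b hb => ?_⟩
    · rw [map_smul, H.ac, chi_one, mul_one, smul_comm]
    · rw [h2 b hb, map_smul, H.ac, chi_one, one_mul, smul_smul, smul_mul_assoc]
      congr 1
      field_simp [chi_ne h hw]
    · rw [h3 b hb, mul_smul_comm, smul_smul, ← mul_assoc, mul_inv_cancel₀ (chi_ne _ _), one_mul]
  have hPN : P ≤ N := by
    rintro u ⟨c', h1, h2, h3⟩ b hb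
    have e1 : D.ι (r * D.act (g1⁻¹, 1) b) u = D.ι (D.act (1, h) c' * D.act (g1⁻¹, 1) b) 1 := by
      rw [← h2 _ (hCbG b hb), ιL, one_mul]
    have e2 : D.ι (b * r) u = D.ι (chi h hw • (b * c')) 1 := by
      rw [← h3 _ hb, ιL, one_mul]
    have e3 : D.ι (D.act (1, h) c') 1 = chi h lw * D.ι c' 1 := by
      have : D.act (1, h) c' = chi h lw • D.act (h, h) c' := by
        have : D.act (h, h) c' = D.act (1, h) (D.act (h, 1) c') := by
          rw [act_act]; simp
        rw [this, h1, map_smul, smul_smul, mul_comm, chi_neg_mul, one_smul]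
      rw [this, map_smul, LinearMap.smul_apply, act_diag, smul_eq_mul]
    have e4 : D.ι (D.act (g1⁻¹, 1) b) 1 = chi g1 lam * D.ι b 1 := by
      have : D.act (g1⁻¹, 1) b = chi g1 lam • D.act (g1⁻¹, g1⁻¹) b := by
        have : D.act (g1⁻¹, g1⁻¹) b = D.act (g1⁻¹, 1) (D.act (1, g1⁻¹) b) := by
          rw [act_act]; simp
        rw [this, hb.2, map_smul, smul_smul, chi_inv, mul_inv_cancel₀ (chi_ne _ _), one_smul]
      rw [this, map_smul, LinearMap.smul_apply, act_diag, smul_eq_mul]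
    rw [e1, e2, ι_one_mul, e3, e4, map_smul, LinearMap.smul_apply, ι_one_mul, smul_eq_mul]
    show _ = chi h (lw - hw) * chi g1 lam * _
    rw [sub_eq_add_neg, chi_add, chi_neg]
    field_simp [chi_ne h hw]
  have key : ∀ u, u ∈ N := by
    refine tri N (hPN (hTP ⟨1, fun b _ => by rw [L_one, one_smul], fun b _ => by rw [L_one, one_smul]⟩)) P hPN
      ?_ ?_ T hTP ⟨1, fun b _ => by rw [L_one, one_smul], fun b _ => by rw [L_one, one_smul]⟩ ?_ ?_
    · intro i u hu b hb
      have h1 := hu _ (hCbE i b hb)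
      have e1 : D.R (D.E i) (r * D.act (g1⁻¹, 1) b) = r * D.act (g1⁻¹, 1) (D.R (D.E i) b) := by
        rw [R_E_mul, H.ER, zero_mul, zero_add, H.RKp, act_R_E, chi_inv, hg1, ← zpow_neg, neg_neg,
          smul_mul_assoc, mul_smul_comm]
      have e2 : D.R (D.E i) (b * r) = D.R (D.E i) b * r := by
        rw [R_E_mul, H.ER, mul_zero, add_zero]
      rw [← ιR, ← ιR, e1, e2]; exact h1
    · rintro i u ⟨c', h1, h2, h3⟩
      refine ⟨D.L (D.F i) c', fun g => ?_, fun b hb => ?_, fun b hb => ?_⟩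
      · have := act_L_F (g, 1) i c'
        rw [chi_one, one_smul, h1, map_smul] at this
        exact this.symm
      · rw [L_mul, h2 b hb, L_F_mul, hb.1, mul_zero, add_zero, Km_of_Kp (hCbK i b hb), act_L_F, hh,
          smul_mul_assoc, mul_smul_comm, smul_smul, ← zpow_add₀ D.hq.1, add_neg_cancel, zpow_zero, one_smul]
      · rw [L_mul, h3 b hb, map_smul, L_F_mul, hb.1, zero_mul, zero_add]
    · rintro i u ⟨t, h2, h3⟩
      refine ⟨t * D.q ^ ((D.d i : ℤ) * hw i + (D.d i : ℤ) * lam i), fun b hb => ?_, fun b hb => ?_⟩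
      · rw [L_mul, h2 b hb, map_smul, L_Kp_mul, H.Kp, hCbK i b hb, smul_mul_smul_comm, ← zpow_add₀ D.hq.1, smul_smul]
      · rw [L_mul, h3 b hb, map_smul, L_Kp_mul, H.Kp, hCbK i b hb, smul_mul_smul_comm, ← zpow_add₀ D.hq.1, smul_smul, add_comm]
    · rintro i u ⟨t, h2, h3⟩
      refine ⟨t * D.q ^ (-((D.d i : ℤ) * hw i) + -((D.d i : ℤ) * lam i)), fun b hb => ?_, fun b hb => ?_⟩
      · rw [L_mul, h2 b hb, map_smul, L_Km_mul, Km_of_Kp (H.Kp i), Km_of_Kp (hCbK i b hb), smul_mul_smul_comm,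
          ← zpow_add₀ D.hq.1, smul_smul]
      · rw [L_mul, h3 b hb, map_smul, L_Km_mul, Km_of_Kp (H.Kp i), Km_of_Kp (hCbK i b hb), smul_mul_smul_comm,
          ← zpow_add₀ D.hq.1, smul_smul, add_comm]
  refine A_eq fun u => ?_
  rw [key u b0 ⟨hF0, hac0⟩, map_smul, LinearMap.smul_apply, smul_eq_mul]


theorem chi_sum {n : ℕ} {κ : Type} (g : Fin n → ℂˣ) (s : Finset κ) (f : κ → Fin n → ℤ) :
    chi g (∑ k ∈ s, f k) = ∏ k ∈ s, chi g (f k) := by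
  classical
  induction s using Finset.induction_on with
  | empty => simp [chi_zero]
  | insert x s hx ih => rw [Finset.sum_insert hx, Finset.prod_insert hx, chi_add, ih]

theorem chi_nsmul {n : ℕ} (g : Fin n → ℂˣ) (m : ℕ) (μ : Fin n → ℤ) : chi g (m • μ) = chi g μ ^ m := by
  induction m with
  | zero => simp [chi_zero]
  | succ m ih => rw [succ_nsmul, chi_add, ih, pow_succ]

theorem chi_mk {n : ℕ} {q : ℂ} (hq : NotRU q) (e μ : Fin n → ℤ) :
    chi (fun k => Units.mk0 (q ^ e k) (hq.zpow_ne _)) μ = ∏ k, q ^ (e k * μ k) := by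
  rw [chi, Units.coe_prod]
  refine Finset.prod_congr rfl fun k _ => ?_
  rw [Units.val_zpow_eq_zpow_val, Units.val_mk0, zpow_mul]

theorem HL.relt {c : D.I} (H : HL D c) : RElt D (D.cf c H.xl H.vh) H.hw H.lw where
  EL i := by rw [L_cf, H.vhE]; exact (D.cfv c H.xl).map_zero
  ER i := by
    rw [R_cf]
    have : H.xl ∘ₗ D.ρ c (D.E i) = 0 := LinearMap.ext (H.xlE i)
    rw [this]; exact (D.cfx c H.vh).map_zero
  ac g := act_cf g H.xlw H.vhw

theorem prod_zpow_sum {n : ℕ} {q : ℂ} (hq : NotRU q) (e : Fin n → ℤ) :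
    ∏ k, q ^ (e k) = q ^ (∑ k, e k) := by
  have : ∀ s : Finset (Fin n), ∏ k ∈ s, q ^ (e k) = q ^ (∑ k ∈ s, e k) := by
    classical
    intro s
    induction s using Finset.induction_on with
    | empty => simp
    | insert x s hx ih => rw [Finset.sum_insert hx, Finset.prod_insert hx, zpow_add₀ hq.1, ih]
  exact this _

theorem normal {r : D.A} {hw lw : Fin D.n → ℤ} (H : RElt D r hw lw) (γ : Fin D.n → ℕ)
    (hγ : lw = hw - ∑ i, γ i • root D.a i) :
    ∃ g : (Fin D.n → ℂˣ) × (Fin D.n → ℂˣ),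
      (∀ i, chi g.2 (root D.a i) = D.q ^ (-((D.d i : ℤ) * hw i))) ∧
      ∀ x, r * x = D.act g x * r := by
  obtain ⟨g1, hg1⟩ := exists_torus (a := D.a) D.hq.1 D.hdet (fun i => -((D.d i : ℤ) * lw i))
  change ∀ i, chi g1 (root D.a i) = _ at hg1
  let δ : Fin D.n → ℂˣ := fun k => Units.mk0 (D.q ^ (-((D.d k : ℤ) * γ k))) (D.hq.zpow_ne _)
  have hδ : ∀ μ, chi δ μ = D.q ^ (∑ k, -((D.d k : ℤ) * γ k) * μ k) := by
    intro μ
    rw [← prod_zpow_sum D.hq]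
    exact chi_mk D.hq (fun k => -((D.d k : ℤ) * γ k)) μ
  have hg2 : ∀ i, chi (g1 * δ) (root D.a i) = D.q ^ (-((D.d i : ℤ) * hw i)) := by
    intro i
    rw [chi_mul, hg1, hδ, ← zpow_add₀ D.hq.1]
    congr 1
    have h1 : hw i = lw i + ∑ k, (γ k : ℤ) * D.a i k := by
      rw [hγ]; simp [root]
    rw [h1, mul_add, Finset.mul_sum, neg_add, ← Finset.sum_neg_distrib]
    congr 1
    refine Finset.sum_congr rfl fun k _ => ?_
    have := D.hsym i k
    show -((D.d k : ℤ) * γ k) * D.a k i = _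
    linear_combination (γ k : ℤ) * this
  refine ⟨(g1, g1 * δ), hg2, ?_⟩
  have hE : ∀ i x, r * x = D.act (g1, g1 * δ) x * r →
      r * D.L (D.E i) x = D.act (g1, g1 * δ) (D.L (D.E i) x) * r := by
    intro i x hx
    have h1 := congrArg (D.L (D.E i)) hx
    rw [L_E_mul, L_E_mul, H.EL, zero_mul, zero_add, mul_zero, add_zero, H.Kp, smul_mul_assoc] at h1
    rw [act_L_E, hg2, smul_mul_assoc, ← h1, smul_smul, ← zpow_add₀ D.hq.1, neg_add_cancel, zpow_zero, one_smul]
  have hER : ∀ i x, r * x = D.act (g1, g1 * δ) x * r →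
      r * D.R (D.E i) x = D.act (g1, g1 * δ) (D.R (D.E i) x) * r := by
    intro i x hx
    have h1 := congrArg (D.R (D.E i)) hx
    rw [R_E_mul, R_E_mul, H.ER, zero_mul, zero_add, mul_zero, add_zero, H.RKp, smul_mul_assoc] at h1
    rw [act_R_E, hg1, smul_mul_assoc, ← h1, smul_smul, ← zpow_add₀ D.hq.1, neg_add_cancel, zpow_zero, one_smul]
  let T : Submodule ℂ D.A :=
    { carrier := {x | r * x = D.act (g1, g1 * δ) x * r}
      add_mem' := fun {x y} hx hy => by
        show r * (x + y) = _
        rw [mul_add, map_add, add_mul, hx, hy]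
      zero_mem' := by show r * 0 = _; simp
      smul_mem' := fun c x hx => by
        show r * (c • x) = _
        rw [mul_smul_comm, map_smul, smul_mul_assoc, hx] }
  refine fun x => A_ind0 (P := fun x => r * x = D.act (g1, g1 * δ) x * r) ?_ ?_ ?_ ?_ x
  · intro t
    rw [AlgEquiv.commutes, Algebra.commutes]
  · intro x y hx hy
    exact T.add_mem hx hy
  · intro x y hx hy
    rw [← mul_assoc, hx, mul_assoc, hy, map_mul, mul_assoc]
  · intro c ξ v
    obtain ⟨H'⟩ := D.exists_HL c
    have hb : D.cf c H'.xh H'.vl ∈ T := by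
      show r * D.cf c H'.xh H'.vl = D.act (g1, g1 * δ) (D.cf c H'.xh H'.vl) * r
      obtain ⟨h, hh⟩ := exists_torus (a := D.a) D.hq.1 D.hdet (fun i => ((D.d i : ℤ) * H'.lw i))
      change ∀ i, chi h (root D.a i) = _ at hh
      have h1 := normal_base H (lam := H'.lw) g1 h hg1 hh (D.cf c H'.xh H'.vl)
        (fun i => by rw [L_cf, H'.vlF]; exact (D.cfv c H'.xh).map_zero)
        (fun g => by rw [act_cf _ H'.xhw H'.vlw, chi_one, one_mul])
      have h2 : chi h (lw - hw) = chi δ H'.lw := by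
        have : lw - hw = - ∑ i, γ i • root D.a i := by rw [hγ]; abel
        rw [this, chi_neg, chi_sum, hδ, ← Finset.prod_inv_distrib, ← prod_zpow_sum D.hq]
        refine Finset.prod_congr rfl fun k _ => ?_
        rw [chi_nsmul, hh, ← zpow_natCast, ← zpow_mul, ← zpow_neg]
        congr 1; ring
      rw [act_cf _ H'.xhw H'.vlw, chi_one, mul_one, chi_inv, chi_neg, inv_inv, mul_smul_comm, h2] at h1
      rw [act_cf _ H'.xhw H'.vlw, smul_mul_assoc, chi_neg, chi_mul, mul_comm (chi g1 H'.lw), ← smul_smul, ← h1, smul_smul,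
        inv_mul_cancel₀ (chi_ne _ _), one_smul]
    have h1 : ∀ v, D.cf c H'.xh v ∈ T := by
      have : wspan (fun j => D.ρ c (D.E j)) (Submodule.span ℂ {H'.vl}) ≤ T.comap (D.cfv c H'.xh) := by
        refine wspan_le ?_ ?_
        · rw [Submodule.span_singleton_le_iff_mem]; exact hb
        · intro j x hx
          have := hE j _ hx
          show D.cf c H'.xh (D.ρ c (D.E j) x) ∈ T
          rw [← L_cf]; exact this
      rw [gen_vl] at this
      exact fun v => this (Submodule.mem_top (x := v))
    have h2 : ∀ ξ, D.cf c ξ v ∈ T := by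
      have : wspan (fun j => D.KT c (D.E j)) (Submodule.span ℂ {H'.xh}) ≤ T.comap (D.cfx c v) := by
        refine wspan_le ?_ ?_
        · rw [Submodule.span_singleton_le_iff_mem]; exact h1 v
        · intro j x hx
          have := hER j _ hx
          show D.cf c (D.KT c (D.E j) x) v ∈ T
          rw [KT_apply, ← R_cf]; exact this
      rw [gen_xh] at this
      exact fun v => this (Submodule.mem_top (x := v))
    exact h2 ξ

end Oq
end OQ

open scoped TensorProduct
namespace OQ

/-- Normal, completely prime, separated elements. -/
structure Good {A : Type} [Ring A] (r : A) : Prop where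
  r0 : r ≠ 0
  dom : ∀ x y : A, x * y = 0 → x = 0 ∨ y = 0
  nl : ∀ x, ∃ y, r * x = y * r
  nr : ∀ x, ∃ y, x * r = r * y
  cp : ∀ x y, (∃ z, x * y = r * z) → (∃ z, x = r * z) ∨ (∃ z, y = r * z)
  sep : ∀ x, (∀ m : ℕ, ∃ y, x = r ^ m * y) → x = 0

theorem Good.npow {A : Type} [Ring A] {r : A} (h : ∀ x, ∃ y, r * x = y * r) (m : ℕ) :
    ∀ x, ∃ y, r ^ m * x = y * r ^ m := by
  induction m with
  | zero => exact fun x => ⟨x, by simp⟩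
  | succ m ih =>
    intro x
    obtain ⟨y, hy⟩ := ih x
    obtain ⟨z, hz⟩ := h y
    exact ⟨z, by rw [pow_succ', mul_assoc, hy, ← mul_assoc, hz, mul_assoc, ← pow_succ', pow_succ']⟩

theorem Good.unop {A : Type} [Ring A] {r : Aᵐᵒᵖ} (G : Good r) : Good r.unop where
  r0 h := G.r0 (MulOpposite.unop_injective h)
  dom x y h := by
    rcases G.dom (MulOpposite.op y) (MulOpposite.op x) (by rw [← MulOpposite.op_mul, h]; rfl) with h | h
    · exact Or.inr (MulOpposite.op_injective h)
    · exact Or.inl (MulOpposite.op_injective h)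
  nl x := by
    obtain ⟨y, hy⟩ := G.nr (MulOpposite.op x)
    exact ⟨y.unop, congrArg MulOpposite.unop hy⟩
  nr x := by
    obtain ⟨y, hy⟩ := G.nl (MulOpposite.op x)
    exact ⟨y.unop, congrArg MulOpposite.unop hy⟩
  cp x y := by
    have key : ∀ x : A, (∃ z, x = r.unop * z) ↔ ∃ z, MulOpposite.op x = r * z := by
      intro x
      constructor
      · rintro ⟨z, rfl⟩
        obtain ⟨y, hy⟩ := G.nr (MulOpposite.op z)
        exact ⟨y, hy⟩
      · rintro ⟨z, hz⟩
        obtain ⟨y, hy⟩ := G.nl z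
        exact ⟨y.unop, congrArg MulOpposite.unop (hz.trans hy)⟩
    rw [key, key, key]
    intro h
    exact (G.cp (MulOpposite.op y) (MulOpposite.op x) h).symm
  sep x h := by
    refine MulOpposite.op_injective (G.sep (MulOpposite.op x) fun m => ?_)
    obtain ⟨y, hy⟩ := h m
    obtain ⟨z, hz⟩ := Good.npow (r := r.unop) (fun x => by
      obtain ⟨y, hy⟩ := G.nr (MulOpposite.op x)
      exact ⟨y.unop, congrArg MulOpposite.unop hy⟩) m y
    refine ⟨MulOpposite.op z, ?_⟩
    rw [hy, hz]; rfl

theorem Good.not_one {A : Type} [Ring A] {r : A} (G : Good r) : ¬ ∃ z, (1 : A) = r * z := by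
  rintro ⟨z, hz⟩
  have : ∀ m : ℕ, (1 : A) = r ^ m * z ^ m := by
    intro m
    induction m with
    | zero => simp
    | succ m ih => rw [pow_succ, pow_succ', mul_assoc, ← mul_assoc r, ← hz, one_mul, ← ih]
  have h0 := G.sep 1 (fun m => ⟨_, this m⟩)
  exact G.r0 (by rw [← mul_one r, h0, mul_zero])

/-- the ideal generated by a good element -/
theorem Good.mem_span {A : Type} [Ring A] {r : A} (G : Good r) (x : A) :
    x ∈ TwoSidedIdeal.span {r} ↔ ∃ z, x = r * z := by
  constructor
  · intro hx
    let J : TwoSidedIdeal A := TwoSidedIdeal.mk' {x | ∃ z, x = r * z} ⟨0, by simp⟩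
      (by rintro _ _ ⟨z, rfl⟩ ⟨w, rfl⟩; exact ⟨z + w, by rw [mul_add]⟩)
      (by rintro _ ⟨z, rfl⟩; exact ⟨-z, by rw [mul_neg]⟩)
      (by
        rintro x _ ⟨z, rfl⟩
        obtain ⟨y, hy⟩ := G.nr x
        exact ⟨y * z, by rw [← mul_assoc, hy, mul_assoc]⟩)
      (by rintro _ y ⟨z, rfl⟩; exact ⟨z * y, by rw [mul_assoc]⟩)
    have hle : TwoSidedIdeal.span {r} ≤ J := by
      rw [TwoSidedIdeal.span_le]
      rintro _ rfl
      exact (TwoSidedIdeal.mem_mk' _ _ _ _ _ _ _).mpr ⟨1, by simp⟩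
    have h3 := hle hx
    rw [TwoSidedIdeal.mem_mk'] at h3
    exact h3
  · rintro ⟨z, rfl⟩
    exact TwoSidedIdeal.mul_mem_right _ _ _ (TwoSidedIdeal.subset_span rfl)

theorem Good.final {A : Type} [Ring A] {r : A} (G : Good r) (Q' : TwoSidedIdeal A) (hQ' : IsPrimeTwoSided Q')
    (h0 : Q' ≠ ⊥) (hle : Q' ≤ TwoSidedIdeal.span {r}) : Q' = TwoSidedIdeal.span {r} := by
  by_cases hr : r ∈ Q'
  · refine le_antisymm hle ?_
    rw [TwoSidedIdeal.span_le]
    rintro _ rfl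
    exact hr
  · exfalso
    have hstep : ∀ y, r * y ∈ Q' → y ∈ Q' := by
      intro y hy
      refine (hQ'.2 r y fun s => ?_).resolve_left hr
      obtain ⟨t, ht⟩ := G.nl s
      rw [ht, mul_assoc]
      exact TwoSidedIdeal.mul_mem_left _ _ _ hy
    have hpow : ∀ m : ℕ, ∀ x ∈ Q', ∃ y ∈ Q', x = r ^ m * y := by
      intro m
      induction m with
      | zero => exact fun x hx => ⟨x, hx, by simp⟩
      | succ m ih =>
        intro x hx
        obtain ⟨y, hy, rfl⟩ := ih x hx
        obtain ⟨z, rfl⟩ := (G.mem_span y).mp (hle hy)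
        exact ⟨z, hstep z hy, by rw [pow_succ, mul_assoc]⟩
    apply h0
    rw [eq_bot_iff]
    intro x hx
    have : x = 0 := G.sep x fun m => by
      obtain ⟨y, -, hy⟩ := hpow m x hx
      exact ⟨y, hy⟩
    rw [this]
    exact TwoSidedIdeal.zero_mem _

theorem Good.prime {A : Type} [Ring A] {r : A} (G : Good r) : IsPrimeTwoSided (TwoSidedIdeal.span {r}) := by
  refine ⟨fun h => ?_, fun x y h => ?_⟩
  · have : (1 : A) ∈ TwoSidedIdeal.span {r} := by rw [h]; trivial
    exact G.not_one ((G.mem_span 1).mp this)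
  · have h1 := h 1
    rw [mul_one, G.mem_span] at h1
    rw [G.mem_span, G.mem_span]
    exact G.cp x y h1

theorem QHyp.good {n : ℕ} {q : ℂ} {d : Fin n → ℕ} {a : Fin n → Fin n → ℤ}
    {A : Type} [Ring A] [Algebra ℂ A] {D : QAct q d a A} {j : Fin n} {r : A} (H : QHyp D j r) : Good r where
  r0 := H.r0
  dom := H.dom
  nl x := ⟨_, H.hσ x⟩
  nr x := ⟨_, H.mul_r x⟩
  cp x y := by
    rintro ⟨z, hz⟩
    rcases H.completely_prime (H.mem_I.mpr ⟨z, hz.symm⟩) with h | h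
    · obtain ⟨w, hw⟩ := H.mem_I.mp h
      exact Or.inl ⟨w, hw.symm⟩
    · obtain ⟨w, hw⟩ := H.mem_I.mp h
      exact Or.inr ⟨w, hw.symm⟩
  sep := H.separated

namespace Oq
variable {D : Oq}

theorem exists_fund (hS : Surj D) (j : Fin D.n) : ∃ r : D.A, Good r ∧ (∀ g, ∃ z : ℂ, D.act g r = z • r) ∧
    ∀ Y : Submodule ℂ D.A, (∀ y ∈ Y, ∀ b, b * y ∈ Y ∧ y * b ∈ Y) → (∀ g, ∀ y ∈ Y, D.act g y ∈ Y) →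
      (∀ x y, (∀ s, x * s * y ∈ Y) → x ∈ Y ∨ y ∈ Y) → r ∉ Y → ∀ y ∈ Y, D.L (D.F j) y ∈ Y := by
  obtain ⟨c, v, hv0, hvw, hvE⟩ := hS (Pi.single j 1) (fun i => by
    by_cases h : i = j
    · subst h; simp
    · simp [h])
  obtain ⟨H⟩ := D.exists_HL c
  have hw : H.hw = Pi.single j 1 := by
    by_contra hne
    exact hv0 (hw_unique H hvw hvE (H.xhw.pair hvw (Ne.symm hne)))
  obtain ⟨g, hg, hn⟩ := normal H.relt H.γ H.hγ
  set r := D.cf c H.xl H.vh with hr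
  have r0 : r ≠ 0 := by
    intro h
    let N : Submodule ℂ (D.V c) :=
      { carrier := {x | ∀ u, H.xl (D.ρ c u x) = 0}
        add_mem' := fun hx hy u => by rw [map_add, map_add, hx u, hy u, add_zero]
        zero_mem' := fun u => by simp
        smul_mem' := fun t x hx u => by rw [map_smul, map_smul, hx u, smul_zero] }
    have hN : H.vh ∈ N := fun u => by rw [← D.hcf, ← hr, h]; simp
    rcases D.hsimple c N (fun u x hx u' => by
      rw [← Module.End.mul_apply, ← map_mul]; exact hx _) with h1 | h1
    · rw [h1] at hN
      exact H.vh0 hN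
    · have h2 : H.vl ∈ N := by rw [h1]; trivial
      have h3 := h2 1
      rw [map_one, Module.End.one_apply] at h3
      exact H.xlv h3
  have fact : ∀ x, D.L (D.F j * D.Kp j) (D.act g x) =
      D.q ^ (-(D.d j : ℤ)) • D.act g (D.L (D.F j * D.Kp j) x) := by
    intro x
    rw [L_mul, LK_act, act_comm, ← LK_act, act_L_F, hg, hw, ← L_mul]
    simp
  have hK : D.L (D.Kp j) r = D.q ^ (D.d j : ℤ) • r := by
    have := H.relt.Kp j
    rw [hw] at this
    simpa using this
  have Q : QHyp D.Q j r :=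
    { hq := D.hq, hd := D.hd, ha := D.ha, hsym := D.hsym, hR := D.hR, dom := D.dom
      wts := D.wtsL
      enil := D.enil
      fnil := fun i x => by
        obtain ⟨m, hm⟩ := D.fnil x
        exact ⟨m, mem_nilE_zero.mp (nilE_epow (fun j => D.L (D.F j * D.Kp j)) i 0 m _ (by rwa [zero_add]))⟩
      hopf := hopf hS
      r0 := r0
      er := H.relt.EL
      rwt := fun i => by rw [← hw]; exact H.relt.Kp i
      fr := fun i hi => by
        rw [Q_f, L_mul, H.relt.Kp, map_smul, L_cf, F_vh H hw i hi]
        have := (D.cfv c H.xl).map_zero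
        rw [show D.cf c H.xl 0 = 0 from this, smul_zero]
      ffr := by
        rw [Q_f, Q_f, L_mul, L_mul, H.relt.Kp, map_smul, map_smul, map_smul, ← L_mul (D.Kp j), KF, L_smul, L_mul, H.relt.Kp,
          map_smul, map_smul, map_smul, L_cf, L_cf, FF_vh H hw]
        have := (D.cfv c H.xl).map_zero
        rw [show D.cf c H.xl 0 = 0 from this, smul_zero, smul_zero, smul_zero]
      κ := D.act (1, D.gK j)
      hκ := fun x => (LK_act j x).symm
      σ := D.act g
      hσ := hn
      θ := D.q ^ (-(D.d j : ℤ))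
      hθ := D.hq.zpow_ne _
      σf := fact }
  refine ⟨r, Q.good, fun h => ⟨_, H.relt.ac h⟩, ?_⟩
  intro Y hY hYa hYp hrY
  have hf : ∀ y ∈ Y, D.L (D.F j * D.Kp j) y ∈ Y := by
    intro y hy
    have h1 := congrArg (D.L (D.F j * D.Kp j)) (hn y)
    have hm := D.Q.f_mul j
    simp only [Q_f, Q_k] at hm
    rw [hm, hm, fact, hK, smul_mul_assoc, smul_mul_assoc, ← hn] at h1
    have h2 : (D.q ^ (D.d j : ℤ) - D.q ^ (-(D.d j : ℤ))) • (r * D.L (D.F j * D.Kp j) y) ∈ Y := by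
      have : (D.q ^ (D.d j : ℤ) - D.q ^ (-(D.d j : ℤ))) • (r * D.L (D.F j * D.Kp j) y) =
          D.L (D.Kp j) (D.act g y) * D.L (D.F j * D.Kp j) r - D.L (D.F j * D.Kp j) r * y := by
        rw [sub_smul, sub_eq_sub_iff_add_eq_add, add_comm, h1, add_comm]
      rw [this, LK_act]
      exact Y.sub_mem (hY _ (hYa _ _ (hYa _ _ hy)) _).2 (hY _ hy _).1
    have h3 : r * D.L (D.F j * D.Kp j) y ∈ Y := by
      have := Y.smul_mem (D.q ^ (D.d j : ℤ) - D.q ^ (-(D.d j : ℤ)))⁻¹ h2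
      rwa [smul_smul, inv_mul_cancel₀ (qq_ne j), one_smul] at this
    refine (hYp r _ fun s => ?_).resolve_left hrY
    rw [hn s, mul_assoc]
    exact (hY _ h3 _).1
  intro y hy
  have h1 := hf _ (Km_stable Y (fun i y hy => by rw [LK_act]; exact hYa _ _ hy) j y hy)
  rwa [← L_mul, mul_assoc, KpKm1, mul_one] at h1

/-- the version for the opposite algebra -/
theorem exists_fund' (hS : Surj D) (j : Fin D.n) : ∃ r : D.A, Good r ∧ (∀ g, ∃ z : ℂ, D.act g r = z • r) ∧
    ∀ Y : Submodule ℂ D.A, (∀ y ∈ Y, ∀ b, b * y ∈ Y ∧ y * b ∈ Y) → (∀ g, ∀ y ∈ Y, D.act g y ∈ Y) →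
      (∀ x y, (∀ s, x * s * y ∈ Y) → x ∈ Y ∨ y ∈ Y) → r ∉ Y → ∀ y ∈ Y, D.L (D.E j) y ∈ Y := by
  obtain ⟨r, hG, ha, hY⟩ := exists_fund (D := D.op) (surj_op hS) j
  change D.Aᵐᵒᵖ at r
  refine ⟨r.unop, Good.unop hG, ?_, ?_⟩
  · intro g
    obtain ⟨z, hz⟩ := ha g⁻¹
    refine ⟨z, ?_⟩
    have h2 : D.act (g⁻¹)⁻¹ r.unop = z • r.unop := congrArg MulOpposite.unop hz
    rwa [inv_inv] at h2
  · intro Y h1 h2 h3 h4 y hy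
    let Y' : Submodule ℂ D.Aᵐᵒᵖ := Y.comap (MulOpposite.opLinearEquiv ℂ).symm.toLinearMap
    have hmem : ∀ x : D.Aᵐᵒᵖ, x ∈ Y' ↔ x.unop ∈ Y := fun x => Iff.rfl
    have key := hY Y' (fun y hy b => ⟨(h1 _ hy _).2, (h1 _ hy _).1⟩)
      (fun g y hy => h2 g⁻¹ _ hy)
      (fun (x y : D.Aᵐᵒᵖ) h => by
        have := h3 (MulOpposite.unop y) (MulOpposite.unop x) (fun s => by
          have := h (MulOpposite.op s)
          have e : MulOpposite.unop y * (s * MulOpposite.unop x) ∈ Y := this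
          rw [← mul_assoc] at e
          exact e)
        exact this.symm) h4 (MulOpposite.op y) hy
    have e : D.op.L (D.op.F j) (MulOpposite.op y) = MulOpposite.op (D.L (D.E j) y) :=
      A_eq (D := D.op) fun u => by
        exact (ιL (D := D.op) (D.E j) (MulOpposite.op y) u).trans (ιL (D := D) (D.E j) y u).symm
    rw [e] at key
    exact key

theorem main (hS : Surj D) (P : TwoSidedIdeal D.A) (hP : IsPrimeTwoSided P)
    (hPa : ∀ g x, x ∈ P → D.act g x ∈ P) (hP0 : P ≠ ⊥) :
    ∃ r ∈ P, Good r ∧ ∀ g, ∃ z : ℂ, D.act g r = z • r := by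
  by_contra hcon
  push Not at hcon
  let Y : Submodule ℂ D.A :=
    { carrier := {x | x ∈ P}
      add_mem' := fun hx hy => P.add_mem hx hy
      zero_mem' := P.zero_mem
      smul_mem' := fun t x hx => by
        show t • x ∈ P
        rw [Algebra.smul_def]
        exact P.mul_mem_left _ _ hx }
  have hYi : ∀ y ∈ Y, ∀ b, b * y ∈ Y ∧ y * b ∈ Y := fun y hy b => ⟨P.mul_mem_left _ _ hy, P.mul_mem_right _ _ hy⟩
  have hYa : ∀ g, ∀ y ∈ Y, D.act g y ∈ Y := fun g y hy => hPa g y hy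
  have hF : ∀ j, ∀ y ∈ Y, D.L (D.F j) y ∈ Y := by
    intro j
    obtain ⟨r, hG, ha, h⟩ := exists_fund hS j
    refine h Y hYi hYa hP.2 (fun hr => ?_)
    obtain ⟨g, hg⟩ := hcon r hr hG
    obtain ⟨z, hz⟩ := ha g
    exact hg z hz
  have hE : ∀ j, ∀ y ∈ Y, D.L (D.E j) y ∈ Y := by
    intro j
    obtain ⟨r, hG, ha, h⟩ := exists_fund' hS j
    refine h Y hYi hYa hP.2 (fun hr => ?_)
    obtain ⟨g, hg⟩ := hcon r hr hG
    obtain ⟨z, hz⟩ := ha g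
    exact hg z hz
  have hK : ∀ j, ∀ y ∈ Y, D.L (D.Kp j) y ∈ Y := fun j y hy => by rw [LK_act]; exact hYa _ _ hy
  have h1 : (1 : D.A) ∈ Y := by
    refine hopf hS Y ?_ (fun y hy b => (hYi y hy b).2) (fun i y hy => ⟨hE i y hy, ?_, hK i y hy⟩)
    · intro h
      apply hP0
      rw [eq_bot_iff]
      intro x hx
      have : x ∈ Y := hx
      rw [h, Submodule.mem_bot] at this
      rw [this]; exact TwoSidedIdeal.zero_mem _
    · rw [Q_f, L_mul]
      exact hF i _ (hK i y hy)
  apply hP.1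
  rw [eq_top_iff]
  intro x _
  have : x * 1 ∈ P := P.mul_mem_left _ _ h1
  rwa [mul_one] at this

theorem main' (hS : Surj D) (P : TwoSidedIdeal D.A) (hP : IsPrimeTwoSided P)
    (hPa : ∀ g x, x ∈ P → D.act g x ∈ P) (hP0 : P ≠ ⊥) :
      ∃ Q : TwoSidedIdeal D.A, Q ≤ P ∧ IsPrimeTwoSided Q ∧ (∀ g x, x ∈ Q → D.act g x ∈ Q) ∧
        Q ≠ ⊥ ∧ (∀ Q' : TwoSidedIdeal D.A, IsPrimeTwoSided Q' → Q' ≠ ⊥ → Q' ≤ Q → Q' = Q) ∧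
        ∃ r : D.A, r ≠ 0 ∧ IsNormalElem r ∧ (∀ g, ∃ z : ℂ, D.act g r = z • r) ∧
          Q = TwoSidedIdeal.span {r} := by
  obtain ⟨r, hr, G, ha⟩ := main hS P hP hPa hP0
  refine ⟨TwoSidedIdeal.span {r}, ?_, G.prime, ?_, ?_, G.final, r, G.r0, ⟨G.nl, G.nr⟩, ha, rfl⟩
  · rw [TwoSidedIdeal.span_le]
    rintro _ rfl
    exact hr
  · intro g x hx
    rw [G.mem_span] at hx ⊢
    obtain ⟨z, rfl⟩ := hx
    obtain ⟨t, ht⟩ := ha g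
    exact ⟨t • D.act g z, by rw [map_mul, ht, smul_mul_assoc, mul_smul_comm]⟩
  · intro h
    have : r ∈ (⊥ : TwoSidedIdeal D.A) := by rw [← h]; exact TwoSidedIdeal.subset_span rfl
    exact G.r0 (by simpa using this)

end Oq
end OQ

open scoped TensorProduct
namespace OQ
theorem mem_wtSp {q : ℂ} {n : ℕ} {d : Fin n → ℕ}
    {U : Type} [Ring U] [Algebra ℂ U] {K : Fin n → Uˣ}
    {Vc : Type} [AddCommGroup Vc] [Module ℂ Vc] {ρ : U →ₐ[ℂ] Module.End ℂ Vc}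
    {μ : Fin n → ℤ} {x : Vc} : x ∈ wtSp q d K ρ μ ↔ IsWt q d (fun j => ρ (K j : U)) μ x := by
  rw [wtSp, Submodule.mem_iInf]
  refine forall_congr' fun i => ?_
  rw [LinearMap.mem_ker, LinearMap.sub_apply, sub_eq_zero, LinearMap.smul_apply, Module.End.one_apply,
    mul_comm]
end OQ

open scoped TensorProduct
theorem OqG_H_UFD
    -- the deformation parameter: a transcendental complex number
    (q : ℂ) (hq : Transcendental ℚ q)
    -- Cartan data of the complex semisimple Lie algebra 𝔤 of rank n
    (n : ℕ) (hn : 0 < n) (a : Fin n → Fin n → ℤ) (d : Fin n → ℕ)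
    (ha_diag : ∀ i, a i i = 2) (ha_off : ∀ i j, i ≠ j → a i j ≤ 0)
    (ha_zero : ∀ i j, a i j = 0 ↔ a j i = 0)
    (hd_pos : ∀ i, 0 < d i)
    (ha_symm : ∀ i j, (d i : ℤ) * a i j = (d j : ℤ) * a j i)
    -- the quantised enveloping algebra U = U_q(𝔤): carries elements E i, F i and units K i
    -- satisfying the defining relations, and is universal for these relations
    (U : Type) [Ring U] [Algebra ℂ U]
    (E F : Fin n → U) (K : Fin n → Uˣ)
    (hrel : UqRels q a d U E F K)
    (hUuniv : ∀ (B : Type) [Ring B] [Algebra ℂ B] (E' F' : Fin n → B) (K' : Fin n → Bˣ),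
      UqRels q a d B E' F' K' → ∃! φ : U →ₐ[ℂ] B,
        (∀ i, φ (E i) = E' i) ∧ (∀ i, φ (F i) = F' i) ∧ (∀ i, φ (K i : U) = (K' i : B)))
    -- the Hopf algebra structure of U_q(𝔤)
    (Δ : U →ₐ[ℂ] U ⊗[ℂ] U) (ε : U →ₐ[ℂ] ℂ)
    (hΔE : ∀ i, Δ (E i) = E i ⊗ₜ 1 + (K i : U) ⊗ₜ E i)
    (hΔF : ∀ i, Δ (F i) = F i ⊗ₜ (((K i)⁻¹ : Uˣ) : U) + 1 ⊗ₜ F i)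
    (hΔK : ∀ i, Δ (K i : U) = (K i : U) ⊗ₜ (K i : U))
    (hεE : ∀ i, ε (E i) = 0) (hεF : ∀ i, ε (F i) = 0) (hεK : ∀ i, ε (K i : U) = 1)
    -- the Weyl group W, acting faithfully on the weight lattice P = ℤⁿ (coordinates taken in
    -- the basis of fundamental weights ϖ i), generated by the simple reflections s i, with
    -- longest element w₀ (characterised by: w₀ maps dominant weights to antidominant ones)
    (W : Type) [Group W] [Finite W] (σ : W →* Multiplicative (AddAut (Fin n → ℤ)))
    (hσinj : Function.Injective σ)
    (s : Fin n → W) (hsgen : Subgroup.closure (Set.range s) = ⊤)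
    (hs : ∀ i (μ : Fin n → ℤ), σ (s i) μ = fun k => μ k - μ i * a k i)
    (w₀ : W) (hw₀ : ∀ μ : Fin n → ℤ, (∀ i, 0 ≤ μ i) → ∀ i, σ w₀ μ i ≤ 0)
    -- the simple finite-dimensional modules V(λ) of highest weight λ = ∑ c i ϖ i ∈ P⁺
    (V : (Fin n → ℕ) → Type) [∀ c, AddCommGroup (V c)] [∀ c, Module ℂ (V c)]
    (ρ : ∀ c, U →ₐ[ℂ] Module.End ℂ (V c))
    (hfd : ∀ c, FiniteDimensional ℂ (V c))
    (hsimple : ∀ c (N : Submodule ℂ (V c)), (∀ (u : U), ∀ v ∈ N, ρ c u v ∈ N) → N = ⊥ ∨ N = ⊤)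
    (hhw : ∀ c, ∃ v : V c, v ≠ 0 ∧ v ∈ wtSp q d K (ρ c) (fun i => (c i : ℤ)) ∧
      ∀ i, ρ c (E i) v = 0)
    (hwtsum : ∀ c, (⨆ μ : Fin n → ℤ, wtSp q d K (ρ c) μ) = ⊤)
    (hextremal : ∀ c (w : W),
      Module.finrank ℂ (wtSp q d K (ρ c) (σ w (fun i => (c i : ℤ)))) = 1)
    -- the quantised coordinate ring A = O_q(G): an algebra of linear forms on U (via the
    -- injection ι into the dual space, multiplication being convolution through Δ),
    -- generated by the coordinate functions cf c ξ v = c^λ_{ξ,v} : u ↦ ξ (u · v)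
    (A : Type) [Ring A] [Algebra ℂ A]
    (ι : A →ₗ[ℂ] (U →ₗ[ℂ] ℂ)) (hιinj : Function.Injective ι)
    (hι1 : ι 1 = ε.toLinearMap)
    (hιmul : ∀ x y : A, ι (x * y) =
      (TensorProduct.lid ℂ ℂ).toLinearMap ∘ₗ (TensorProduct.map (ι x) (ι y)) ∘ₗ Δ.toLinearMap)
    (cf : ∀ c : Fin n → ℕ, Module.Dual ℂ (V c) → V c → A)
    (hcf : ∀ c ξ v u, ι (cf c ξ v) u = ξ (ρ c u v))
    (hAgen : Algebra.adjoin ℂ {x : A | ∃ c ξ v, x = cf c ξ v} = ⊤)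
    -- the rational action of the torus 𝓗 = (ℂ*)ⁿ × (ℂ*)ⁿ on O_q(G), by which a pair
    -- (g₁, g₂) rescales a coordinate function c^λ_{ξ,v} with ξ of weight μ and v of
    -- weight η by the scalar g₁(μ) g₂(η)
    (act : (Fin n → ℂˣ) × (Fin n → ℂˣ) →* (A ≃ₐ[ℂ] A))
    (hact : ∀ g c (ξ : Module.Dual ℂ (V c)) v (μ η : Fin n → ℤ),
      inDualWt q d K (ρ c) μ ξ → v ∈ wtSp q d K (ρ c) η →
      act g (cf c ξ v) =
        ((((∏ i, g.1 i ^ μ i) * (∏ i, g.2 i ^ η i) : ℂˣ) : ℂ)) • cf c ξ v) :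
    -- O_q(G) is an 𝓗-UFD: every nonzero 𝓗-invariant prime ideal contains a height one
    -- 𝓗-invariant prime ideal generated by a normal 𝓗-eigenvector
    ∀ P : TwoSidedIdeal A, IsPrimeTwoSided P → (∀ g x, x ∈ P → act g x ∈ P) → P ≠ ⊥ →
      ∃ Q : TwoSidedIdeal A, Q ≤ P ∧ IsPrimeTwoSided Q ∧ (∀ g x, x ∈ Q → act g x ∈ Q) ∧
        Q ≠ ⊥ ∧ (∀ Q' : TwoSidedIdeal A, IsPrimeTwoSided Q' → Q' ≠ ⊥ → Q' ≤ Q → Q' = Q) ∧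
        ∃ r : A, r ≠ 0 ∧ IsNormalElem r ∧ (∀ g, ∃ z : ℂ, act g r = z • r) ∧
          Q = TwoSidedIdeal.span {r} := by
  intro P hP hPa hP0
  let D : OQ.Oq :=
    { q := q, n := n, a := a, d := d
      hq := OQ.notRU_of_transcendental hq
      ha := ha_diag, hd := hd_pos, hsym := ha_symm
      hR := OQ.refBound hd_pos hsgen ha_diag hs
      hdet := OQ.det_ne hsgen ha_diag hs
      U := U, iU1 := inferInstance, iU2 := inferInstance
      E := E, F := F, K := K, hrel := hrel, huniv := hUuniv
      Δ := Δ, ε := ε, hΔE := hΔE, hΔF := hΔF, hΔK := hΔK, hεE := hεE, hεF := hεF, hεK := hεK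
      I := Fin n → ℕ, V := V, iV1 := inferInstance, iV2 := inferInstance
      ρ := ρ, hfd := hfd, hsimple := hsimple
      hnt := fun c => by
        obtain ⟨v, hv, -⟩ := hhw c
        exact ⟨v, hv⟩
      hwt := fun c x => by
        have hx : x ∈ (⨆ μ : Fin n → ℤ, wtSp q d K (ρ c) μ) := by rw [hwtsum c]; trivial
        refine (iSup_le fun μ => ?_ : (⨆ μ : Fin n → ℤ, wtSp q d K (ρ c) μ) ≤ _) hx
        intro y hy
        exact Submodule.subset_span ⟨μ, OQ.mem_wtSp.mp hy⟩
      A := A, iA1 := inferInstance, iA2 := inferInstance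
      ι := ι, hιinj := hιinj
      hι1 := fun u => by rw [hι1]; rfl
      hιmul := fun x y u => by rw [hιmul]; rfl
      cf := cf, hcf := hcf, hAgen := hAgen
      act := act
      hact := fun g c ξ v μ η h1 h2 => by
        refine hact g c ξ v (-μ) η ?_ (OQ.mem_wtSp.mpr h2)
        intro ν hν x hx
        rw [neg_neg] at hν
        exact h1 ν hν x (OQ.mem_wtSp.mp hx) }
  have hS : OQ.Oq.Surj D := by
    intro μ hμ
    obtain ⟨v, hv0, hvw, hvE⟩ := hhw (fun i => (μ i).toNat)
    refine ⟨fun i => (μ i).toNat, v, hv0, ?_, hvE⟩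
    have h1 := OQ.mem_wtSp.mp hvw
    have h2 : (fun i => (((μ i).toNat : ℕ) : ℤ)) = μ := funext fun i => Int.toNat_of_nonneg (hμ i)
    rw [h2] at h1
    exact h1
  exact OQ.Oq.main' (D := D) hS P hP hPa hP0
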